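/- Let f : ℂ² → ℂ² be a biholomorphism (a holomorphic bijection with holomorphic inverse), and let p be a saddle fixed point of f: f(p) = p and the eigenvalues λˢ, λᵘ of Df_p satisfy |λˢ| < 1 < |λᵘ|. Assume p admits a homoclinic intersection: there exists τ ≠ p with fⁿ(τ) → p and f⁻ⁿ(τ) → p as n → ∞. Then there exist c, c' ∈ ℂ \ {0}, an integer N ≥ 1, and points (pₙ)_{n ≥ N} such that for every n ≥ N: fⁿ(pₙ) = pₙ, the eigenvalues λˢₙ, λᵘₙ of D(fⁿ)_{pₙ} satisfy |λˢₙ| < 1 < |λᵘₙ|, λˢₙ/(λˢ)ⁿ → c and λᵘₙ/(λᵘ)ⁿ → c' as n → ∞; moreover p lies in the closure of {pₙ : n ≥ N}, and the sequence can be chosen dense for the complex-analytic Zariski topology: every holomorphic function g : ℂ² → ℂ vanishing at every pₙ vanishes identically. -/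

import Mathlib

open Function Set Filter Topology

noncomputable section

/-- A polynomial map of `ℂ²`. -/
def IsPolyMap (F : ℂ × ℂ → ℂ × ℂ) : Prop :=
  ∃ P Q : MvPolynomial (Fin 2) ℂ, ∀ z : ℂ × ℂ,
    F z = (MvPolynomial.eval ![z.1, z.2] P, MvPolynomial.eval ![z.1, z.2] Q)

/-- A polynomial automorphism of `ℂ²`. -/
def IsPolyAuto (F : ℂ × ℂ → ℂ × ℂ) : Prop :=
  IsPolyMap F ∧ ∃ G : ℂ × ℂ → ℂ × ℂ, IsPolyMap G ∧
    (∀ z, G (F z) = z) ∧ (∀ z, F (G z) = z)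

/-- A generalized Hénon map. -/
def IsHenon (h : ℂ × ℂ → ℂ × ℂ) : Prop :=
  ∃ (p : Polynomial ℂ) (a : ℂ), a ≠ 0 ∧ 2 ≤ p.natDegree ∧
    ∀ z : ℂ × ℂ, h z = (Polynomial.eval z.1 p - a * z.2, z.1)

/-- A loxodromic automorphism of `ℂ²`. -/
def IsLoxodromic (f : ℂ × ℂ → ℂ × ℂ) : Prop :=
  IsPolyAuto f ∧
  ∃ (u uinv : ℂ × ℂ → ℂ × ℂ) (hs : List (ℂ × ℂ → ℂ × ℂ)),
    IsPolyAuto u ∧ (∀ z, uinv (u z) = z) ∧ (∀ z, u (uinv z) = z) ∧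
    hs ≠ [] ∧ (∀ h ∈ hs, IsHenon h) ∧
    ∀ z, f z = uinv (hs.foldr (fun h acc => h ∘ acc) id (u z))

/-- The set of points with bounded forward orbit. -/
def Kplus (f : ℂ × ℂ → ℂ × ℂ) : Set (ℂ × ℂ) :=
  {z | ∃ C : ℝ, ∀ n : ℕ, ‖f^[n] z‖ ≤ C}

/-- `lam` is an eigenvalue of the continuous linear map `T`. -/
def IsEigenvalue (T : (ℂ × ℂ) →L[ℂ] ℂ × ℂ) (lam : ℂ) : Prop :=
  ∃ v : ℂ × ℂ, v ≠ 0 ∧ T v = lam • v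

/-- `p` is a saddle periodic point of period `n` with stable multiplier `ls`
and unstable multiplier `lu`. -/
def IsSaddle (f : ℂ × ℂ → ℂ × ℂ) (p : ℂ × ℂ) (n : ℕ) (ls lu : ℂ) : Prop :=
  1 ≤ n ∧ f^[n] p = p ∧
  IsEigenvalue (fderiv ℂ (f^[n]) p) ls ∧ IsEigenvalue (fderiv ℂ (f^[n]) p) lu ∧
  ‖ls‖ < 1 ∧ 1 < ‖lu‖

/-- Coordinatewise complex conjugation `σ(x,y) = (x̄, ȳ)`. -/
def conjMap (z : ℂ × ℂ) : ℂ × ℂ := (starRingEnd ℂ z.1, starRingEnd ℂ z.2)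

/-- The open unit disk in `ℂ`. -/
def unitDisk : Set ℂ := Metric.ball 0 1

/-- `γ` is a transversal to `J⁺`. -/
def IsTransversal (f : ℂ × ℂ → ℂ × ℂ) (γ : ℂ → ℂ × ℂ) : Prop :=
  Set.InjOn γ unitDisk ∧ DifferentiableOn ℂ γ unitDisk ∧
  (∃ z ∈ unitDisk, γ z ∈ Kplus f) ∧ ¬ (∀ z ∈ unitDisk, γ z ∈ Kplus f)

/-- The Julia slice associated to a transversal. -/
def juliaSlice (f : ℂ × ℂ → ℂ × ℂ) (γ : ℂ → ℂ × ℂ) : Set ℂ :=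
  unitDisk ∩ frontier {z | z ∈ unitDisk ∧ γ z ∈ Kplus f}

/-- An unstable parametrization of a saddle periodic point. -/
def IsUnstableParam (f : ℂ × ℂ → ℂ × ℂ) (n : ℕ) (lu : ℂ) (p : ℂ × ℂ) (ψ : ℂ → ℂ × ℂ) : Prop :=
  Function.Injective ψ ∧ Differentiable ℂ ψ ∧ ψ 0 = p ∧
  ∀ ζ : ℂ, f^[n] (ψ ζ) = ψ (lu * ζ)

/-- `S` is contained in a proper real-analytic subvariety of `ℂ²`. -/
def ContainedInProperRealAnalyticSubvariety (S : Set (ℂ × ℂ)) : Prop :=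
  ∃ V : Set (ℂ × ℂ), IsClosed V ∧ V ≠ Set.univ ∧ S ⊆ V ∧
    ∀ x ∈ V, ∃ (U : Set (ℂ × ℂ)) (g : ℂ × ℂ → ℝ),
      IsOpen U ∧ x ∈ U ∧ (∀ y ∈ U, AnalyticAt ℝ g y) ∧
      (∃ y ∈ U, g y ≠ 0) ∧ ∀ y ∈ V ∩ U, g y = 0

open Function Set Filter Topology
noncomputable section

section HA
variable {E F : Type*} [NormedAddCommGroup E] [NormedSpace ℂ E]
  [NormedAddCommGroup F] [NormedSpace ℂ F]

lemma ha_cauchy {f : E → F} {z : E} {δ M : ℝ} (hδ : 0 < δ)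
    (hf : DifferentiableOn ℂ f (Metric.ball z δ)) (hM : ∀ w ∈ Metric.ball z δ, ‖f w‖ ≤ M) :
    ‖fderiv ℂ f z‖ ≤ 2 * M / δ := by
  refine Complex.norm_fderiv_le_div_of_mapsTo_ball hf (fun w hw => ?_) hδ
  rw [mem_closedBall_iff_norm]
  have h1 := hM w hw
  have h2 := hM z (Metric.mem_ball_self hδ)
  have := norm_sub_le (f w) (f z)
  linarith

lemma ha_fderiv_cont {f : E → F} {z : E} (hf : ∀ᶠ w in 𝓝 z, DifferentiableAt ℂ f w) :
    ContinuousAt (fderiv ℂ f) z := by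
  have hc : ContinuousAt f z := hf.self_of_nhds.continuousAt
  have h1 : ∀ᶠ w in 𝓝 z, DifferentiableAt ℂ f w ∧ ‖f w‖ < ‖f z‖ + 1 :=
    hf.and (hc.norm.eventually_lt continuousAt_const (by simp))
  obtain ⟨r, hr, hball⟩ := Metric.eventually_nhds_iff_ball.1 h1
  set M := ‖f z‖ + 1 with hMdef
  have hM0 : 0 < M := by positivity
  set δ := r / 3 with hδdef
  have hδ : 0 < δ := by positivity
  have hsub : ∀ w ∈ Metric.ball z (2 * δ), Metric.ball w δ ⊆ Metric.ball z r := by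
    intro w hw x hx
    rw [Metric.mem_ball] at *
    have := dist_triangle x w z
    linarith
  have hlip : ∀ w ∈ Metric.ball z (2 * δ), ‖fderiv ℂ f w‖ ≤ 2 * M / δ := by
    intro w hw
    refine ha_cauchy hδ (fun x hx => (hball x (hsub w hw hx)).1.differentiableWithinAt)
      (fun x hx => (hball x (hsub w hw hx)).2.le)
  have hL : ∀ a ∈ Metric.ball z (2 * δ), ∀ b ∈ Metric.ball z (2 * δ),
      ‖f b - f a‖ ≤ 2 * M / δ * ‖b - a‖ := by
    intro a ha b hb
    refine (convex_ball z (2 * δ)).norm_image_sub_le_of_norm_fderiv_le (𝕜 := ℂ)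
      (fun x hx => (hball x ?_).1) hlip ha hb
    rw [Metric.mem_ball] at *; linarith
  have key : ∀ w ∈ Metric.ball z δ, ‖fderiv ℂ f w - fderiv ℂ f z‖
      ≤ 2 * (2 * M / δ * ‖w - z‖) / δ := by
    intro w hw
    have hw' : ‖w - z‖ < δ := by rwa [← dist_eq_norm]
    have hmem : ∀ x ∈ Metric.ball z δ, x + (w - z) ∈ Metric.ball z (2 * δ) ∧
        x ∈ Metric.ball z (2 * δ) := by
      intro x hx
      rw [mem_ball_iff_norm] at *
      constructor
      · have := norm_add_le (x - z) (w - z)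
        rw [show x + (w - z) - z = x - z + (w - z) by abel]
        linarith
      · rw [mem_ball_iff_norm]; linarith
    have hd1 : ∀ x ∈ Metric.ball z δ, DifferentiableAt ℂ (fun y => f (y + (w - z))) x := by
      intro x hx
      rw [differentiableAt_comp_add_right]
      refine (hball _ ?_).1
      have := (hmem x hx).1
      rw [Metric.mem_ball] at *; linarith
    have hd2 : ∀ x ∈ Metric.ball z δ, DifferentiableAt ℂ f x := by
      intro x hx
      refine (hball _ ?_).1
      rw [Metric.mem_ball] at *; linarith
    have h3 := ha_cauchy (f := fun x => f (x + (w - z)) - f x) (z := z) hδ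
      (M := 2 * M / δ * ‖w - z‖)
      (fun x hx => ((hd1 x hx).sub (hd2 x hx)).differentiableWithinAt)
      (fun x hx => by
        have := hL x (hmem x hx).2 _ (hmem x hx).1
        simpa using this)
    have h4 : fderiv ℂ (fun x => f (x + (w - z)) - f x) z = fderiv ℂ f w - fderiv ℂ f z := by
      have hz := Metric.mem_ball_self (x := z) hδ
      rw [fderiv_fun_sub (hd1 z hz) (hd2 z hz), fderiv_comp_add_right]
      simp
    rwa [h4] at h3
  rw [ContinuousAt, tendsto_iff_norm_sub_tendsto_zero]
  have hlim : Tendsto (fun w => 2 * (2 * M / δ * ‖w - z‖) / δ) (𝓝 z) (𝓝 0) := by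
    have : Continuous (fun w => 2 * (2 * M / δ * ‖w - z‖) / δ) := by fun_prop
    simpa using this.tendsto z
  refine squeeze_zero' (Eventually.of_forall fun w => norm_nonneg _) ?_ hlim
  filter_upwards [Metric.ball_mem_nhds z hδ] with w hw using key w hw

lemma ha_strict {f : E → F} {z : E} (hf : ∀ᶠ w in 𝓝 z, DifferentiableAt ℂ f w) :
    HasStrictFDerivAt f (fderiv ℂ f z) z :=
  hasStrictFDerivAt_of_hasFDerivAt_of_continuousAt
    (hf.mono fun _ h => h.hasFDerivAt) (ha_fderiv_cont hf)

/-- Weierstrass theorem in several variables. -/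
lemma ha_weier [CompleteSpace F] {G : ℕ → E → F} {g : E → F} {z : E} {ρ : ℝ} (hρ : 0 < ρ)
    (hd : ∀ᶠ n in atTop, DifferentiableOn ℂ (G n) (Metric.ball z ρ))
    (hu : TendstoUniformlyOn G g atTop (Metric.ball z ρ)) :
    (∀ w ∈ Metric.ball z (ρ / 2), DifferentiableAt ℂ g w) ∧
    TendstoUniformlyOn (fun n => fderiv ℂ (G n)) (fderiv ℂ g) atTop (Metric.ball z (ρ / 2)) := by
  have hsub : ∀ w ∈ Metric.ball z (ρ / 2), Metric.ball w (ρ / 2) ⊆ Metric.ball z ρ := by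
    intro w hw x hx
    rw [Metric.mem_ball] at *
    have := dist_triangle x w z
    linarith
  have hdat : ∀ n, DifferentiableOn ℂ (G n) (Metric.ball z ρ) →
      ∀ w ∈ Metric.ball z ρ, DifferentiableAt ℂ (G n) w := fun n h w hw =>
    (h w hw).differentiableAt (Metric.isOpen_ball.mem_nhds hw)
  have hC : UniformCauchySeqOn (fun n => fderiv ℂ (G n)) atTop (Metric.ball z (ρ / 2)) := by
    rw [Metric.uniformCauchySeqOn_iff]
    intro ε hε
    have h1 := hu.uniformCauchySeqOn
    rw [Metric.uniformCauchySeqOn_iff] at h1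
    obtain ⟨N, hN⟩ := h1 (ε * ρ / 8) (by positivity)
    obtain ⟨N', hN'⟩ := eventually_atTop.1 hd
    refine ⟨max N N', fun m hm n hn w hw => ?_⟩
    have hm1 := hdat m (hN' m (le_trans (le_max_right _ _) hm))
    have hn1 := hdat n (hN' n (le_trans (le_max_right _ _) hn))
    have h2 := ha_cauchy (f := fun x => G m x - G n x) (z := w) (half_pos hρ) (M := ε * ρ / 8)
      (fun x hx => ((hm1 x (hsub w hw hx)).sub (hn1 x (hsub w hw hx))).differentiableWithinAt)
      (fun x hx => by
        have := hN m (le_trans (le_max_left _ _) hm) n (le_trans (le_max_left _ _) hn) x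
          (hsub w hw hx)
        rw [dist_eq_norm] at this
        exact this.le)
    have hw' := hsub w hw (Metric.mem_ball_self (half_pos hρ))
    rw [fderiv_fun_sub (hm1 w hw') (hn1 w hw')] at h2
    rw [dist_eq_norm]
    have : 2 * (ε * ρ / 8) / (ρ / 2) = ε / 2 := by field_simp; ring
    linarith
  have hex : ∀ w ∈ Metric.ball z (ρ / 2), ∃ L, Tendsto (fun n => fderiv ℂ (G n) w) atTop (𝓝 L) :=
    fun w hw => cauchySeq_tendsto_of_complete (hC.cauchySeq hw)
  choose! g' hg' using hex
  have hU : TendstoUniformlyOn (fun n => fderiv ℂ (G n)) g' atTop (Metric.ball z (ρ / 2)) :=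
    hC.tendstoUniformlyOn_of_tendsto hg'
  obtain ⟨N', hN'⟩ := eventually_atTop.1 hd
  have hder : ∀ w ∈ Metric.ball z (ρ / 2), HasFDerivAt g (g' w) w := by
    intro w hw
    have hU' : TendstoUniformlyOn (fun n => fderiv ℂ (G (n + N'))) g' atTop
        (Metric.ball z (ρ / 2)) := fun u hu' => (tendsto_add_atTop_nat N').eventually (hU u hu')
    refine hasFDerivAt_of_tendstoUniformlyOn (f := fun n => G (n + N')) Metric.isOpen_ball hU' (fun n x hx => ?_) (fun x hx => ?_) hw
    · exact (hdat _ (hN' _ (by omega)) x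
        (hsub x hx (Metric.mem_ball_self (half_pos hρ)))).hasFDerivAt
    · have := hu.tendsto_at (hsub x hx (Metric.mem_ball_self (half_pos hρ)))
      exact (tendsto_add_atTop_iff_nat N').2 this
  refine ⟨fun w hw => (hder w hw).differentiableAt, ?_⟩
  refine hU.congr_right fun w hw => ?_
  exact (hder w hw).fderiv.symm

/-- consequence: derivatives converge along moving points -/
lemma ha_weier_seq [CompleteSpace F] {G : ℕ → E → F} {g : E → F} {z : E} {ρ : ℝ} (hρ : 0 < ρ)
    (hd : ∀ᶠ n in atTop, DifferentiableOn ℂ (G n) (Metric.ball z ρ))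
    (hu : TendstoUniformlyOn G g atTop (Metric.ball z ρ)) :
    Tendsto (fun p : ℕ × E => fderiv ℂ (G p.1) p.2) (atTop ×ˢ 𝓝 z) (𝓝 (fderiv ℂ g z)) := by
  obtain ⟨h1, h2⟩ := ha_weier hρ hd hu
  have hc : ContinuousAt (fderiv ℂ g) z :=
    ha_fderiv_cont (eventually_of_mem (Metric.ball_mem_nhds z (half_pos hρ)) h1)
  rw [Metric.tendsto_nhds]
  intro ε hε
  rw [Metric.tendstoUniformlyOn_iff] at h2
  have h3 := h2 (ε / 2) (half_pos hε)
  have h4 := (Metric.tendsto_nhds.1 hc (ε / 2) (half_pos hε)).and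
    (Metric.ball_mem_nhds z (half_pos hρ))
  filter_upwards [h3.prod_mk h4] with p hp
  have := hp.1 p.2 hp.2.2
  have h5 := hp.2.1
  calc _ ≤ dist (fderiv ℂ (G p.1) p.2) (fderiv ℂ g p.2) + dist (fderiv ℂ g p.2) (fderiv ℂ g z) :=
        dist_triangle _ _ _
    _ < ε := by rw [dist_comm (fderiv ℂ (G p.1) p.2)]; linarith

/-- continuous convergence implies uniform convergence on small balls -/
lemma ha_unif_of_cc [ProperSpace E] {G : ℕ → E → F} {g : E → F} {z : E}
    (h : ∀ᶠ w in 𝓝 z, Tendsto (fun p : ℕ × E => G p.1 p.2) (atTop ×ˢ 𝓝 w) (𝓝 (g w))) :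
    ∃ ρ > 0, TendstoUniformlyOn G g atTop (Metric.ball z ρ) := by
  obtain ⟨r, hr, hball⟩ := Metric.eventually_nhds_iff_ball.1 h
  have hcont : ∀ w ∈ Metric.ball z r, ContinuousAt g w := by
    intro w hw
    rw [ContinuousAt, Metric.tendsto_nhds]
    intro ε hε
    have h1 := Metric.tendsto_nhds.1 (hball w hw) (ε / 2) (half_pos hε)
    obtain ⟨pa, hpa, pb, hpb, hab⟩ := eventually_prod_iff.1 h1
    filter_upwards [hpb, Metric.isOpen_ball.mem_nhds hw] with x hx hxb
    have h2 : Tendsto (fun n => G n x) atTop (𝓝 (g x)) := by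
      have := hball x hxb
      exact this.comp ((tendsto_id.prodMk (tendsto_const_pure (a := atTop) (b := x))).mono_right
            (prod_mono le_rfl (pure_le_nhds x)))
    have h3 : dist (g x) (g w) ≤ ε / 2 :=
      le_of_tendsto (h2.dist tendsto_const_nhds) (hpa.mono fun n hn => (hab hn hx).le)
    linarith
  have hl : TendstoLocallyUniformlyOn G g atTop (Metric.ball z r) := by
    rw [Metric.isOpen_ball.tendstoLocallyUniformlyOn_iff_forall_tendsto]
    intro x hx
    have h1 := hball x hx
    have h2 : Tendsto (fun p : ℕ × E => g p.2) (atTop ×ˢ 𝓝 x) (𝓝 (g x)) :=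
      (hcont x hx).tendsto.comp tendsto_snd
    have h3 := h2.prodMk_nhds h1
    exact h3.mono_right (nhds_le_uniformity (g x))
  refine ⟨r / 2, half_pos hr, ?_⟩
  have := (tendstoLocallyUniformlyOn_iff_forall_isCompact Metric.isOpen_ball).1 hl
    (Metric.closedBall z (r / 2)) (Metric.closedBall_subset_ball (by linarith))
    (isCompact_closedBall z _)
  exact this.mono Metric.ball_subset_closedBall

/-- Persistence of nondegenerate zeros. -/
lemma ha_hurwitz [CompleteSpace E] {G : ℕ → E → E} {g : E → E} {z : E} {ρ : ℝ} (hρ : 0 < ρ)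
    (hd : ∀ᶠ n in atTop, DifferentiableOn ℂ (G n) (Metric.ball z ρ))
    (hu : TendstoUniformlyOn G g atTop (Metric.ball z ρ)) (hz : g z = 0)
    (A : E ≃L[ℂ] E) (hA : HasFDerivAt g (A : E →L[ℂ] E) z) :
    ∃ x : ℕ → E, Tendsto x atTop (𝓝 z) ∧ ∀ᶠ n in atTop, G n (x n) = 0 := by
  rcases subsingleton_or_nontrivial E with hE | hE
  · exact ⟨fun _ => z, tendsto_const_nhds, Eventually.of_forall fun n => Subsingleton.elim _ _⟩
  have hA0 : 0 < ‖(A.symm : E →L[ℂ] E)‖ := A.symm.norm_pos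
  set κ : ℝ := ‖(A.symm : E →L[ℂ] E)‖⁻¹ with hκ
  have hκ0 : 0 < κ := by positivity
  have hT := ha_weier_seq hρ hd hu
  rw [hA.fderiv] at hT
  have h1 := Metric.tendsto_nhds.1 hT (κ / 2) (half_pos hκ0)
  obtain ⟨pa, hpa, pb, hpb, hab⟩ := eventually_prod_iff.1 h1
  obtain ⟨r, hr, hball⟩ := Metric.eventually_nhds_iff_ball.1
    (hpb.and (Metric.ball_mem_nhds z hρ))
  have hG0 : Tendsto (fun n => G n z) atTop (𝓝 0) := by
    have := hu.tendsto_at (Metric.mem_ball_self hρ)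
    rwa [hz] at this
  have hsol : ∀ᶠ n in atTop, ∃ x, dist x z ≤ 2 / κ * ‖G n z‖ ∧ G n x = 0 := by
    have hsmall : ∀ᶠ n in atTop, 2 / κ * ‖G n z‖ < r := by
      have : Tendsto (fun n => 2 / κ * ‖G n z‖) atTop (𝓝 0) := by
        simpa using hG0.norm.const_mul (2 / κ)
      exact this.eventually_lt_const hr
    filter_upwards [hpa, hd, hsmall] with n hn hdn hs
    have happ : ApproximatesLinearOn (G n) (A : E →L[ℂ] E) (Metric.ball z r)
        ⟨κ / 2, (half_pos hκ0).le⟩ := by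
      intro x hx y hy
      refine (convex_ball z r).norm_image_sub_le_of_norm_fderiv_le' (𝕜 := ℂ) ?_ ?_ hy hx
      · intro x hx
        exact ((hdn x (hball x hx).2).differentiableAt
          (Metric.isOpen_ball.mem_nhds (hball x hx).2))
      · intro x hx
        have := hab hn (hball x hx).1
        rw [dist_eq_norm] at this
        exact this.le
    have hs' := happ.surjOn_closedBall_of_nonlinearRightInverse A.toNonlinearRightInverse
      (ε := 2 / κ * ‖G n z‖) (b := z) (by positivity) (Metric.closedBall_subset_ball hs)
    have h0 : (0 : E) ∈ Metric.closedBall (G n z)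
      ((((A.toNonlinearRightInverse).nnnorm : ℝ)⁻¹ - (⟨κ / 2, (half_pos hκ0).le⟩ : NNReal)) * (2 / κ * ‖G n z‖)) := by
      have e1 : (((A.toNonlinearRightInverse).nnnorm : ℝ)⁻¹) = κ := rfl
      rw [e1, Metric.mem_closedBall, dist_zero_left]
      have : (κ - ((⟨κ / 2, (half_pos hκ0).le⟩ : NNReal) : ℝ)) * (2 / κ * ‖G n z‖) = ‖G n z‖ := by
        change (κ - κ / 2) * (2 / κ * ‖G n z‖) = ‖G n z‖
        field_simp; ring
      exact this.ge
    obtain ⟨x, hx, hx0⟩ := hs' h0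
    exact ⟨x, hx, hx0⟩
  obtain ⟨N, hN⟩ := eventually_atTop.1 hsol
  choose! x hx using hN
  refine ⟨x, ?_, eventually_atTop.2 ⟨N, fun n hn => (hx n hn).2⟩⟩
  rw [tendsto_iff_dist_tendsto_zero]
  have : Tendsto (fun n => 2 / κ * ‖G n z‖) atTop (𝓝 0) := by
    simpa using hG0.norm.const_mul (2 / κ)
  exact squeeze_zero' (Eventually.of_forall fun _ => dist_nonneg)
    (eventually_atTop.2 ⟨N, fun n hn => (hx n hn).1⟩) this

end HA
end

open Function Set Filter Topology
noncomputable section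

/-- real-sequence hyperbolicity -/
lemma hb_cone {a b : ℕ → ℝ} {θ : ℝ} {n : ℕ} (hθ0 : 0 ≤ θ)
    (hA : ∀ i < n, a i ≤ b i → a (i + 1) ≤ b (i + 1) ∧ b i ≤ θ * b (i + 1)) (k : ℕ) :
    ∀ i, i + k ≤ n → a i ≤ b i → a (i + k) ≤ b (i + k) ∧ b i ≤ θ ^ k * b (i + k) := by
  induction k with
  | zero => intro i _ h; simpa using h
  | succ k ih =>
    intro i hi h
    obtain ⟨h1, h2⟩ := ih i (by omega) h
    obtain ⟨h3, h4⟩ := hA (i + k) (by omega) h1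
    refine ⟨h3, h2.trans ?_⟩
    rw [pow_succ, mul_assoc]
    exact mul_le_mul_of_nonneg_left h4 (by positivity)

lemma hb_hyp {a b : ℕ → ℝ} {θ : ℝ} {n : ℕ} (hθ0 : 0 ≤ θ)
    (hA : ∀ i < n, a i ≤ b i → a (i + 1) ≤ b (i + 1) ∧ b i ≤ θ * b (i + 1))
    (hB : ∀ i < n, b i < a i → a (i + 1) ≤ θ * a i) {i : ℕ} (hi : i ≤ n) :
    max (a i) (b i) ≤ max (θ ^ i * a 0) (θ ^ (n - i) * b n) := by
  rcases le_or_gt (a i) (b i) with h | h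
  · have := (hb_cone hθ0 hA (n - i) i (by omega) h).2
    rw [Nat.add_sub_cancel' hi] at this
    rw [max_eq_right h]
    exact le_max_of_le_right this
  · rw [max_eq_left h.le]
    apply le_max_of_le_left
    have h1 : ∀ j, j ≤ i → b j < a j := by
      intro j hj
      by_contra hc
      have := (hb_cone hθ0 hA (i - j) j (by omega) (not_lt.1 hc)).1
      rw [Nat.add_sub_cancel' hj] at this
      linarith
    have h2 : ∀ j, j ≤ i → a j ≤ θ ^ j * a 0 := by
      intro j
      induction j with
      | zero => intro _; simp
      | succ j ih =>
        intro hj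
        have h3 := hB j (by omega) (h1 j (by omega))
        have h4 := ih (by omega)
        calc a (j + 1) ≤ θ * a j := h3
          _ ≤ θ * (θ ^ j * a 0) := mul_le_mul_of_nonneg_left h4 hθ0
          _ = _ := by ring
    exact h2 i le_rfl

/-- the diagonal linear map -/
def dg (l m : ℂ) : ℂ × ℂ →L[ℂ] ℂ × ℂ :=
  (l • ContinuousLinearMap.fst ℂ ℂ ℂ).prod (m • ContinuousLinearMap.snd ℂ ℂ ℂ)

@[simp] lemma dg_apply (l m : ℂ) (v : ℂ × ℂ) : dg l m v = (l * v.1, m * v.2) := rfl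

/-- conjugation by the coordinate swap -/
def sw (f : ℂ × ℂ → ℂ × ℂ) : ℂ × ℂ → ℂ × ℂ := fun z => (f z.swap).swap

lemma sw_sw (f : ℂ × ℂ → ℂ × ℂ) : sw (sw f) = f := rfl

lemma sw_iter (f : ℂ × ℂ → ℂ × ℂ) (n : ℕ) (z : ℂ × ℂ) : (sw f)^[n] z = (f^[n] z.swap).swap := by
  induction n with
  | zero => simp
  | succ n ih => rw [iterate_succ_apply', ih, iterate_succ_apply']; simp [sw]

lemma norm_swap' (z : ℂ × ℂ) : ‖z.swap‖ = ‖z‖ := by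
  simp [Prod.norm_def, max_comm]

/-- one-sided local hyperbolicity -/
structure Loc (f : ℂ × ℂ → ℂ × ℂ) (l m : ℂ) (θ ε R : ℝ) : Prop where
  R0 : 0 < R
  θ0 : 0 < θ
  θ1 : θ < 1
  ε0 : 0 < ε
  hl : ‖l‖ + ε ≤ θ
  hm : θ⁻¹ ≤ ‖m‖ - ε
  l0 : l ≠ 0
  dif : Differentiable ℂ f
  fix : f 0 = 0
  der : fderiv ℂ f 0 = dg l m
  close : ∀ z : ℂ × ℂ, ‖z‖ ≤ R → ‖fderiv ℂ f z - dg l m‖ ≤ ε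

structure Sys (f g : ℂ × ℂ → ℂ × ℂ) (l m : ℂ) (θ ε R : ℝ) : Prop where
  lo : Loc f l m θ ε R
  lo' : Loc (sw g) m⁻¹ l⁻¹ θ ε R
  left : ∀ z, g (f z) = z
  right : ∀ z, f (g z) = z

lemma Sys.swap {f g : ℂ × ℂ → ℂ × ℂ} {l m : ℂ} {θ ε R : ℝ} (h : Sys f g l m θ ε R) :
    Sys (sw g) (sw f) m⁻¹ l⁻¹ θ ε R where
  lo := h.lo'
  lo' := by rw [inv_inv, inv_inv]; exact h.lo
  left z := by simp [sw, h.right]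
  right z := by simp [sw, h.left]

section loc
variable {f : ℂ × ℂ → ℂ × ℂ} {l m : ℂ} {θ ε R : ℝ}

lemma Loc.m1 (h : Loc f l m θ ε R) : 1 < ‖m‖ := by
  have := h.hm; have := h.ε0
  have := (one_lt_inv₀ h.θ0).2 h.θ1
  linarith

lemma Loc.m0 (h : Loc f l m θ ε R) : m ≠ 0 := by
  intro hm; have := h.m1; simp [hm] at this; linarith

lemma Loc.l1 (h : Loc f l m θ ε R) : ‖l‖ < 1 := by
  have := h.hl; have := h.ε0; have := h.θ1
  linarith

lemma Loc.est (h : Loc f l m θ ε R) {z z' : ℂ × ℂ} (hz : ‖z‖ ≤ R) (hz' : ‖z'‖ ≤ R) :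
    ‖f z - f z' - dg l m (z - z')‖ ≤ ε * ‖z - z'‖ := by
  refine (convex_closedBall (0 : ℂ × ℂ) R).norm_image_sub_le_of_norm_fderiv_le' (𝕜 := ℂ)
    (fun x _ => h.dif x) (fun x hx => h.close x (by simpa using hx)) (by simpa using hz')
    (by simpa using hz)

lemma Loc.est1 (h : Loc f l m θ ε R) {z z' : ℂ × ℂ} (hz : ‖z‖ ≤ R) (hz' : ‖z'‖ ≤ R) :
    ‖(f z).1 - (f z').1 - l * (z.1 - z'.1)‖ ≤ ε * ‖z - z'‖ :=
  (norm_fst_le (f z - f z' - dg l m (z - z'))).trans (h.est hz hz')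

lemma Loc.est2 (h : Loc f l m θ ε R) {z z' : ℂ × ℂ} (hz : ‖z‖ ≤ R) (hz' : ‖z'‖ ≤ R) :
    ‖(f z).2 - (f z').2 - m * (z.2 - z'.2)‖ ≤ ε * ‖z - z'‖ :=
  (norm_snd_le (f z - f z' - dg l m (z - z'))).trans (h.est hz hz')

lemma Loc.lin (h : Loc f l m θ ε R) {v w : ℂ × ℂ} (hvw : ‖w - dg l m v‖ ≤ ε * ‖v‖) :
    (‖v.1‖ ≤ ‖v.2‖ → ‖w.1‖ ≤ ‖w.2‖ ∧ ‖v.2‖ ≤ θ * ‖w.2‖) ∧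
    ‖w.1‖ ≤ θ * ‖v‖ := by
  have e1 : ‖w.1 - l * v.1‖ ≤ ε * ‖v‖ := (norm_fst_le (w - dg l m v)).trans hvw
  have e2 : ‖w.2 - m * v.2‖ ≤ ε * ‖v‖ := (norm_snd_le (w - dg l m v)).trans hvw
  have f1 : ‖w.1‖ ≤ (‖l‖ + ε) * ‖v‖ := by
    have := norm_add_le (w.1 - l * v.1) (l * v.1)
    rw [sub_add_cancel, norm_mul] at this
    have h3 := mul_le_mul_of_nonneg_left (norm_fst_le v) (norm_nonneg l)
    linarith
  have f1' : ‖w.1‖ ≤ θ * ‖v‖ := f1.trans (mul_le_mul_of_nonneg_right h.hl (norm_nonneg _))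
  refine ⟨fun hc => ?_, f1'⟩
  have hv : ‖v‖ = ‖v.2‖ := by rw [Prod.norm_def, max_eq_right hc]
  have f2 : (‖m‖ - ε) * ‖v.2‖ ≤ ‖w.2‖ := by
    have := norm_sub_le (w.2) (w.2 - m * v.2)
    rw [sub_sub_cancel, norm_mul] at this
    rw [hv] at e2
    linarith
  have f3 : θ⁻¹ * ‖v.2‖ ≤ ‖w.2‖ := (mul_le_mul_of_nonneg_right h.hm (norm_nonneg _)).trans f2
  have f4 : ‖v.2‖ ≤ θ * ‖w.2‖ := by
    have := mul_le_mul_of_nonneg_left f3 h.θ0.le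
    rwa [← mul_assoc, mul_inv_cancel₀ h.θ0.ne', one_mul] at this
  refine ⟨?_, f4⟩
  rw [hv] at f1'
  have h1 := h.θ1
  have h0 := h.θ0
  have : θ * ‖v.2‖ ≤ 1 * ‖v.2‖ := mul_le_mul_of_nonneg_right h1.le (norm_nonneg _)
  have : θ * ‖w.2‖ ≤ 1 * ‖w.2‖ := mul_le_mul_of_nonneg_right h1.le (norm_nonneg _)
  linarith

/-- orbit stays in the box up to time n -/
def Orb (f : ℂ × ℂ → ℂ × ℂ) (R : ℝ) (n : ℕ) (z : ℂ × ℂ) : Prop := ∀ i ≤ n, ‖f^[i] z‖ ≤ R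

lemma Loc.hyp (h : Loc f l m θ ε R) {n : ℕ} {z z' : ℂ × ℂ} (hz : Orb f R n z) (hz' : Orb f R n z')
    {i : ℕ} (hi : i ≤ n) :
    ‖f^[i] z - f^[i] z'‖ ≤
      max (θ ^ i * ‖z.1 - z'.1‖) (θ ^ (n - i) * ‖(f^[n] z).2 - (f^[n] z').2‖) := by
  have hL : ∀ i < n, _ := fun i (hi : i < n) => h.lin (h.est (hz i hi.le) (hz' i hi.le))
  have := hb_hyp (a := fun i => ‖(f^[i] z - f^[i] z').1‖) (b := fun i => ‖(f^[i] z - f^[i] z').2‖)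
    h.θ0.le (n := n) (fun i hi hab => by
      have := (hL i hi).1 hab
      simp only [iterate_succ_apply']
      exact this) (fun i hi hab => by
      have := (hL i hi).2
      simp only [iterate_succ_apply']
      rw [Prod.norm_def (f^[i] z - f^[i] z'), max_eq_left hab.le] at this
      exact this) hi
  exact this

lemma Loc.orb0 (h : Loc f l m θ ε R) (n : ℕ) : Orb f R n 0 := by
  intro i _
  rw [iterate_fixed h.fix i]; simpa using h.R0.le

lemma Loc.bvp (h : Loc f l m θ ε R) (n : ℕ) : ∀ q : ℂ × ℂ, ‖q‖ ≤ R →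
    ∃ z : ℂ × ℂ, z.1 = q.1 ∧ Orb f R n z ∧ (f^[n] z).2 = q.2 := by
  induction n with
  | zero =>
    intro q hq
    refine ⟨q, rfl, fun i hi => ?_, rfl⟩
    obtain rfl : i = 0 := by omega
    simpa using hq
  | succ n ih =>
    intro q hq
    have hq1 : ‖q.1‖ ≤ R := (norm_fst_le q).trans hq
    have hq2 : ‖q.2‖ ≤ R := (norm_snd_le q).trans hq
    have hex : ∀ y : ℂ, ‖y‖ ≤ R → ∃ z : ℂ × ℂ, z.1 = q.1 ∧ Orb f R n z ∧ (f^[n] z).2 = y :=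
      fun y hy => ih (q.1, y) (by simpa [Prod.norm_def] using ⟨hq1, hy⟩)
    choose! Z hZ1 hZ2 hZ3 using hex
    set T : ℂ → ℂ := fun y => m⁻¹ * (q.2 - ((f (f^[n] (Z y))).2 - m * y)) with hT
    have hmpos : 0 < ‖m‖ := norm_pos_iff.2 h.m0
    have hlip : ∀ y y' : ℂ, ‖y‖ ≤ R → ‖y'‖ ≤ R → ‖T y - T y'‖ ≤ ε / ‖m‖ * ‖y - y'‖ := by
      intro y y' hy hy'
      have e := h.est2 (hZ2 y hy n le_rfl) (hZ2 y' hy' n le_rfl)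
      rw [hZ3 y hy, hZ3 y' hy'] at e
      have e2 := h.hyp (hZ2 y hy) (hZ2 y' hy') (le_refl n)
      rw [hZ1 y hy, hZ1 y' hy', hZ3 y hy, hZ3 y' hy'] at e2
      simp only [sub_self, norm_zero, mul_zero, Nat.sub_self, pow_zero, one_mul] at e2
      rw [max_eq_right (norm_nonneg _)] at e2
      have : T y - T y' = -(m⁻¹ * ((f (f^[n] (Z y))).2 - (f (f^[n] (Z y'))).2 - m * (y - y'))) := by
        simp only [hT]; ring
      rw [this, norm_neg, norm_mul, norm_inv]
      calc ‖m‖⁻¹ * _ ≤ ‖m‖⁻¹ * (ε * ‖y - y'‖) := by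
            gcongr
            exact e.trans (mul_le_mul_of_nonneg_left e2 h.ε0.le)
        _ = _ := by ring
    have hmaps : ∀ y : ℂ, ‖y‖ ≤ R → ‖T y‖ ≤ R := by
      intro y hy
      have e := h.est2 (hZ2 y hy n le_rfl) (h.orb0 0 0 le_rfl)
      simp only [iterate_zero, id, h.fix, Prod.snd_zero, sub_zero] at e
      rw [hZ3 y hy] at e
      have e3 : ‖f^[n] (Z y)‖ ≤ R := hZ2 y hy n le_rfl
      have e4 := norm_sub_le q.2 ((f (f^[n] (Z y))).2 - m * y)
      have e5 : ε * ‖f^[n] (Z y)‖ ≤ ε * R := mul_le_mul_of_nonneg_left e3 h.ε0.le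
      simp only [hT, norm_mul, norm_inv]
      rw [inv_mul_le_iff₀ hmpos]
      have : 1 + ε ≤ ‖m‖ := by
        have := h.hm
        have := (one_lt_inv₀ h.θ0).2 h.θ1
        linarith
      have := mul_le_mul_of_nonneg_right this h.R0.le
      linarith
    have hεm : ε / ‖m‖ < 1 := by
      rw [div_lt_one hmpos]
      have := h.hm
      have := (one_lt_inv₀ h.θ0).2 h.θ1
      linarith
    obtain ⟨y, hy, hfix⟩ : ∃ y : ℂ, ‖y‖ ≤ R ∧ T y = y := by
      have hcomp : IsComplete (Metric.closedBall (0 : ℂ) R) := Metric.isClosed_closedBall.isComplete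
      have hmt : MapsTo T (Metric.closedBall (0 : ℂ) R) (Metric.closedBall (0 : ℂ) R) := by
        intro y hy
        simp only [mem_closedBall_zero_iff] at *
        exact hmaps y hy
      have hc : ContractingWith ⟨ε / ‖m‖, div_nonneg h.ε0.le hmpos.le⟩ (hmt.restrict T _ _) := by
        refine ⟨hεm, LipschitzWith.of_dist_le_mul fun y y' => ?_⟩
        have := hlip y y' (mem_closedBall_zero_iff.1 y.2) (mem_closedBall_zero_iff.1 y'.2)
        rw [Subtype.dist_eq, Subtype.dist_eq, dist_eq_norm, dist_eq_norm]
        exact this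
      obtain ⟨y, hy, hf, _⟩ := ContractingWith.exists_fixedPoint' hcomp hmt hc
        (x := 0) (by simpa using h.R0.le) (edist_ne_top _ _)
      exact ⟨y, by simpa using hy, hf⟩
    have hfz : (f (f^[n] (Z y))).2 = q.2 := by
      have : m * T y = m * y := by rw [hfix]
      simp only [hT] at this
      rw [← mul_assoc, mul_inv_cancel₀ h.m0, one_mul] at this
      linear_combination -this
    refine ⟨Z y, hZ1 y hy, ?_, by rw [iterate_succ_apply']; exact hfz⟩
    intro i hi
    rcases Nat.lt_or_ge n i with hi' | hi'
    · obtain rfl : i = n + 1 := by omega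
      rw [iterate_succ_apply']
      have e := h.est (hZ2 y hy n le_rfl) (h.orb0 0 0 le_rfl)
      simp only [iterate_zero, id, h.fix, sub_zero] at e
      have e1 := (h.lin e).2
      rw [Prod.norm_def]
      refine max_le ?_ (by rw [hfz]; exact hq2)
      have e3 : ‖f^[n] (Z y)‖ ≤ R := hZ2 y hy n le_rfl
      have := mul_le_mul h.θ1.le e3 (norm_nonneg _) zero_le_one
      linarith
    · exact (hZ2 y hy i hi')

def bP (f : ℂ × ℂ → ℂ × ℂ) (R : ℝ) (n : ℕ) (q : ℂ × ℂ) : ℂ × ℂ :=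
  Classical.epsilon fun z => z.1 = q.1 ∧ Orb f R n z ∧ (f^[n] z).2 = q.2

lemma Loc.bP_spec (h : Loc f l m θ ε R) (n : ℕ) {q : ℂ × ℂ} (hq : ‖q‖ ≤ R) :
    (bP f R n q).1 = q.1 ∧ Orb f R n (bP f R n q) ∧ (f^[n] (bP f R n q)).2 = q.2 :=
  Classical.epsilon_spec (h.bvp n q hq)

lemma Loc.bP_uniq (h : Loc f l m θ ε R) {n : ℕ} {z : ℂ × ℂ} (hz : Orb f R n z) :
    bP f R n (z.1, (f^[n] z).2) = z := by
  have hq : ‖((z.1, (f^[n] z).2) : ℂ × ℂ)‖ ≤ R := by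
    rw [Prod.norm_def]
    exact max_le ((norm_fst_le z).trans (hz 0 (by omega)))
      ((norm_snd_le (f^[n] z)).trans (hz n le_rfl))
  obtain ⟨h1, h2, h3⟩ := h.bP_spec n hq
  have := h.hyp h2 hz (Nat.zero_le n)
  rw [h1, h3] at this
  simp only [sub_self, norm_zero, mul_zero, max_self, iterate_zero, id] at this
  exact sub_eq_zero.1 (norm_le_zero_iff.1 this)

lemma Loc.bP_hyp (h : Loc f l m θ ε R) {n : ℕ} {q q' : ℂ × ℂ} (hq : ‖q‖ ≤ R) (hq' : ‖q'‖ ≤ R)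
    {i : ℕ} (hi : i ≤ n) :
    ‖f^[i] (bP f R n q) - f^[i] (bP f R n q')‖ ≤
      max (θ ^ i * ‖q.1 - q'.1‖) (θ ^ (n - i) * ‖q.2 - q'.2‖) := by
  obtain ⟨h1, h2, h3⟩ := h.bP_spec n hq
  obtain ⟨h1', h2', h3'⟩ := h.bP_spec n hq'
  have := h.hyp h2 h2' hi
  rwa [h1, h3, h1', h3'] at this

lemma Loc.hyp0 (h : Loc f l m θ ε R) {n : ℕ} {z : ℂ × ℂ} (hz : Orb f R n z)
    {i : ℕ} (hi : i ≤ n) :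
    ‖f^[i] z‖ ≤ max (θ ^ i * ‖z.1‖) (θ ^ (n - i) * ‖(f^[n] z).2‖) := by
  have := h.hyp hz (h.orb0 n) hi
  simpa [iterate_fixed h.fix] using this

lemma Loc.pow_le (h : Loc f l m θ ε R) (i : ℕ) : θ ^ i ≤ 1 := pow_le_one₀ h.θ0.le h.θ1.le

lemma Loc.bP_norm (h : Loc f l m θ ε R) {n : ℕ} {q : ℂ × ℂ} (hq : ‖q‖ ≤ R)
    {i : ℕ} (hi : i ≤ n) : ‖f^[i] (bP f R n q)‖ ≤ ‖q‖ := by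
  obtain ⟨h1, h2, h3⟩ := h.bP_spec n hq
  have := h.hyp0 h2 hi
  rw [h1, h3] at this
  refine this.trans (max_le ?_ ?_)
  · have := mul_le_mul (h.pow_le i) (norm_fst_le q) (norm_nonneg _) zero_le_one
    linarith
  · have := mul_le_mul (h.pow_le (n - i)) (norm_snd_le q) (norm_nonneg _) zero_le_one
    linarith

lemma Loc.lin_iter (h : Loc f l m θ ε R) {n : ℕ} {z : ℂ × ℂ} (hz : Orb f R n z) (v : ℂ × ℂ)
    (hv : ‖v.1‖ ≤ ‖v.2‖) :
    ‖(fderiv ℂ (f^[n]) z v).1‖ ≤ ‖(fderiv ℂ (f^[n]) z v).2‖ ∧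
    ‖v.2‖ ≤ ‖(fderiv ℂ (f^[n]) z v).2‖ := by
  induction n with
  | zero =>
    have : fderiv ℂ (f^[0]) z = ContinuousLinearMap.id ℂ _ := by
      rw [iterate_zero]; exact fderiv_id
    rw [this]
    exact ⟨hv, le_rfl⟩
  | succ n ih =>
    obtain ⟨h1, h2⟩ := ih (fun i hi => hz i (by omega))
    have e : fderiv ℂ (f^[n + 1]) z v = fderiv ℂ f (f^[n] z) (fderiv ℂ (f^[n]) z v) := by
      rw [iterate_succ', fderiv_comp _ (h.dif _) (h.dif.iterate n _)]
      rfl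
    rw [e]
    have e2 : ‖fderiv ℂ f (f^[n] z) (fderiv ℂ (f^[n]) z v) - dg l m (fderiv ℂ (f^[n]) z v)‖
        ≤ ε * ‖fderiv ℂ (f^[n]) z v‖ := by
      rw [← _root_.sub_apply]
      exact ContinuousLinearMap.le_of_opNorm_le _ (h.close _ (hz n (by omega))) _
    obtain ⟨h3, h4⟩ := (h.lin e2).1 h1
    refine ⟨h3, h2.trans (h4.trans ?_)⟩
    have := mul_le_mul_of_nonneg_right h.θ1.le
      (norm_nonneg (fderiv ℂ f (f^[n] z) (fderiv ℂ (f^[n]) z v)).2)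
    linarith

lemma Loc.bP_diff (h : Loc f l m θ ε R) (n : ℕ) {q : ℂ × ℂ} (hq : ‖q‖ < R) :
    DifferentiableAt ℂ (bP f R n) q := by
  set S : ℂ × ℂ → ℂ × ℂ := fun z => (z.1, (f^[n] z).2) with hS
  have hfn : Differentiable ℂ (f^[n]) := h.dif.iterate n
  set D : ℂ × ℂ →L[ℂ] ℂ × ℂ := (ContinuousLinearMap.fst ℂ ℂ ℂ).prod
    ((ContinuousLinearMap.snd ℂ ℂ ℂ).comp (fderiv ℂ (f^[n]) (bP f R n q))) with hD
  have hSD : HasFDerivAt S D (bP f R n q) :=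
    hasFDerivAt_fst.prodMk (hasFDerivAt_snd.comp _ (hfn _).hasFDerivAt)
  have hinj : Injective D := by
    rw [injective_iff_map_eq_zero]
    intro v hv
    have hv1 : v.1 = 0 := congrArg Prod.fst hv
    have hv2 : (fderiv ℂ (f^[n]) (bP f R n q) v).2 = 0 := congrArg Prod.snd hv
    have := (h.lin_iter (h.bP_spec n hq.le).2.1 v (by simp [hv1])).2
    rw [hv2, norm_zero] at this
    exact Prod.ext hv1 (norm_le_zero_iff.1 this)
  set e : (ℂ × ℂ) ≃L[ℂ] (ℂ × ℂ) :=
    (LinearEquiv.ofInjectiveEndo (D : ℂ × ℂ →ₗ[ℂ] ℂ × ℂ) hinj).toContinuousLinearEquiv with he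
  have heD : (e : ℂ × ℂ →L[ℂ] ℂ × ℂ) = D := by
    apply ContinuousLinearMap.ext; intro v; rfl
  have hcont : ContinuousAt (bP f R n) q := by
    rw [ContinuousAt, tendsto_iff_norm_sub_tendsto_zero]
    have hlim : Tendsto (fun w => ‖w - q‖) (𝓝 q) (𝓝 0) := by
      have : Continuous (fun w : ℂ × ℂ => ‖w - q‖) := by fun_prop
      simpa using this.tendsto q
    refine squeeze_zero' (Eventually.of_forall fun w => norm_nonneg _) ?_ hlim
    have : ∀ᶠ w in 𝓝 q, ‖w‖ < R := continuous_norm.continuousAt.eventually_lt_const hq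
    filter_upwards [this] with w hw
    have := h.bP_hyp (n := n) hw.le hq.le (Nat.zero_le n)
    simp only [iterate_zero, id] at this
    refine this.trans (max_le ?_ ?_)
    · simpa using norm_fst_le (w - q)
    · have := mul_le_mul (h.pow_le (n - 0)) (norm_snd_le (w - q)) (norm_nonneg _) zero_le_one
      simpa using this
  refine (HasFDerivAt.of_local_left_inverse (f := S) (f' := e) hcont ?_ ?_).differentiableAt
  · rw [heD]; exact hSD
  · have : ∀ᶠ w in 𝓝 q, ‖w‖ < R := continuous_norm.continuousAt.eventually_lt_const hq
    filter_upwards [this] with w hw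
    obtain ⟨h1, -, h3⟩ := h.bP_spec n hw.le
    exact Prod.ext h1 h3

/-- local stable graph -/
def ws (f : ℂ × ℂ → ℂ × ℂ) (R : ℝ) (x : ℂ) : ℂ :=
  Classical.epsilon fun y => ∀ i, ‖f^[i] (x, y)‖ ≤ R

lemma Loc.dist_fst (h : Loc f l m θ ε R) {n : ℕ} {z z' : ℂ × ℂ} (hz : Orb f R n z)
    (hz' : Orb f R n z') (he : z.1 = z'.1) : ‖z - z'‖ ≤ 2 * R * θ ^ n := by
  have := h.hyp hz hz' (Nat.zero_le n)
  rw [he] at this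
  simp only [iterate_zero, id, sub_self, norm_zero, mul_zero, Nat.sub_zero] at this
  refine this.trans (max_le (by have := h.R0; have := h.θ0; positivity) ?_)
  have h1 := (norm_snd_le _).trans (hz n le_rfl)
  have h2 := (norm_snd_le _).trans (hz' n le_rfl)
  have h3 := (norm_sub_le (f^[n] z).2 (f^[n] z').2)
  have : ‖(f^[n] z).2 - (f^[n] z').2‖ ≤ 2 * R := by linarith
  have := mul_le_mul_of_nonneg_left this (pow_nonneg h.θ0.le n)
  linarith

lemma Loc.pow_lim (h : Loc f l m θ ε R) (C : ℝ) : Tendsto (fun n : ℕ => C * θ ^ n) atTop (𝓝 0) := by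
  simpa using (tendsto_pow_atTop_nhds_zero_of_lt_one h.θ0.le h.θ1).const_mul C

lemma Loc.ws_spec (h : Loc f l m θ ε R) {x : ℂ} (hx : ‖x‖ ≤ R) :
    ∀ i, ‖f^[i] (x, ws f R x)‖ ≤ R := by
  apply Classical.epsilon_spec (p := fun y => ∀ i, ‖f^[i] (x, y)‖ ≤ R)
  have hq : ‖((x, 0) : ℂ × ℂ)‖ ≤ R := by simpa [Prod.norm_def] using hx
  set z : ℕ → ℂ × ℂ := fun n => bP f R n (x, 0) with hz
  have hs := fun n => h.bP_spec n hq
  have hC : CauchySeq z := by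
    refine cauchySeq_of_le_tendsto_0 (fun n => 2 * R * θ ^ n) (fun n k N hn hk => ?_)
      (h.pow_lim (2 * R))
    rw [dist_eq_norm]
    refine h.dist_fst (fun i hi => (hs n).2.1 i (by omega)) (fun i hi => (hs k).2.1 i (by omega)) ?_
    rw [(hs n).1, (hs k).1]
  obtain ⟨Z, hZ⟩ := cauchySeq_tendsto_of_complete hC
  have h1 : Z.1 = x := by
    have : Tendsto (fun n => (z n).1) atTop (𝓝 Z.1) := (continuous_fst.tendsto Z).comp hZ
    refine tendsto_nhds_unique this ?_
    refine tendsto_const_nhds.congr fun n => ((hs n).1).symm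
  refine ⟨Z.2, fun i => ?_⟩
  have h2 : (x, Z.2) = Z := by rw [← h1]
  rw [h2]
  have : Tendsto (fun n => ‖f^[i] (z n)‖) atTop (𝓝 ‖f^[i] Z‖) :=
    (((h.dif.iterate i).continuous.norm).tendsto Z).comp hZ
  exact le_of_tendsto this (eventually_atTop.2 ⟨i, fun n hn => (hs n).2.1 i hn⟩)

lemma Loc.ws_uniq (h : Loc f l m θ ε R) {z : ℂ × ℂ} (hz : ∀ i, ‖f^[i] z‖ ≤ R) :
    z.2 = ws f R z.1 := by
  have hx : ‖z.1‖ ≤ R := (norm_fst_le z).trans (hz 0)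
  have h1 := h.ws_spec hx
  have h2 : ∀ n, ‖z - (z.1, ws f R z.1)‖ ≤ 2 * R * θ ^ n := fun n =>
    h.dist_fst (n := n) (fun i _ => hz i) (fun i _ => h1 i) rfl
  have h3 := ge_of_tendsto' (h.pow_lim (2 * R)) h2
  have h4 := sub_eq_zero.1 (norm_le_zero_iff.1 h3)
  exact congrArg Prod.snd h4

lemma Loc.ws_unif (h : Loc f l m θ ε R) {q : ℂ × ℂ} (hq : ‖q‖ ≤ R) (n : ℕ) :
    ‖bP f R n q - (q.1, ws f R q.1)‖ ≤ 2 * R * θ ^ n :=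
  h.dist_fst (h.bP_spec n hq).2.1 (fun i _ => h.ws_spec ((norm_fst_le q).trans hq) i)
    (h.bP_spec n hq).1

lemma Loc.stab_hyp (h : Loc f l m θ ε R) {z z' : ℂ × ℂ} (hz : ∀ i, ‖f^[i] z‖ ≤ R)
    (hz' : ∀ i, ‖f^[i] z'‖ ≤ R) (i : ℕ) :
    ‖f^[i] z - f^[i] z'‖ ≤ θ ^ i * ‖z.1 - z'.1‖ := by
  have h1 : ∀ n, ‖f^[i] z - f^[i] z'‖ ≤ max (θ ^ i * ‖z.1 - z'.1‖) (2 * R * θ ^ n) := by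
    intro n
    have := h.hyp (n := n + i) (fun i _ => hz i) (fun i _ => hz' i) (Nat.le_add_left i n)
    refine this.trans (max_le_max le_rfl ?_)
    rw [Nat.add_sub_cancel, mul_comm]
    refine mul_le_mul_of_nonneg_right ?_ (pow_nonneg h.θ0.le n)
    have h1 := (norm_snd_le _).trans (hz (n + i))
    have h2 := (norm_snd_le _).trans (hz' (n + i))
    have h3 := (norm_sub_le (f^[n + i] z).2 (f^[n + i] z').2)
    linarith
  have h2 : Tendsto (fun n : ℕ => max (θ ^ i * ‖z.1 - z'.1‖) (2 * R * θ ^ n)) atTop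
      (𝓝 (max (θ ^ i * ‖z.1 - z'.1‖) 0)) := tendsto_const_nhds.max (h.pow_lim _)
  have h3 := ge_of_tendsto' h2 h1
  rwa [max_eq_left (by have := h.θ0; positivity)] at h3

lemma Loc.ws_lip (h : Loc f l m θ ε R) {x x' : ℂ} (hx : ‖x‖ ≤ R) (hx' : ‖x'‖ ≤ R) :
    ‖ws f R x - ws f R x'‖ ≤ θ * ‖x - x'‖ := by
  have h0 := h.stab_hyp (h.ws_spec hx) (h.ws_spec hx') 0
  have h1 := h.stab_hyp (h.ws_spec hx) (h.ws_spec hx') 1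
  have h2 := h.est2 (h.ws_spec hx 0) (h.ws_spec hx' 0)
  simp only [iterate_zero, id, iterate_one, pow_zero, pow_one, one_mul] at h0 h1 h2
  have h3 := (norm_snd_le _).trans h1
  simp only [Prod.snd_sub] at h3
  set a := (f (x, ws f R x)).2 - (f (x', ws f R x')).2
  set d := ws f R x - ws f R x'
  have h4 := norm_sub_le a (a - m * d)
  rw [sub_sub_cancel, norm_mul] at h4
  have h5 := mul_le_mul_of_nonneg_left h0 h.ε0.le
  have h6 : ‖m‖ * ‖d‖ ≤ (θ + ε) * ‖x - x'‖ := by linarith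
  have hε1 : ε ≤ 1 := by have := h.hl; have := h.θ1; have := norm_nonneg l; linarith
  have h7 : θ + ε ≤ θ * ‖m‖ := by
    have e1 : θ * (θ⁻¹ + ε) ≤ θ * ‖m‖ := mul_le_mul_of_nonneg_left (by linarith [h.hm]) h.θ0.le
    rw [mul_add, mul_inv_cancel₀ h.θ0.ne'] at e1
    nlinarith [h.θ1, h.ε0, h.θ0]
  have h8 : ‖m‖ * ‖d‖ ≤ ‖m‖ * (θ * ‖x - x'‖) := by
    have := mul_le_mul_of_nonneg_right h7 (norm_nonneg (x - x'))
    linarith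
  exact le_of_mul_le_mul_left h8 (norm_pos_iff.2 h.m0)

lemma Loc.ws_zero (h : Loc f l m θ ε R) : ws f R 0 = 0 := by
  have := h.ws_uniq (z := 0) (fun i => h.orb0 i i le_rfl)
  exact this.symm

lemma Loc.ws_norm (h : Loc f l m θ ε R) {x : ℂ} (hx : ‖x‖ ≤ R) : ‖ws f R x‖ ≤ θ * ‖x‖ := by
  have := h.ws_lip hx (x' := 0) (by simpa using h.R0.le)
  simpa [h.ws_zero] using this

lemma Loc.ws_diff (h : Loc f l m θ ε R) : DifferentiableOn ℂ (ws f R) (Metric.ball 0 R) := by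
  have hu : TendstoUniformlyOn (fun (n : ℕ) (x : ℂ) => (bP f R n (x, 0)).2) (ws f R) atTop
      (Metric.ball 0 R) := by
    rw [Metric.tendstoUniformlyOn_iff]
    intro e he
    filter_upwards [(h.pow_lim (2 * R)).eventually_lt_const he] with n hn x hx
    have hx' : ‖x‖ < R := by simpa using hx
    have := h.ws_unif (q := (x, 0)) (by simpa [Prod.norm_def] using hx'.le) n
    rw [dist_comm, dist_eq_norm]
    exact ((norm_snd_le _).trans this).trans_lt hn
  refine hu.tendstoLocallyUniformlyOn.differentiableOn (Eventually.of_forall fun n => ?_)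
    Metric.isOpen_ball
  intro x hx
  have hx' : ‖x‖ < R := by simpa using hx
  refine DifferentiableAt.differentiableWithinAt ?_
  have := h.bP_diff n (q := (x, 0)) (by simpa [Prod.norm_def] using hx')
  have h2 : DifferentiableAt ℂ (fun x : ℂ => (x, (0 : ℂ))) x := by fun_prop
  exact differentiableAt_snd.comp x (DifferentiableAt.comp (g := bP f R n) x this h2)

end loc
end

open Function Set Filter Topology
noncomputable section

lemma hc_alpha {G : ℂ → ℂ → ℂ} {ρ C : ℝ} (hρ : 0 < ρ) (hC : 0 ≤ C)
    (hd : ∀ y : ℂ, ‖y‖ < ρ → DifferentiableOn ℂ (fun u => G u y) (Metric.ball 0 ρ))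
    (h0 : ∀ y : ℂ, ‖y‖ < ρ → G 0 y = 0)
    (hL : ∀ u u' y y' : ℂ, ‖u‖ < ρ → ‖u'‖ < ρ → ‖y‖ < ρ → ‖y'‖ < ρ →
      ‖G u y - G u' y'‖ ≤ C * (‖u - u'‖ + ‖y - y'‖)) :
    ∀ u u' y y' : ℂ, ‖u‖ < ρ / 2 → ‖u'‖ < ρ / 2 → ‖y‖ < ρ → ‖y'‖ < ρ →
      ‖dslope (fun u => G u y) 0 u - dslope (fun u => G u y') 0 u'‖ ≤
        4 * C / ρ * (‖u - u'‖ + ‖y - y'‖) := by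
  have hz : (0 : ℂ) ∈ Metric.ball (0 : ℂ) ρ := Metric.mem_ball_self hρ
  have hdd : ∀ y : ℂ, ‖y‖ < ρ →
      DifferentiableOn ℂ (dslope (fun u => G u y) 0) (Metric.ball 0 ρ) := fun y hy =>
    (Complex.differentiableOn_dslope (Metric.ball_mem_nhds 0 hρ)).2 (hd y hy)
  have hb : ∀ y : ℂ, ‖y‖ < ρ → ∀ u ∈ Metric.ball (0 : ℂ) ρ,
      ‖dslope (fun u => G u y) 0 u‖ ≤ C := by
    intro y hy u hu
    have := Complex.norm_dslope_le_div_of_mapsTo_ball (R₂ := C * ρ) (hd y hy) (fun v hv => ?_) hu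
    · rwa [mul_div_assoc, div_self hρ.ne', mul_one] at this
    · rw [mem_closedBall_iff_norm]
      have hv' : ‖v‖ < ρ := by simpa using hv
      have := hL v 0 y y hv' (by simpa using hρ) hy hy
      simp only [sub_zero, sub_self, norm_zero, add_zero] at this
      exact this.trans (mul_le_mul_of_nonneg_left hv'.le hC)
  have hy : ∀ u y y' : ℂ, ‖u‖ < ρ → ‖y‖ < ρ → ‖y'‖ < ρ →
      ‖dslope (fun u => G u y) 0 u - dslope (fun u => G u y') 0 u‖ ≤ C * ‖y - y'‖ / ρ := by
    intro u y y' hu hy hy'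
    have e : dslope (fun u => G u y) 0 u - dslope (fun u => G u y') 0 u
        = dslope (fun u => G u y - G u y') 0 u := by
      rcases eq_or_ne u 0 with rfl | hne
      · rw [dslope_same, dslope_same, dslope_same]
        rw [deriv_fun_sub ((hd y hy).differentiableAt (Metric.ball_mem_nhds 0 hρ))
          ((hd y' hy').differentiableAt (Metric.ball_mem_nhds 0 hρ))]
      · rw [dslope_of_ne _ hne, dslope_of_ne _ hne, dslope_of_ne _ hne]
        simp only [slope_def_field]; ring
    rw [e]
    refine Complex.norm_dslope_le_div_of_mapsTo_ball ((hd y hy).sub (hd y' hy')) (fun v hv => ?_)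
      (by simpa using hu)
    rw [mem_closedBall_iff_norm]
    have hv' : ‖v‖ < ρ := by simpa using hv
    have := hL v v y y' hv' hv' hy hy'
    simp only [h0 y hy, h0 y' hy', sub_zero]
    simpa using this
  have hu : ∀ u u' y : ℂ, ‖u‖ < ρ / 2 → ‖u'‖ < ρ / 2 → ‖y‖ < ρ →
      ‖dslope (fun u => G u y) 0 u - dslope (fun u => G u y) 0 u'‖ ≤ 4 * C / ρ * ‖u - u'‖ := by
    intro u u' y hu hu' hy
    have hsub : ∀ w ∈ Metric.ball (0 : ℂ) (ρ / 2), Metric.ball w (ρ / 2) ⊆ Metric.ball 0 ρ := by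
      intro w hw x hx
      rw [Metric.mem_ball] at *
      have := dist_triangle x w 0
      linarith
    refine (convex_ball (0 : ℂ) (ρ / 2)).norm_image_sub_le_of_norm_fderiv_le (𝕜 := ℂ) ?_ ?_
      (by simpa using hu') (by simpa using hu)
    · intro x hx
      exact (hdd y hy).differentiableAt (Metric.isOpen_ball.mem_nhds
        (hsub x hx (Metric.mem_ball_self (half_pos hρ))))
    · intro x hx
      have := ha_cauchy (half_pos hρ) ((hdd y hy).mono (hsub x hx))
        (fun w hw => hb y hy w (hsub x hx hw))
      refine this.trans (le_of_eq ?_)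
      field_simp; ring
  intro u u' y y' h1 h2 h3 h4
  have a1 := hu u u' y h1 h2 h3
  have a2 := hy u' y y' (by linarith) h3 h4
  have a3 := norm_sub_le_norm_sub_add_norm_sub (dslope (fun u => G u y) 0 u)
    (dslope (fun u => G u y) 0 u') (dslope (fun u => G u y') 0 u')
  have a4 : C * ‖y - y'‖ / ρ ≤ 4 * C / ρ * ‖y - y'‖ := by
    rw [show 4 * C / ρ * ‖y - y'‖ = 4 * (C * ‖y - y'‖ / ρ) by ring]
    have : 0 ≤ C * ‖y - y'‖ / ρ := by positivity
    linarith
  rw [mul_add]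
  linarith

section sys
variable {f g : ℂ × ℂ → ℂ × ℂ} {l m : ℂ} {θ ε R : ℝ}

/-- the local unstable graph -/
def wu (g : ℂ × ℂ → ℂ × ℂ) (R : ℝ) (y : ℂ) : ℂ := ws (sw g) R y

lemma Sys.gf (h : Sys f g l m θ ε R) (n : ℕ) (z : ℂ × ℂ) : g^[n] (f^[n] z) = z :=
  (LeftInverse.iterate h.left n) z

lemma Sys.fg (h : Sys f g l m θ ε R) (n : ℕ) (z : ℂ × ℂ) : f^[n] (g^[n] z) = z :=
  (LeftInverse.iterate h.right n) z

lemma Sys.g_sub (h : Sys f g l m θ ε R) {i n : ℕ} (hi : i ≤ n) (z : ℂ × ℂ) :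
    g^[i] (f^[n] z) = f^[n - i] z := by
  obtain ⟨k, rfl⟩ := Nat.exists_eq_add_of_le hi
  rw [iterate_add_apply, h.gf]; congr 1; simp

lemma Sys.g_diff (h : Sys f g l m θ ε R) : Differentiable ℂ g := by
  have := h.lo'.dif
  have h2 : g = fun z : ℂ × ℂ => ((sw g) (z.2, z.1)).swap := rfl
  rw [h2]
  have h3 : Differentiable ℂ (fun z : ℂ × ℂ => sw g (z.2, z.1)) :=
    this.comp (by fun_prop : Differentiable ℂ (fun z : ℂ × ℂ => (z.2, z.1)))
  exact (differentiable_snd.comp h3).prodMk (differentiable_fst.comp h3)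

lemma Sys.wu_spec (h : Sys f g l m θ ε R) {y : ℂ} (hy : ‖y‖ ≤ R) (i : ℕ) :
    ‖g^[i] (wu g R y, y)‖ ≤ R := by
  have := h.lo'.ws_spec hy i
  rwa [sw_iter, norm_swap'] at this

lemma Sys.wu_uniq (h : Sys f g l m θ ε R) {z : ℂ × ℂ} (hz : ∀ i, ‖g^[i] z‖ ≤ R) :
    z.1 = wu g R z.2 := by
  have := h.lo'.ws_uniq (z := z.swap) (fun i => by rw [sw_iter, norm_swap']; exact hz i)
  exact this

lemma Sys.bP_swap (h : Sys f g l m θ ε R) (n : ℕ) {q : ℂ × ℂ} (hq : ‖q‖ ≤ R) :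
    bP (sw g) R n q.swap = (f^[n] (bP f R n q)).swap := by
  obtain ⟨h1, h2, h3⟩ := h.lo.bP_spec n hq
  have := h.lo'.bP_uniq (n := n) (z := (f^[n] (bP f R n q)).swap) (fun i hi => by
    rw [sw_iter, norm_swap', Prod.swap_swap, h.g_sub hi]
    exact h2 _ (by omega))
  rw [sw_iter, Prod.swap_swap, h.gf] at this
  simp only [Prod.fst_swap, Prod.snd_swap, h3, h1] at this
  exact this

lemma Sys.wu_inv (h : Sys f g l m θ ε R) {y : ℂ} (hy : ‖y‖ ≤ R) (hf : ‖f (wu g R y, y)‖ ≤ R) :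
    (f (wu g R y, y)).1 = wu g R (f (wu g R y, y)).2 := by
  apply h.wu_uniq
  intro i
  rcases i with _ | i
  · exact hf
  · rw [iterate_succ_apply, h.left]; exact h.wu_spec hy i

/-- straightened coordinate -/
def xh (g : ℂ × ℂ → ℂ × ℂ) (R : ℝ) (z : ℂ × ℂ) : ℂ := z.1 - wu g R z.2

lemma Sys.xh_lip (h : Sys f g l m θ ε R) {z z' : ℂ × ℂ} (hz : ‖z‖ ≤ R) (hz' : ‖z'‖ ≤ R) :
    ‖xh g R z - xh g R z'‖ ≤ 2 * ‖z - z'‖ := by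
  have h1 := h.lo'.ws_lip ((norm_snd_le z).trans hz) ((norm_snd_le z').trans hz')
  have h2 := norm_fst_le (z - z')
  have h3 := norm_snd_le (z - z')
  have h4 := norm_sub_le (z.1 - z'.1) (wu g R z.2 - wu g R z'.2)
  have h5 : xh g R z - xh g R z' = z.1 - z'.1 - (wu g R z.2 - wu g R z'.2) := by
    simp only [xh]; ring
  rw [h5]
  have h6 := mul_le_mul_of_nonneg_right h.lo.θ1.le (norm_nonneg (z.2 - z'.2))
  simp only [Prod.fst_sub, Prod.snd_sub] at h2 h3
  simp only [wu] at *
  linarith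

lemma Sys.xh_zero (h : Sys f g l m θ ε R) : xh g R 0 = 0 := by
  simp [xh, wu, h.lo'.ws_zero]

lemma Sys.wu_diffAt (h : Sys f g l m θ ε R) {y : ℂ} (hy : ‖y‖ < R) :
    DifferentiableAt ℂ (wu g R) y :=
  h.lo'.ws_diff.differentiableAt (Metric.isOpen_ball.mem_nhds (by simpa using hy))

lemma Sys.ws_diffAt (h : Sys f g l m θ ε R) {y : ℂ} (hy : ‖y‖ < R) :
    DifferentiableAt ℂ (ws f R) y :=
  h.lo.ws_diff.differentiableAt (Metric.isOpen_ball.mem_nhds (by simpa using hy))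

lemma Sys.xh_diffAt (h : Sys f g l m θ ε R) {z : ℂ × ℂ} (hz : ‖z‖ < R) :
    DifferentiableAt ℂ (xh g R) z :=
  differentiableAt_fst.sub ((h.wu_diffAt ((norm_snd_le z).trans_lt hz)).comp z differentiableAt_snd)

lemma hc_log {a b : ℂ} (ha : ‖a - 1‖ ≤ 1 / 2) (hb : ‖b - 1‖ ≤ 1 / 2) :
    ‖Complex.log a - Complex.log b‖ ≤ 2 * ‖a - b‖ := by
  have hre : ∀ x ∈ Metric.closedBall (1 : ℂ) (1 / 2), 1 / 2 ≤ x.re := by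
    intro x hx
    rw [mem_closedBall_iff_norm] at hx
    have := (Complex.abs_re_le_norm (x - 1)).trans hx
    simp only [Complex.sub_re, Complex.one_re] at this
    have := abs_le.1 this
    linarith
  refine (convex_closedBall (1 : ℂ) (1 / 2)).norm_image_sub_le_of_norm_hasDerivWithin_le (𝕜 := ℂ)
    (f' := fun x => x⁻¹) ?_ ?_ (mem_closedBall_iff_norm.2 hb) (mem_closedBall_iff_norm.2 ha)
  · intro x hx
    exact (Complex.hasDerivAt_log (Or.inl (by linarith [hre x hx]))).hasDerivWithinAt
  · intro x hx
    rw [norm_inv]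
    have h1 : 1 / 2 ≤ ‖x‖ := (hre x hx).trans (Complex.re_le_norm x)
    rw [inv_le_comm₀ (by linarith) (by norm_num)]
    linarith

lemma Sys.mult (h : Sys f g l m θ ε R) : ∃ R' : ℝ, 0 < R' ∧ R' < R ∧ ∃ (ell : ℂ × ℂ → ℂ) (C : ℝ),
    0 ≤ C ∧ ell 0 = 0 ∧ (∀ z z' : ℂ × ℂ, ‖z‖ ≤ R' → ‖z'‖ ≤ R' → ‖ell z - ell z'‖ ≤ C * ‖z - z'‖) ∧
    (∀ z : ℂ × ℂ, ‖z‖ ≤ R' → xh g R (f z) = l * xh g R z * Complex.exp (ell z)) := by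
  have hcf : ContinuousAt f 0 := h.lo.dif.continuous.continuousAt
  have hev : ∀ᶠ z in 𝓝 (0 : ℂ × ℂ), ‖f z‖ < R := by
    refine hcf.norm.eventually_lt_const ?_
    simpa [h.lo.fix] using h.lo.R0
  obtain ⟨r, hr, hball⟩ := Metric.eventually_nhds_iff_ball.1 hev
  set ρ := min r R / 2 with hρd
  have hρ : 0 < ρ := half_pos (lt_min hr h.lo.R0)
  have hρr : 2 * ρ ≤ r := by rw [hρd]; linarith [min_le_left r R]
  have hρR : 2 * ρ ≤ R := by rw [hρd]; linarith [min_le_right r R]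
  set Φ : ℂ → ℂ → ℂ × ℂ := fun u y => (u + wu g R y, y) with hΦ
  have hΦn : ∀ u y : ℂ, ‖u‖ < ρ → ‖y‖ < ρ → ‖Φ u y‖ < 2 * ρ := by
    intro u y hu hy
    have h1 := h.lo'.ws_norm (x := y) (by linarith)
    have h2 := mul_le_mul_of_nonneg_right h.lo.θ1.le (norm_nonneg y)
    have h3 := norm_add_le u (wu g R y)
    simp only [wu] at *
    rw [Prod.norm_def]
    exact max_lt (by simp only [hΦ, wu]; linarith) (by simp only [hΦ]; linarith)
  have hfΦ : ∀ u y : ℂ, ‖u‖ < ρ → ‖y‖ < ρ → ‖f (Φ u y)‖ < R := fun u y hu hy =>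
    hball _ (by rw [mem_ball_zero_iff]; linarith [hΦn u y hu hy])
  set M : ℝ := ‖dg l m‖ + ε with hM
  have hM0 : 0 ≤ M := by have := h.lo.ε0; positivity
  have hflip : ∀ z z' : ℂ × ℂ, ‖z‖ ≤ R → ‖z'‖ ≤ R → ‖f z - f z'‖ ≤ M * ‖z - z'‖ := by
    intro z z' hz hz'
    have h1 := h.lo.est hz hz'
    have h2 := (dg l m).le_opNorm (z - z')
    have h3 := norm_add_le (f z - f z' - dg l m (z - z')) (dg l m (z - z'))
    rw [sub_add_cancel] at h3
    rw [hM, add_mul]; linarith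
  set G : ℂ → ℂ → ℂ := fun u y => xh g R (f (Φ u y)) with hG
  have hGd : ∀ y : ℂ, ‖y‖ < ρ → DifferentiableOn ℂ (fun u => G u y) (Metric.ball 0 ρ) := by
    intro y hy u hu
    have hu' : ‖u‖ < ρ := by simpa using hu
    refine DifferentiableAt.differentiableWithinAt ?_
    have a1 : DifferentiableAt ℂ (fun u => Φ u y) u := by simp only [hΦ]; fun_prop
    have a2 : DifferentiableAt ℂ (fun u => f (Φ u y)) u :=
      DifferentiableAt.comp (g := f) (f := fun u => Φ u y) u (h.lo.dif _) a1
    exact DifferentiableAt.comp (g := xh g R) (f := fun u => f (Φ u y)) u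
      (h.xh_diffAt (hfΦ u y hu' hy)) a2
  have hG0 : ∀ y : ℂ, ‖y‖ < ρ → G 0 y = 0 := by
    intro y hy
    have h1 := hfΦ 0 y (by simpa using hρ) hy
    simp only [hG, hΦ, zero_add, xh] at h1 ⊢
    rw [h.wu_inv (by linarith) h1.le, sub_self]
  have hGL : ∀ u u' y y' : ℂ, ‖u‖ < ρ → ‖u'‖ < ρ → ‖y‖ < ρ → ‖y'‖ < ρ →
      ‖G u y - G u' y'‖ ≤ (2 * M) * (‖u - u'‖ + ‖y - y'‖) := by
    intro u u' y y' hu hu' hy hy'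
    have h1 := h.xh_lip (hfΦ u y hu hy).le (hfΦ u' y' hu' hy').le
    have h2 := hflip (Φ u y) (Φ u' y') (by linarith [hΦn u y hu hy]) (by linarith [hΦn u' y' hu' hy'])
    have h3 : ‖Φ u y - Φ u' y'‖ ≤ ‖u - u'‖ + ‖y - y'‖ := by
      have h4 := h.lo'.ws_lip (x := y) (x' := y') (by linarith) (by linarith)
      have h5 := mul_le_mul_of_nonneg_right h.lo.θ1.le (norm_nonneg (y - y'))
      rw [Prod.norm_def]
      refine max_le ?_ ?_
      · have := norm_add_le (u - u') (wu g R y - wu g R y')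
        simp only [hΦ, Prod.fst_sub]
        rw [show u + wu g R y - (u' + wu g R y') = u - u' + (wu g R y - wu g R y') by ring]
        simp only [wu] at *
        linarith
      · simp only [hΦ, Prod.snd_sub]; linarith [norm_nonneg (u - u')]
    have := mul_le_mul_of_nonneg_left h3 hM0
    simp only [hG]
    linarith
  have hα := hc_alpha hρ (by positivity : 0 ≤ 2 * M) hGd hG0 hGL
  set α : ℂ × ℂ → ℂ := fun z => dslope (fun u => G u z.2) 0 (xh g R z) with hαd
  set C1 : ℝ := 4 * (2 * M) / ρ with hC1
  have hC10 : 0 ≤ C1 := by positivity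
  have hxs : ∀ z : ℂ × ℂ, ‖z‖ ≤ ρ / 5 → ‖xh g R z‖ < ρ / 2 := by
    intro z hz
    have := h.xh_lip (z := z) (z' := 0) (by linarith) (by simpa using h.lo.R0.le)
    rw [h.xh_zero, sub_zero, sub_zero] at this
    linarith
  have hαL : ∀ z z' : ℂ × ℂ, ‖z‖ ≤ ρ / 5 → ‖z'‖ ≤ ρ / 5 → ‖α z - α z'‖ ≤ 3 * C1 * ‖z - z'‖ := by
    intro z z' hz hz'
    have h1 := hα (xh g R z) (xh g R z') z.2 z'.2 (hxs z hz) (hxs z' hz')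
      (by linarith [norm_snd_le z]) (by linarith [norm_snd_le z'])
    refine h1.trans ?_
    have h2 := h.xh_lip (z := z) (z' := z') (by linarith) (by linarith)
    have h3 := norm_snd_le (z - z')
    simp only [Prod.snd_sub] at h3
    rw [show 3 * C1 * ‖z - z'‖ = C1 * (3 * ‖z - z'‖) by ring]
    exact mul_le_mul_of_nonneg_left (by linarith) hC10
  have hα0 : α 0 = l := by
    simp only [hαd, h.xh_zero, dslope_same, Prod.snd_zero]
    refine HasDerivAt.deriv ?_
    have e1 : HasDerivAt (fun u : ℂ => ((u, 0) : ℂ × ℂ)) ((1, 0) : ℂ × ℂ) 0 :=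
      (hasDerivAt_id (0 : ℂ)).prodMk (hasDerivAt_const (0 : ℂ) (0 : ℂ))
    have e2 : HasFDerivAt f (dg l m) ((0, 0) : ℂ × ℂ) := by
      have := (h.lo.dif 0).hasFDerivAt
      rwa [h.lo.der] at this
    have e3 : HasDerivAt (fun u : ℂ => f (u, 0)) (dg l m (1, 0)) 0 :=
      HasFDerivAt.comp_hasDerivAt (f := fun u : ℂ => ((u, 0) : ℂ × ℂ)) (l := f) 0 e2 e1
    have e4 : HasDerivAt (fun u : ℂ => (f (u, 0)).1) (dg l m (1, 0)).1 0 :=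
      ((ContinuousLinearMap.fst ℂ ℂ ℂ).hasFDerivAt).comp_hasDerivAt (0 : ℂ) e3
    have e5 : HasDerivAt (fun u : ℂ => (f (u, 0)).2) (dg l m (1, 0)).2 0 :=
      ((ContinuousLinearMap.snd ℂ ℂ ℂ).hasFDerivAt).comp_hasDerivAt (0 : ℂ) e3
    have e6 : HasDerivAt (wu g R) (deriv (wu g R) 0) (f ((0 : ℂ), (0 : ℂ))).2 := by
      have : f ((0 : ℂ), (0 : ℂ)) = 0 := h.lo.fix
      rw [this]
      exact (h.wu_diffAt (y := 0) (by simpa using h.lo.R0)).hasDerivAt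
    have e7 := e4.fun_sub (e6.comp (0 : ℂ) e5)
    have e8 : wu g R 0 = 0 := h.lo'.ws_zero
    simpa [hG, hΦ, xh, e8, dg_apply, Function.comp_def] using e7
  have hl0 : 0 < ‖l‖ := norm_pos_iff.2 h.lo.l0
  set R' : ℝ := min (ρ / 5) (‖l‖ / (2 * (3 * C1 + 1))) with hR'
  have hR'0 : 0 < R' := lt_min (by positivity) (by positivity)
  have hR'1 : R' ≤ ρ / 5 := min_le_left _ _
  have hαn : ∀ z : ℂ × ℂ, ‖z‖ ≤ R' → ‖α z / l - 1‖ ≤ 1 / 2 := by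
    intro z hz
    have h1 := hαL z 0 (hz.trans hR'1) (by simp; positivity)
    rw [hα0, sub_zero] at h1
    have h2 : ‖z‖ ≤ ‖l‖ / (2 * (3 * C1 + 1)) := hz.trans (min_le_right _ _)
    rw [le_div_iff₀ (by positivity)] at h2
    rw [div_sub_one h.lo.l0, norm_div, div_le_iff₀ hl0]
    nlinarith [norm_nonneg z]
  refine ⟨R', hR'0, by linarith, fun z => Complex.log (α z / l), 2 * (3 * C1 / ‖l‖), by positivity,
    by simp [hα0, h.lo.l0], ?_, ?_⟩
  · intro z z' hz hz'
    have h1 := hc_log (hαn z hz) (hαn z' hz')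
    have h2 := hαL z z' (hz.trans hR'1) (hz'.trans hR'1)
    refine h1.trans ?_
    rw [← sub_div, norm_div, mul_assoc]
    gcongr
    rw [div_mul_eq_mul_div]
    gcongr
  · intro z hz
    have hne : α z / l ≠ 0 := by
      intro h0
      have := hαn z hz
      rw [h0] at this
      norm_num at this
    rw [Complex.exp_log hne]
    have h1 := sub_smul_dslope (fun u => G u z.2) 0 (xh g R z)
    simp only [sub_zero, smul_eq_mul] at h1
    rw [hG0 z.2 (by linarith [norm_snd_le z]), sub_zero] at h1
    have h2 : G (xh g R z) z.2 = xh g R (f z) := by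
      simp [hG, hΦ, xh]
    rw [h2] at h1
    rw [← h1]
    have := h.lo.l0
    simp only [hαd]
    field_simp

end sys
end

open Function Set Filter Topology
noncomputable section

lemma hc_exp {a b : ℂ} {M : ℝ} (ha : ‖a‖ ≤ M) (hb : ‖b‖ ≤ M) :
    ‖Complex.exp a - Complex.exp b‖ ≤ Real.exp M * ‖a - b‖ := by
  refine (convex_closedBall (0 : ℂ) M).norm_image_sub_le_of_norm_hasDerivWithin_le (𝕜 := ℂ)
    (f' := Complex.exp) (fun x _ => (Complex.hasDerivAt_exp x).hasDerivWithinAt) ?_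
    (by simpa using hb) (by simpa using ha)
  intro x hx
  rw [Complex.norm_exp]
  exact Real.exp_le_exp.2 ((Complex.re_le_norm x).trans (by simpa using hx))

lemma hc_halfpow {θ : ℝ} (h0 : 0 < θ) (h1 : θ < 1) (n : ℕ) :
    θ ^ (n / 2) ≤ (√θ)⁻¹ * √θ ^ n := by
  have hs : 0 < √θ := Real.sqrt_pos.2 h0
  have hs1 : √θ ≤ 1 := Real.sqrt_le_one.2 h1.le
  have h2 : √θ ^ (2 * (n / 2) + 1) ≤ √θ ^ n := pow_le_pow_of_le_one hs.le hs1 (by omega)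
  rw [pow_succ, pow_mul, Real.sq_sqrt h0.le] at h2
  rw [← div_eq_inv_mul, le_div_iff₀ hs]
  exact h2

lemma hc_geom {θ : ℝ} (h0 : 0 < θ) (h1 : θ < 1) (n : ℕ) :
    ∑ i ∈ Finset.range n, θ ^ i ≤ (1 - θ)⁻¹ := by
  rw [← tsum_geometric_of_lt_one h0.le h1]
  exact (summable_geometric_of_lt_one h0.le h1).sum_le_tsum _ (fun i _ => by positivity)

section sys
variable {f g : ℂ × ℂ → ℂ × ℂ} {l m : ℂ} {θ ε R : ℝ}

lemma xh_iter {R' : ℝ} {ell : ℂ × ℂ → ℂ}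
    (he : ∀ z : ℂ × ℂ, ‖z‖ ≤ R' → xh g R (f z) = l * xh g R z * Complex.exp (ell z))
    {n : ℕ} {z : ℂ × ℂ} (hz : ∀ i < n, ‖f^[i] z‖ ≤ R') :
    xh g R (f^[n] z) = l ^ n * xh g R z * Complex.exp (∑ i ∈ Finset.range n, ell (f^[i] z)) := by
  induction n with
  | zero => simp
  | succ n ih =>
    rw [iterate_succ_apply', he _ (hz n (by omega)), ih (fun i hi => hz i (by omega)),
      Finset.sum_range_succ, Complex.exp_add]
    ring

lemma Sys.Ldiff (h : Sys f g l m θ ε R) {R' C : ℝ} (hR' : R' < R) {ell : ℂ × ℂ → ℂ}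
    (hC : 0 ≤ C) (h0 : ell 0 = 0)
    (hL : ∀ z z' : ℂ × ℂ, ‖z‖ ≤ R' → ‖z'‖ ≤ R' → ‖ell z - ell z'‖ ≤ C * ‖z - z'‖)
    {q : ℂ × ℂ} (hq : ‖q‖ ≤ R') (n : ℕ) :
    ‖(∑ i ∈ Finset.range (n + 1), ell (f^[i] (bP f R (n + 1) q))) -
      ∑ i ∈ Finset.range n, ell (f^[i] (bP f R n q))‖ ≤
      C * R * (4 * (1 - θ)⁻¹ + 1) * θ ^ (n / 2) := by
  have hqR : ‖q‖ ≤ R := hq.trans hR'.le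
  have hR0 := h.lo.R0
  have hθ0 := h.lo.θ0
  have hθ1 := h.lo.θ1
  set z := bP f R n q with hz
  set z' := bP f R (n + 1) q with hz'
  obtain ⟨s1, s2, s3⟩ := h.lo.bP_spec n hqR
  obtain ⟨s1', s2', s3'⟩ := h.lo.bP_spec (n + 1) hqR
  have n1 : ∀ i ≤ n, ‖f^[i] z‖ ≤ R' := fun i hi => (h.lo.bP_norm hqR hi).trans hq
  have n2 : ∀ i ≤ n + 1, ‖f^[i] z'‖ ≤ R' := fun i hi => (h.lo.bP_norm hqR hi).trans hq
  have d1 : ∀ i ≤ n, ‖f^[i] z' - f^[i] z‖ ≤ 2 * R * θ ^ (n - i) := by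
    intro i hi
    have := h.lo.hyp (n := n) (fun i hi => s2' i (by omega)) s2 hi
    rw [s1, s1', sub_self, norm_zero, mul_zero] at this
    refine this.trans (max_le (by positivity) ?_)
    have a1 := (norm_snd_le _).trans (s2' n (by omega))
    have a2 := (norm_snd_le _).trans (s2 n le_rfl)
    have a3 := norm_sub_le (f^[n] z').2 (f^[n] z).2
    rw [mul_comm]
    refine mul_le_mul_of_nonneg_right ?_ (by positivity)
    linarith
  have d2 : ∀ i ≤ n, ‖f^[i + 1] z' - f^[i] z‖ ≤ 2 * R * θ ^ i := by
    intro i hi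
    have := h.lo.hyp (n := n) (z := f z') (fun i hi => by
      rw [← iterate_succ_apply]; exact s2' (i + 1) (by omega)) s2 hi
    rw [← iterate_succ_apply, ← iterate_succ_apply, s3, s3', sub_self, norm_zero, mul_zero] at this
    refine this.trans (max_le ?_ (by positivity))
    have a1 := (norm_fst_le _).trans (s2' 1 (by omega))
    have a2 := (norm_fst_le _).trans (s2 0 (by omega))
    have a3 := norm_sub_le (f z').1 (z).1
    rw [mul_comm]
    refine mul_le_mul_of_nonneg_right ?_ (by positivity)
    simp only [iterate_one, iterate_zero, id] at a1 a2
    linarith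
  set k := n / 2 with hk
  have d3 : ‖f^[k] z'‖ ≤ R * θ ^ k := by
    have := h.lo.hyp0 s2' (i := k) (by omega)
    rw [s1', s3'] at this
    refine this.trans (max_le ?_ ?_)
    · rw [mul_comm]
      exact mul_le_mul_of_nonneg_right ((norm_fst_le q).trans hqR) (by positivity)
    · have a : θ ^ (n + 1 - k) ≤ θ ^ k := pow_le_pow_of_le_one hθ0.le hθ1.le (by omega)
      rw [mul_comm]
      exact mul_le_mul ((norm_snd_le q).trans hqR) a (by positivity) hR0.le
  have hsplit : (∑ i ∈ Finset.range (n + 1), ell (f^[i] z')) - ∑ i ∈ Finset.range n, ell (f^[i] z)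
      = (∑ i ∈ Finset.range k, (ell (f^[i] z') - ell (f^[i] z))) + ell (f^[k] z') +
        ∑ i ∈ Finset.range (n - k), (ell (f^[k + i + 1] z') - ell (f^[k + i] z)) := by
    have e1 : n + 1 = (k + 1) + (n - k) := by omega
    have e2 : n = k + (n - k) := by omega
    rw [e1, Finset.sum_range_add, Finset.sum_range_succ]
    conv_lhs => rw [e2]
    rw [Finset.sum_range_add, Finset.sum_sub_distrib, Finset.sum_sub_distrib]
    simp only [add_tsub_cancel_left]
    have : ∀ i, k + 1 + i = k + i + 1 := fun i => by ring
    simp only [this]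
    ring
  rw [hsplit]
  have b1 : ‖∑ i ∈ Finset.range k, (ell (f^[i] z') - ell (f^[i] z))‖ ≤
      C * (2 * R) * θ ^ k * (1 - θ)⁻¹ := by
    calc _ ≤ ∑ i ∈ Finset.range k, C * (2 * R) * θ ^ k * θ ^ (k - 1 - i) := by
          refine norm_sum_le_of_le _ fun i hi => ?_
          have hi' := Finset.mem_range.1 hi
          refine (hL _ _ (n2 i (by omega)) (n1 i (by omega))).trans ?_
          have a : θ ^ (n - i) ≤ θ ^ (k + (k - 1 - i)) :=
            pow_le_pow_of_le_one hθ0.le hθ1.le (by omega)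
          rw [pow_add] at a
          calc C * ‖f^[i] z' - f^[i] z‖ ≤ C * (2 * R * (θ ^ k * θ ^ (k - 1 - i))) := by
                refine mul_le_mul_of_nonneg_left ((d1 i (by omega)).trans ?_) hC
                exact mul_le_mul_of_nonneg_left a (by positivity)
            _ = _ := by ring
      _ = C * (2 * R) * θ ^ k * ∑ i ∈ Finset.range k, θ ^ i := by
          rw [← Finset.mul_sum, Finset.sum_range_reflect (fun i => θ ^ i)]
      _ ≤ _ := mul_le_mul_of_nonneg_left (hc_geom hθ0 hθ1 k) (by positivity)
  have b3 : ‖∑ i ∈ Finset.range (n - k), (ell (f^[k + i + 1] z') - ell (f^[k + i] z))‖ ≤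
      C * (2 * R) * θ ^ k * (1 - θ)⁻¹ := by
    calc _ ≤ ∑ i ∈ Finset.range (n - k), C * (2 * R) * θ ^ k * θ ^ i := by
          refine norm_sum_le_of_le _ fun i hi => ?_
          have hi' := Finset.mem_range.1 hi
          refine (hL _ _ (n2 _ (by omega)) (n1 _ (by omega))).trans ?_
          calc C * ‖f^[k + i + 1] z' - f^[k + i] z‖ ≤ C * (2 * R * θ ^ (k + i)) :=
                mul_le_mul_of_nonneg_left (d2 _ (by omega)) hC
            _ = _ := by ring
      _ = C * (2 * R) * θ ^ k * ∑ i ∈ Finset.range (n - k), θ ^ i := by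
          rw [← Finset.mul_sum]
      _ ≤ _ := mul_le_mul_of_nonneg_left (hc_geom hθ0 hθ1 _) (by positivity)
  have b2 : ‖ell (f^[k] z')‖ ≤ C * R * θ ^ k := by
    have := hL (f^[k] z') 0 (n2 k (by omega)) (by simpa using (norm_nonneg q).trans hq)
    rw [h0, sub_zero, sub_zero] at this
    refine this.trans ?_
    rw [mul_assoc]
    exact mul_le_mul_of_nonneg_left d3 hC
  refine (norm_add₃_le).trans ?_
  have : C * R * (4 * (1 - θ)⁻¹ + 1) * θ ^ k = C * (2 * R) * θ ^ k * (1 - θ)⁻¹ + C * R * θ ^ k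
    + C * (2 * R) * θ ^ k * (1 - θ)⁻¹ := by ring
  rw [this]
  gcongr

lemma Sys.xh_lower (h : Sys f g l m θ ε R) {x : ℂ} (hx : ‖x‖ ≤ R) :
    (1 - θ) * ‖x‖ ≤ ‖xh g R (x, ws f R x)‖ := by
  have h1 := h.lo.ws_norm hx
  have hθ := h.lo.θ1
  have hθ0 := h.lo.θ0
  have h5 : ‖ws f R x‖ ≤ ‖x‖ := h1.trans (by nlinarith [norm_nonneg x])
  have h2 := h.lo'.ws_norm (h5.trans hx)
  have h3 := norm_sub_norm_le x (wu g R (ws f R x))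
  have h4 := mul_le_mul_of_nonneg_left h5 hθ0.le
  simp only [xh]
  simp only [wu] at *
  nlinarith [norm_nonneg x]

lemma Sys.Kthm (h : Sys f g l m θ ε R) : ∃ r : ℝ, 0 < r ∧ r < R ∧ ∃ K : ℂ × ℂ → ℂ,
    TendstoUniformlyOn (fun n q => (l ^ n)⁻¹ * xh g R (f^[n] (bP f R n q))) K atTop
      (Metric.ball 0 r) ∧
    (∀ q ∈ Metric.ball (0 : ℂ × ℂ) r, DifferentiableAt ℂ K q) ∧
    (∀ q ∈ Metric.ball (0 : ℂ × ℂ) r, q.1 ≠ 0 → K q ≠ 0) ∧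
    (∀ q ∈ Metric.ball (0 : ℂ × ℂ) r, fderiv ℂ K q (1, 0) ≠ 0) := by
  obtain ⟨R', hR'0, hR'R, ell, C, hC, h0, hL, he⟩ := h.mult
  have hR0 := h.lo.R0
  have hθ0 := h.lo.θ0
  have hθ1 := h.lo.θ1
  set L : ℕ → ℂ × ℂ → ℂ := fun n q => ∑ i ∈ Finset.range n, ell (f^[i] (bP f R n q)) with hLd
  set t := √θ with ht
  have ht0 : 0 < t := Real.sqrt_pos.2 hθ0
  have ht1 : t < 1 := by rw [ht, Real.sqrt_lt' one_pos]; simpa using hθ1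
  set D := C * R * (4 * (1 - θ)⁻¹ + 1) * t⁻¹ with hD
  have h1θ : 0 < (1 - θ)⁻¹ := inv_pos.2 (by linarith)
  have hD0 : 0 ≤ D := by positivity
  have hstep : ∀ q : ℂ × ℂ, ‖q‖ ≤ R' → ∀ n, dist (L n q) (L (n + 1) q) ≤ D * t ^ n := by
    intro q hq n
    rw [dist_comm, dist_eq_norm]
    refine (h.Ldiff hR'R hC h0 hL hq n).trans ?_
    rw [hD, mul_assoc _ t⁻¹]
    exact mul_le_mul_of_nonneg_left (hc_halfpow hθ0 hθ1 n) (by positivity)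
  have hex : ∀ q : ℂ × ℂ, ‖q‖ ≤ R' → ∃ a, Tendsto (fun n => L n q) atTop (𝓝 a) := fun q hq =>
    cauchySeq_tendsto_of_complete (cauchySeq_of_le_geometric t D ht1 (hstep q hq))
  choose! Li hLi using hex
  have hdist : ∀ q : ℂ × ℂ, ‖q‖ ≤ R' → ∀ n, ‖L n q - Li q‖ ≤ D / (1 - t) * t ^ n := by
    intro q hq n
    rw [← dist_eq_norm]
    refine (dist_le_of_le_geometric_of_tendsto t D ht1 (hstep q hq) (hLi q hq) n).trans
      (le_of_eq ?_)
    ring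
  set B := D / (1 - t) with hB
  have hB0 : 0 ≤ B := div_nonneg hD0 (by linarith)
  have hLib : ∀ q : ℂ × ℂ, ‖q‖ ≤ R' → ‖Li q‖ ≤ B := by
    intro q hq
    have := hdist q hq 0
    simpa [hLd] using this
  have hLb : ∀ q : ℂ × ℂ, ‖q‖ ≤ R' → ∀ n, ‖L n q‖ ≤ 2 * B := by
    intro q hq n
    have h1 := hdist q hq n
    have h2 := hLib q hq
    have h3 := norm_add_le (L n q - Li q) (Li q)
    rw [sub_add_cancel] at h3
    have h4 : B * t ^ n ≤ B * 1 := mul_le_mul_of_nonneg_left (pow_le_one₀ ht0.le ht1.le) hB0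
    linarith
  set K : ℂ × ℂ → ℂ := fun q => xh g R (q.1, ws f R q.1) * Complex.exp (Li q) with hK
  set Kn : ℕ → ℂ × ℂ → ℂ := fun n q => (l ^ n)⁻¹ * xh g R (f^[n] (bP f R n q)) with hKn
  have hKn' : ∀ n, ∀ q : ℂ × ℂ, ‖q‖ ≤ R' → Kn n q = xh g R (bP f R n q) * Complex.exp (L n q) := by
    intro n q hq
    simp only [hKn]
    rw [xh_iter he (fun i hi => (h.lo.bP_norm (hq.trans hR'R.le) hi.le).trans hq)]
    have := pow_ne_zero n h.lo.l0
    simp only [hLd]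
    field_simp
  have hxb : ∀ z : ℂ × ℂ, ‖z‖ ≤ R → ‖xh g R z‖ ≤ 2 * R := by
    intro z hz
    have := h.xh_lip hz (z' := 0) (by simpa using hR0.le)
    rw [h.xh_zero, sub_zero, sub_zero] at this
    linarith
  have hKb : ∀ q : ℂ × ℂ, ‖q‖ ≤ R' → ∀ n, ‖Kn n q - K q‖ ≤
      (4 * R * Real.exp (2 * B)) * θ ^ n + (2 * R * Real.exp (2 * B) * B) * t ^ n := by
    intro q hq n
    have hqR := hq.trans hR'R.le
    rw [hKn' n q hq]
    simp only [hK]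
    have hq1 : ‖q.1‖ ≤ R := (norm_fst_le q).trans hqR
    have hP := (h.lo.bP_spec n hqR).2.1 0 (Nat.zero_le n)
    have hW := h.lo.ws_spec hq1 0
    simp only [iterate_zero, id] at hP hW
    have e1 : xh g R (bP f R n q) * Complex.exp (L n q) -
        xh g R (q.1, ws f R q.1) * Complex.exp (Li q)
        = (xh g R (bP f R n q) - xh g R (q.1, ws f R q.1)) * Complex.exp (L n q) +
        xh g R (q.1, ws f R q.1) * (Complex.exp (L n q) - Complex.exp (Li q)) := by ring
    rw [e1]
    refine (norm_add_le _ _).trans ?_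
    rw [norm_mul, norm_mul]
    have a1 : ‖xh g R (bP f R n q) - xh g R (q.1, ws f R q.1)‖ ≤ 4 * R * θ ^ n := by
      have := h.xh_lip hP hW
      have := h.lo.ws_unif hqR n
      linarith
    have a2 : ‖Complex.exp (L n q)‖ ≤ Real.exp (2 * B) := by
      rw [Complex.norm_exp]
      exact Real.exp_le_exp.2 ((Complex.re_le_norm _).trans (hLb q hq n))
    have a3 := hxb _ hW
    have a4 : ‖Complex.exp (L n q) - Complex.exp (Li q)‖ ≤ Real.exp (2 * B) * (B * t ^ n) := by
      refine (hc_exp (hLb q hq n) ((hLib q hq).trans (by linarith))).trans ?_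
      exact mul_le_mul_of_nonneg_left (hdist q hq n) (Real.exp_pos _).le
    have a5 := mul_le_mul a1 a2 (norm_nonneg _) (by positivity)
    have a6 := mul_le_mul a3 a4 (norm_nonneg _) (by positivity)
    calc _ ≤ _ := add_le_add a5 a6
      _ = _ := by ring
  have hU : TendstoUniformlyOn Kn K atTop (Metric.ball 0 R') := by
    rw [Metric.tendstoUniformlyOn_iff]
    intro e hepos
    have hlim : Tendsto (fun n : ℕ => (4 * R * Real.exp (2 * B)) * θ ^ n +
        (2 * R * Real.exp (2 * B) * B) * t ^ n) atTop (𝓝 0) := by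
      have h1 := (tendsto_pow_atTop_nhds_zero_of_lt_one hθ0.le hθ1).const_mul
        (4 * R * Real.exp (2 * B))
      have h2 := (tendsto_pow_atTop_nhds_zero_of_lt_one ht0.le ht1).const_mul
        (2 * R * Real.exp (2 * B) * B)
      simpa using h1.add h2
    filter_upwards [hlim.eventually_lt_const hepos] with n hn q hq
    rw [dist_comm, dist_eq_norm]
    exact (hKb q (by simpa using (Metric.ball_subset_closedBall hq)) n).trans_lt hn
  have hKlow : ∀ q : ℂ × ℂ, ‖q‖ ≤ R' → (1 - θ) * Real.exp (-B) * ‖q.1‖ ≤ ‖K q‖ := by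
    intro q hq
    have h1 := h.xh_lower ((norm_fst_le q).trans (hq.trans hR'R.le))
    have h2 : Real.exp (-B) ≤ ‖Complex.exp (Li q)‖ := by
      rw [Complex.norm_exp]
      refine Real.exp_le_exp.2 ?_
      have := (Complex.abs_re_le_norm (Li q)).trans (hLib q hq)
      linarith [abs_le.1 this]
    simp only [hK, norm_mul]
    have := mul_le_mul h1 h2 (Real.exp_pos _).le (norm_nonneg _)
    linarith
  set c := (1 - θ) * Real.exp (-B) with hc
  have hc0 : 0 < c := mul_pos (by linarith) (Real.exp_pos _)
  have hKd : ∀ q ∈ Metric.ball (0 : ℂ × ℂ) (R' / 2), DifferentiableAt ℂ K q := by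
    refine (ha_weier hR'0 (Eventually.of_forall fun n => ?_) hU).1
    intro q hq
    have hq' : ‖q‖ < R := by
      have : ‖q‖ < R' := by simpa using hq
      linarith
    refine DifferentiableAt.differentiableWithinAt ?_
    simp only [hKn]
    refine DifferentiableAt.const_mul ?_ _
    have a1 : DifferentiableAt ℂ (fun q => f^[n] (bP f R n q)) q :=
      DifferentiableAt.comp (g := f^[n]) q ((h.lo.dif.iterate n) _) (h.lo.bP_diff n hq')
    exact DifferentiableAt.comp (g := xh g R) (f := fun q => f^[n] (bP f R n q)) q
      (h.xh_diffAt ((h.lo.bP_norm hq'.le le_rfl).trans_lt hq')) a1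
  have hK0 : K 0 = 0 := by
    have : xh g R ((0 : ℂ), (0 : ℂ)) = 0 := h.xh_zero
    simp [hK, h.lo.ws_zero, this]
  have hder0 : fderiv ℂ K 0 (1, 0) ≠ 0 := by
    intro hzero
    have a1 : HasDerivAt (fun x : ℂ => ((x, 0) : ℂ × ℂ)) ((1, 0) : ℂ × ℂ) 0 :=
      (hasDerivAt_id (0 : ℂ)).prodMk (hasDerivAt_const (0 : ℂ) (0 : ℂ))
    have a2 : HasFDerivAt K (fderiv ℂ K 0) ((0, 0) : ℂ × ℂ) :=
      (hKd 0 (Metric.mem_ball_self (by positivity))).hasFDerivAt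
    have a3 : HasDerivAt (fun x : ℂ => K (x, 0)) (fderiv ℂ K 0 (1, 0)) 0 :=
      HasFDerivAt.comp_hasDerivAt (f := fun x : ℂ => ((x, 0) : ℂ × ℂ)) (l := K) 0 a2 a1
    rw [hzero, hasDerivAt_iff_isLittleO] at a3
    have a4 := a3.def (half_pos hc0)
    have a5 : ∀ᶠ x : ℂ in 𝓝[≠] 0, ‖x‖ < R' ∧ x ≠ 0 := by
      have : ∀ᶠ x : ℂ in 𝓝 0, ‖x‖ < R' :=
        continuous_norm.continuousAt.eventually_lt_const (by simpa using hR'0)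
      exact (this.filter_mono nhdsWithin_le_nhds).and self_mem_nhdsWithin
    obtain ⟨x, ⟨hx1, hx2⟩, hx3⟩ := (a5.and (a4.filter_mono nhdsWithin_le_nhds)).exists
    have a6 := hKlow (x, 0) (by simpa [Prod.norm_def] using hx1.le)
    have hK00 : K (0, 0) = 0 := hK0
    simp only [hK00, sub_zero, smul_zero] at hx3 a6
    have := norm_pos_iff.2 hx2
    nlinarith
  have hev : ∀ᶠ q in 𝓝 (0 : ℂ × ℂ), fderiv ℂ K q (1, 0) ≠ 0 := by
    have hcont : ContinuousAt (fderiv ℂ K) 0 :=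
      ha_fderiv_cont (eventually_of_mem (Metric.ball_mem_nhds 0 (by positivity)) hKd)
    have : ContinuousAt (fun q => fderiv ℂ K q (1, 0)) 0 := hcont.clm_apply continuousAt_const
    exact this.eventually_ne hder0
  obtain ⟨r, hr, hball⟩ := Metric.eventually_nhds_iff_ball.1 hev
  refine ⟨min r (R' / 2), lt_min hr (by positivity), ?_, K, ?_, ?_, ?_, ?_⟩
  · have := min_le_right r (R' / 2); linarith
  · refine hU.mono (Metric.ball_subset_ball ?_)
    have := min_le_right r (R' / 2); linarith
  · exact fun q hq => hKd q (Metric.ball_subset_ball (min_le_right _ _) hq)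
  · intro q hq hq1 hKq
    have h1 : ‖q‖ ≤ R' := by
      have : ‖q‖ < min r (R' / 2) := by simpa using hq
      have := min_le_right r (R' / 2); linarith
    have h2 := hKlow q h1
    rw [hKq, norm_zero] at h2
    have := norm_pos_iff.2 hq1
    nlinarith
  · exact fun q hq => hball q (Metric.ball_subset_ball (min_le_left _ _) hq)

/-- Normal form of the passage near the saddle. -/
lemma Sys.nf (h : Sys f g l m θ ε R) : ∃ r : ℝ, 0 < r ∧ r < R ∧ ∃ K H : ℂ × ℂ → ℂ,
    (TendstoUniformlyOn (fun n q => (l ^ n)⁻¹ * ((f^[n] (bP f R n q)).1 - wu g R q.2)) K atTop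
      (Metric.ball 0 r) ∧
    (∀ q ∈ Metric.ball (0 : ℂ × ℂ) r, DifferentiableAt ℂ K q) ∧
    (∀ q ∈ Metric.ball (0 : ℂ × ℂ) r, q.1 ≠ 0 → K q ≠ 0) ∧
    (∀ q ∈ Metric.ball (0 : ℂ × ℂ) r, fderiv ℂ K q (1, 0) ≠ 0)) ∧
    (TendstoUniformlyOn (fun n q => m ^ n * ((bP f R n q).2 - ws f R q.1)) H atTop
      (Metric.ball 0 r) ∧
    (∀ q ∈ Metric.ball (0 : ℂ × ℂ) r, DifferentiableAt ℂ H q) ∧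
    (∀ q ∈ Metric.ball (0 : ℂ × ℂ) r, q.2 ≠ 0 → H q ≠ 0) ∧
    (∀ q ∈ Metric.ball (0 : ℂ × ℂ) r, fderiv ℂ H q (0, 1) ≠ 0)) := by
  obtain ⟨r1, hr1, hr1R, K, k1, k2, k3, k4⟩ := h.Kthm
  obtain ⟨r2, hr2, hr2R, H, j1, j2, j3, j4⟩ := h.swap.Kthm
  set r := min r1 r2 with hr
  have s1 : Metric.ball (0 : ℂ × ℂ) r ⊆ Metric.ball 0 r1 := Metric.ball_subset_ball (min_le_left _ _)
  have s2 : ∀ q ∈ Metric.ball (0 : ℂ × ℂ) r, q.swap ∈ Metric.ball (0 : ℂ × ℂ) r2 := by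
    intro q hq
    rw [mem_ball_zero_iff] at *
    rw [norm_swap']
    exact hq.trans_le (min_le_right _ _)
  have hsw : ∀ q : ℂ × ℂ, HasFDerivAt (Prod.swap : ℂ × ℂ → ℂ × ℂ)
      ((ContinuousLinearMap.snd ℂ ℂ ℂ).prod (ContinuousLinearMap.fst ℂ ℂ ℂ)) q := fun q =>
    hasFDerivAt_snd.prodMk hasFDerivAt_fst
  have hnr : ∀ q ∈ Metric.ball (0 : ℂ × ℂ) r, ‖q‖ ≤ R := by
    intro q hq
    have h1 : ‖q‖ < r := by simpa using hq
    have := min_le_left r1 r2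
    linarith
  refine ⟨r, lt_min hr1 hr2, (min_le_left _ _).trans_lt hr1R, K, fun q => H q.swap,
    ⟨?_, fun q hq => k2 q (s1 hq), fun q hq => k3 q (s1 hq), fun q hq => k4 q (s1 hq)⟩, ?_, ?_, ?_, ?_⟩
  · refine (k1.mono s1).congr (Eventually.of_forall fun n q hq => ?_)
    simp only [xh, (h.lo.bP_spec n (hnr q hq)).2.2]
  · rw [Metric.tendstoUniformlyOn_iff] at j1 ⊢
    intro e he
    filter_upwards [j1 e he] with n hn q hq
    have h1 := hn q.swap (s2 q hq)
    rw [h.bP_swap n (hnr q hq), sw_iter, Prod.swap_swap, h.gf] at h1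
    simp only [xh, wu, sw_sw, Prod.fst_swap, Prod.snd_swap, (h.lo.bP_spec n (hnr q hq)).1] at h1
    rwa [inv_pow, inv_inv] at h1
  · intro q hq
    exact DifferentiableAt.comp q (j2 _ (s2 q hq)) (hsw q).differentiableAt
  · intro q hq hq2
    exact j3 _ (s2 q hq) hq2
  · intro q hq
    have h1 := ((j2 _ (s2 q hq)).hasFDerivAt.comp q (hsw q)).fderiv
    have h2 : fderiv ℂ (fun q : ℂ × ℂ => H q.swap) q = _ := h1
    rw [h2]
    exact j4 _ (s2 q hq)

end sys
end

open Function Set Filter Topology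
noncomputable section

variable {f g : ℂ × ℂ → ℂ × ℂ} {l m : ℂ} {θ ε R : ℝ}

lemma hd_inv {s : ℂ → ℂ} {r : ℝ} (hr : 0 < r) (hs : ∀ ξ, ‖ξ‖ < r → DifferentiableAt ℂ s ξ)
    (h0 : s 0 = 0) (hd : deriv s 0 ≠ 0) :
    ∃ (x : ℂ → ℂ) (δ r0 : ℝ), 0 < δ ∧ 0 < r0 ∧ r0 ≤ r ∧ (∀ ξ, ‖ξ‖ < r0 → x (s ξ) = ξ) ∧
      ∀ t, ‖t‖ < δ → DifferentiableAt ℂ x t ∧ ‖x t‖ < r0 ∧ s (x t) = t := by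
  have hev : ∀ᶠ ξ in 𝓝 (0 : ℂ), DifferentiableAt ℂ s ξ := by
    filter_upwards [Metric.ball_mem_nhds (0 : ℂ) hr] with ξ hξ
    exact hs ξ (by simpa using hξ)
  have hA : AnalyticAt ℂ s 0 := Complex.analyticAt_iff_eventually_differentiableAt.2 hev
  have hc : ContDiffAt ℂ 1 s 0 := hA.contDiffAt
  have hst : HasStrictDerivAt s (deriv s 0) 0 := hc.hasStrictDerivAt one_ne_zero
  have hst' := hst.hasStrictFDerivAt_equiv hd
  set x := hst'.localInverse s _ 0 with hx
  have e1 : ∀ᶠ ξ in 𝓝 (0 : ℂ), x (s ξ) = ξ := hst'.eventually_left_inverse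
  have e2 : ∀ᶠ t in 𝓝 (0 : ℂ), s (x t) = t := by
    have := hst'.eventually_right_inverse; rwa [h0] at this
  have e3 : ContinuousAt x 0 := by
    have := hst'.localInverse_continuousAt; rwa [h0] at this
  have x0 : x 0 = 0 := by
    have := e1.self_of_nhds; rwa [h0] at this
  obtain ⟨r1, hr1, e1'⟩ := Metric.eventually_nhds_iff.1 e1
  set r0 := min r r1
  have hr0 : 0 < r0 := lt_min hr hr1
  have e4 : ∀ᶠ t in 𝓝 (0 : ℂ), ‖x t‖ < r0 := by
    have : Tendsto x (𝓝 0) (𝓝 0) := by have := e3.tendsto; rwa [x0] at this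
    have := this.norm
    rw [norm_zero] at this
    exact this.eventually (gt_mem_nhds hr0)
  have hst2 := hst.to_localInverse hd
  rw [h0] at hst2
  have e5 : ∀ᶠ t in 𝓝 (0 : ℂ), deriv s (x t) ≠ 0 := by
    have h1 : ContinuousAt (fun t => deriv s (x t)) 0 := by
      have h2 : ContinuousAt (deriv s) (x 0) := by rw [x0]; exact hA.deriv.continuousAt
      exact ContinuousAt.comp (g := deriv s) h2 e3
    exact h1.eventually_ne (by rw [x0]; exact hd)
  have e6 : ∀ᶠ t in 𝓝 (0 : ℂ), DifferentiableAt ℂ x t := by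
    have : ContDiffAt ℂ 1 x 0 := by
      have := hc.to_localInverse hst'.hasFDerivAt one_ne_zero
      rwa [h0] at this
    filter_upwards [this.eventually (by simp)] with t ht using ht.differentiableAt one_ne_zero
  obtain ⟨δ, hδ, e7⟩ := Metric.eventually_nhds_iff.1 (e2.and (e4.and e6))
  refine ⟨x, δ, r0, hδ, hr0, min_le_left _ _, fun ξ hξ => e1' ?_, fun t ht => ?_⟩
  · simpa using hξ.trans_le (min_le_right _ _)
  · obtain ⟨a, b, c⟩ := e7 (by simpa using ht : dist t 0 < δ)
    exact ⟨c, b, a⟩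

lemma Loc.ws_inv (h : Loc f l m θ ε R) {x : ℂ} (hx : ‖x‖ ≤ R) :
    (f (x, ws f R x)).2 = ws f R (f (x, ws f R x)).1 ∧ ‖(f (x, ws f R x)).1‖ ≤ θ * ‖x‖ := by
  have h1 := h.ws_spec hx
  constructor
  · apply h.ws_uniq
    intro i
    rw [← iterate_succ_apply]
    exact h1 (i + 1)
  · have h2 := h.stab_hyp h1 (fun i => h.orb0 i i le_rfl) 1
    have h3 := norm_fst_le (f (x, ws f R x))
    simp [h.fix] at h2
    exact h3.trans h2

lemma Sys.Kfun (h : Sys f g l m θ ε R) : ∃ r : ℝ, 0 < r ∧ r < R ∧ ∃ s : ℂ → ℂ,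
    (∀ ξ, ‖ξ‖ < r → DifferentiableAt ℂ s ξ) ∧ s 0 = 0 ∧ deriv s 0 ≠ 0 ∧
    (∀ ξ, ‖ξ‖ < r → s (f (ξ, ws f R ξ)).1 = l * s ξ) := by
  obtain ⟨r, hr, hrR, K, hK, hKd, hK0, hK1⟩ := h.Kthm
  have L := h.lo
  have hmem : ∀ ξ : ℂ, ‖ξ‖ < r → ((ξ, 0) : ℂ × ℂ) ∈ Metric.ball (0 : ℂ × ℂ) r := by
    intro ξ hξ; simpa [Prod.norm_def] using hξ
  have hnn : ∀ ξ : ℂ, ‖((ξ, 0) : ℂ × ℂ)‖ = ‖ξ‖ := by intro ξ; simp [Prod.norm_def]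
  have hsd : ∀ ξ : ℂ, ‖ξ‖ < r → HasDerivAt (fun ξ => K (ξ, 0)) (fderiv ℂ K (ξ, 0) (1, 0)) ξ := by
    intro ξ hξ
    have e3 : HasDerivAt (fun ξ : ℂ => ((ξ, 0) : ℂ × ℂ)) (1, 0) ξ :=
      (hasDerivAt_id ξ).prodMk (hasDerivAt_const ξ 0)
    exact (hKd _ (hmem ξ hξ)).hasFDerivAt.comp_hasDerivAt (f := fun ξ : ℂ => ((ξ, 0) : ℂ × ℂ)) ξ e3
  refine ⟨r, hr, hrR, fun ξ => K (ξ, 0), fun ξ hξ => (hsd ξ hξ).differentiableAt, ?_, ?_, ?_⟩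
  · have h1 := hK.tendsto_at (hmem 0 (by simpa using hr))
    have h2 : ∀ n : ℕ, (l ^ n)⁻¹ * xh g R (f^[n] (bP f R n (0, 0))) = 0 := by
      intro n
      have h3 := L.bP_norm (n := n) (q := 0) (by simpa using L.R0.le) le_rfl
      have h4 : f^[n] (bP f R n (0, 0)) = 0 := by
        rw [← norm_le_zero_iff]; rw [norm_zero] at h3; exact h3
      rw [h4, h.xh_zero, mul_zero]
    simp only [h2] at h1
    exact tendsto_nhds_unique h1 tendsto_const_nhds
  · have := (hsd 0 (by simpa using hr)).deriv
    rw [this]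
    exact hK1 _ (hmem 0 (by simpa using hr))
  · intro ξ hξ
    have hξR : ‖ξ‖ ≤ R := (hξ.trans hrR).le
    have hq : ‖((ξ, 0) : ℂ × ℂ)‖ ≤ R := by rw [hnn]; exact hξR
    set w : ℕ → ℂ × ℂ := fun n => f (bP f R (n + 1) (ξ, 0)) with hw
    have hwO : ∀ n, Orb f R n (w n) := by
      intro n i hi
      rw [hw]; simp only
      rw [← iterate_succ_apply]
      exact (L.bP_spec (n + 1) hq).2.1 (i + 1) (by omega)
    have hw2 : ∀ n, (f^[n] (w n)).2 = 0 := by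
      intro n
      rw [hw]; simp only
      rw [← iterate_succ_apply]
      exact (L.bP_spec (n + 1) hq).2.2
    have hb : ∀ n, bP f R n ((w n).1, 0) = w n := by
      intro n
      have := L.bP_uniq (hwO n)
      rwa [hw2] at this
    have hwn : ∀ n, ‖(w n).1‖ < r := by
      intro n
      have := L.bP_norm (n := n + 1) hq (i := 1) (by omega)
      rw [hnn] at this
      exact ((norm_fst_le _).trans this).trans_lt hξ
    have hb1 : Tendsto (fun n => bP f R (n + 1) (ξ, 0)) atTop (𝓝 (ξ, ws f R ξ)) := by
      rw [tendsto_iff_norm_sub_tendsto_zero]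
      refine squeeze_zero (fun _ => norm_nonneg _) (fun n => L.ws_unif hq (n + 1)) ?_
      exact (L.pow_lim (2 * R)).comp (tendsto_add_atTop_nat 1)
    have hw3 : Tendsto w atTop (𝓝 (f (ξ, ws f R ξ))) :=
      (L.dif.continuous.tendsto _).comp hb1
    have hw4 : Tendsto (fun n => (((w n).1, 0) : ℂ × ℂ)) atTop (𝓝 ((f (ξ, ws f R ξ)).1, 0)) :=
      ((continuous_fst.tendsto _).comp hw3).prodMk_nhds tendsto_const_nhds
    have hlim : ‖(f (ξ, ws f R ξ)).1‖ < r := by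
      have h1 := (L.ws_inv hξR).2
      have h2 : θ * ‖ξ‖ ≤ 1 * ‖ξ‖ := mul_le_mul_of_nonneg_right L.θ1.le (norm_nonneg _)
      linarith
    have h5 := hK.tendsto_comp
      (hKd _ (hmem _ hlim)).continuousAt.continuousWithinAt
      (tendsto_nhdsWithin_iff.2 ⟨hw4, Eventually.of_forall fun n => hmem _ (hwn n)⟩)
    have h6 := ((hK.tendsto_at (hmem ξ hξ)).comp (tendsto_add_atTop_nat 1)).const_mul l
    refine tendsto_nhds_unique h5 (h6.congr fun n => ?_)
    simp only [comp]
    rw [hb, hw]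
    simp only
    rw [← iterate_succ_apply f n, pow_succ, mul_inv]
    have := L.l0
    field_simp

lemma Sys.lin (h : Sys f g l m θ ε R) : ∃ (S : ℂ → ℂ × ℂ) (s : ℂ → ℂ) (δ r0 : ℝ),
    0 < δ ∧ 0 < r0 ∧ r0 < R ∧ Differentiable ℂ S ∧ Injective S ∧ S 0 = 0 ∧
    (∀ t, f (S t) = S (l * t)) ∧
    (∀ t, ‖t‖ < δ → (S t).2 = ws f R (S t).1 ∧ ‖(S t).1‖ < r0 ∧ s (S t).1 = t) ∧
    (∀ ξ, ‖ξ‖ < r0 → ‖s ξ‖ < δ → S (s ξ) = (ξ, ws f R ξ)) ∧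
    (∀ ξ, ‖ξ‖ < r0 → DifferentiableAt ℂ s ξ) ∧ s 0 = 0 := by
  obtain ⟨r, hr, hrR, s, hsd, hs0, hs1, hsf⟩ := h.Kfun
  obtain ⟨x, δ, r0, hδ, hr0, hr0r, hx1, hx2⟩ := hd_inv hr hsd hs0 hs1
  have L := h.lo
  set ψ : ℂ → ℂ × ℂ := fun t => (x t, ws f R (x t)) with hψ
  have l1 := L.l1
  have lδ : ∀ t, ‖t‖ < δ → ‖l * t‖ < δ := by
    intro t ht
    rw [norm_mul]
    have : ‖l‖ * ‖t‖ ≤ 1 * ‖t‖ := mul_le_mul_of_nonneg_right l1.le (norm_nonneg _)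
    linarith
  have hψf : ∀ t, ‖t‖ < δ → f (ψ t) = ψ (l * t) := by
    intro t ht
    obtain ⟨_, a2, a3⟩ := hx2 t ht
    have b0 : ‖x t‖ < r := a2.trans_le hr0r
    have b1 := L.ws_inv (x := x t) (b0.trans hrR).le
    have b2 := hsf (x t) b0
    rw [a3] at b2
    have b3 : θ * ‖x t‖ ≤ 1 * ‖x t‖ := mul_le_mul_of_nonneg_right L.θ1.le (norm_nonneg _)
    have b4 : x (l * t) = (f (ψ t)).1 := by
      rw [← b2]
      exact hx1 _ (by linarith [b1.2])
    have b5 : (f (ψ t)).2 = ws f R (f (ψ t)).1 := b1.1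
    apply Prod.ext
    · exact b4.symm
    · rw [b5, ← b4]
  have hex : ∀ t, ∃ n : ℕ, ‖l ^ n * t‖ < δ := by
    intro t
    have : Tendsto (fun n : ℕ => ‖l ^ n * t‖) atTop (𝓝 0) := by
      have := ((tendsto_pow_atTop_nhds_zero_of_norm_lt_one l1).mul_const t).norm
      simpa using this
    exact (this.eventually (gt_mem_nhds hδ)).exists
  choose n hn using hex
  set S : ℂ → ℂ × ℂ := fun t => g^[n t] (ψ (l ^ n t * t)) with hS
  have step : ∀ t k, ‖l ^ k * t‖ < δ → ∀ j, ‖l ^ (k + j) * t‖ < δ ∧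
      g^[k + j] (ψ (l ^ (k + j) * t)) = g^[k] (ψ (l ^ k * t)) := by
    intro t k hk j
    induction j with
    | zero => exact ⟨hk, rfl⟩
    | succ j ih =>
      have e : l ^ (k + (j + 1)) * t = l * (l ^ (k + j) * t) := by ring
      rw [e]
      refine ⟨lδ _ ih.1, ?_⟩
      rw [← hψf _ ih.1, ← add_assoc, iterate_succ_apply, h.left, ih.2]
  have hSk : ∀ t k, ‖l ^ k * t‖ < δ → S t = g^[k] (ψ (l ^ k * t)) := by
    intro t k hk
    have a := (step t k hk (n t)).2
    have b := (step t (n t) (hn t) k).2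
    rw [← a, add_comm k, b]
  have hS0 : ∀ t, ‖t‖ < δ → S t = ψ t := by
    intro t ht
    have := hSk t 0 (by simpa using ht)
    simpa using this
  have hψinj : ∀ t t', ‖t‖ < δ → ‖t'‖ < δ → ψ t = ψ t' → t = t' := by
    intro t t' ht ht' he
    have : x t = x t' := congrArg Prod.fst he
    rw [← (hx2 t ht).2.2, this, (hx2 t' ht').2.2]
  refine ⟨S, s, δ, r0, hδ, hr0, hr0r.trans_lt hrR, ?_, ?_, ?_, ?_, ?_, ?_, ?_, hs0⟩
  · intro t
    have h1 : S =ᶠ[𝓝 t] fun t => g^[n t] (ψ (l ^ n t * t)) := EventuallyEq.rfl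
    have h2 : ∀ᶠ t' in 𝓝 t, ‖l ^ (n t) * t'‖ < δ := by
      have : Continuous fun t' : ℂ => ‖l ^ (n t) * t'‖ := by fun_prop
      exact this.continuousAt.eventually (gt_mem_nhds (hn t))
    have h3 : S =ᶠ[𝓝 t] fun t' => g^[n t] (ψ (l ^ (n t) * t')) := by
      filter_upwards [h2] with t' ht' using hSk t' _ ht'
    refine DifferentiableAt.congr_of_eventuallyEq ?_ h3
    obtain ⟨a1, a2, a3⟩ := hx2 _ (hn t)
    have hw : DifferentiableAt ℂ ψ (l ^ (n t) * t) := by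
      refine a1.prodMk ?_
      refine DifferentiableAt.comp (g := ws f R) (f := x) _ ?_ a1
      exact L.ws_diff.differentiableAt (Metric.isOpen_ball.mem_nhds (by
        simpa using (a2.trans_le hr0r).trans hrR))
    have hm : DifferentiableAt ℂ (fun t' : ℂ => l ^ (n t) * t') t := by fun_prop
    refine DifferentiableAt.comp (g := g^[n t]) (f := fun t' => ψ (l ^ (n t) * t')) t
      ((h.g_diff.iterate (n t)) _) ?_
    exact DifferentiableAt.comp (g := ψ) (f := fun t' : ℂ => l ^ (n t) * t') t hw hm
  · intro t t' he
    have a := (step t (n t) (hn t) (n t')).1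
    have b := (step t' (n t') (hn t') (n t)).1
    rw [add_comm (n t')] at b
    rw [hSk t _ a, hSk t' _ b] at he
    have he' := congrArg (f^[n t + n t']) he
    rw [h.fg, h.fg] at he'
    have := hψinj _ _ a b he'
    exact mul_left_cancel₀ (pow_ne_zero _ L.l0) this
  · rw [hS0 0 (by simpa using hδ)]
    have : x 0 = 0 := by have := hx1 0 (by simpa using hr0); rwa [hs0] at this
    simp [hψ, this, L.ws_zero]
  · intro t
    have a := (step t (n t) (hn t) 1).1
    rw [hSk t _ a, hSk (l * t) (n t) (by rwa [pow_succ, mul_assoc] at a), pow_succ, mul_assoc,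
      iterate_succ_apply', h.right]
  · intro t ht
    rw [hS0 t ht]
    exact ⟨rfl, (hx2 t ht).2.1, (hx2 t ht).2.2⟩
  · intro ξ hξ hs
    rw [hS0 _ hs]
    simp [hψ, hx1 ξ hξ]
  · intro ξ hξ
    exact hsd ξ (hξ.trans_le hr0r)
end

open Function Set Filter Topology
noncomputable section

/-- transition between two injective curves -/
def ovs (S U : ℂ → ℂ × ℂ) (ζ : ℂ) : ℂ := invFun S (U ζ)

/-- the overlap set of two curves -/
def ovO (S U : ℂ → ℂ × ℂ) : Set ℂ :=
  {ζ | ζ ≠ 0 ∧ ∀ᶠ z in 𝓝 ζ, S (ovs S U z) = U z ∧ DifferentiableAt ℂ (ovs S U) z}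

lemma ovs_eq {S U : ℂ → ℂ × ℂ} (hS : Injective S) {t ζ : ℂ} (h : S t = U ζ) : ovs S U ζ = t := by
  rw [ovs, ← h]; exact leftInverse_invFun hS t

lemma ovO_mul {S U : ℂ → ℂ × ℂ} (hS : Injective S) {a b : ℂ} (ha : a ≠ 0)
    (hab : ∀ t ζ, S t = U ζ → S (b * t) = U (a * ζ)) {ζ : ℂ} (hζ : ζ ∈ ovO S U) :
    a * ζ ∈ ovO S U ∧ ovs S U (a * ζ) = b * ovs S U ζ := by
  refine ⟨⟨mul_ne_zero ha hζ.1, ?_⟩, ovs_eq hS (hab _ _ hζ.2.self_of_nhds.1)⟩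
  have hc : Tendsto (fun z => a⁻¹ * z) (𝓝 (a * ζ)) (𝓝 ζ) := by
    have : Continuous fun z : ℂ => a⁻¹ * z := by fun_prop
    have := this.tendsto (a * ζ)
    rwa [inv_mul_cancel_left₀ ha] at this
  have h1 := hc.eventually hζ.2
  have h2 : ∀ᶠ z in 𝓝 (a * ζ), S (b * ovs S U (a⁻¹ * z)) = U z := by
    filter_upwards [h1] with z hz
    have := hab _ _ hz.1
    rwa [mul_inv_cancel_left₀ ha] at this
  have h3 : ∀ᶠ z in 𝓝 (a * ζ), ovs S U =ᶠ[𝓝 z] fun z => b * ovs S U (a⁻¹ * z) := by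
    filter_upwards [h2.eventually_nhds] with z hz
    filter_upwards [hz] with w hw using ovs_eq hS hw
  filter_upwards [h1, h2, h3] with z h1 h2 h3
  refine ⟨by rw [ovs_eq hS h2, h2], ?_⟩
  refine DifferentiableAt.congr_of_eventuallyEq ?_ h3
  refine DifferentiableAt.const_mul ?_ b
  exact DifferentiableAt.comp (g := ovs S U) (f := fun z => a⁻¹ * z) z h1.2 (by fun_prop)

lemma hd_over {S U : ℂ → ℂ × ℂ} {l m : ℂ} (l0 : l ≠ 0) (l1 : ‖l‖ < 1) (m1 : 1 < ‖m‖)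
    (hS : Injective S) (hU : Injective U) (hSd : Differentiable ℂ S) (hUd : Differentiable ℂ U)
    (hS0 : S 0 = 0) (hU0 : U 0 = 0)
    (hlm : ∀ t ζ, S t = U ζ ↔ S (l * t) = U (m * ζ))
    (hcl : ∀ (z : ℕ → ℂ) (ζ t : ℂ), (∀ n, z n ∈ ovO S U) → Tendsto z atTop (𝓝 ζ) → ζ ≠ 0 →
      Tendsto (fun n => ovs S U (z n)) atTop (𝓝 t) → ζ ∈ ovO S U ∧ ovs S U ζ = t)
    (hne : (ovO S U).Nonempty) : False := by
  set σ := ovs S U with hσ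
  set Ω := ovO S U with hΩ
  have m0 : m ≠ 0 := by intro h; simp [h] at m1; linarith
  have hz : ∀ k : ℤ, ∀ t ζ, S t = U ζ → S (l ^ k * t) = U (m ^ k * ζ) := by
    intro k
    induction k using Int.induction_on with
    | zero => intro t ζ h; simpa using h
    | succ i ih =>
      intro t ζ h
      have := (hlm _ _).1 (ih t ζ h)
      rwa [← mul_assoc, ← mul_assoc, ← zpow_one_add₀ l0, ← zpow_one_add₀ m0, add_comm] at this
    | pred i ih =>
      intro t ζ h
      rw [hlm]
      have := ih t ζ h
      rw [← mul_assoc, ← mul_assoc, ← zpow_one_add₀ l0, ← zpow_one_add₀ m0]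
      simpa using this
  have hinv : ∀ (k : ℤ) ζ, ζ ∈ Ω → m ^ k * ζ ∈ Ω ∧ σ (m ^ k * ζ) = l ^ k * σ ζ :=
    fun k ζ hζ => ovO_mul hS (zpow_ne_zero k m0) (hz k) hζ
  have hlogm : 0 < Real.log ‖m‖ := Real.log_pos m1
  have hl' : 0 < ‖l‖ := norm_pos_iff.2 l0
  have hlogl : Real.log ‖l‖ < 0 := Real.log_neg hl' l1
  set β : ℝ := -Real.log ‖l‖ / Real.log ‖m‖ with hβ
  have hβ0 : 0 < β := div_pos (by linarith) hlogm
  set v : ℂ → ℝ := fun ζ => ‖σ ζ‖ * Real.exp (β * Real.log ‖ζ‖) with hv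
  have hvinv : ∀ (k : ℤ) ζ, ζ ∈ Ω → v (m ^ k * ζ) = v ζ := by
    intro k ζ hζ
    have hζ0 : ‖ζ‖ ≠ 0 := norm_ne_zero_iff.2 hζ.1
    have hm' : ‖m‖ ≠ 0 := norm_ne_zero_iff.2 m0
    simp only [hv]
    rw [(hinv k ζ hζ).2, norm_mul, norm_mul, norm_zpow, norm_zpow,
      Real.log_mul (zpow_ne_zero k hm') hζ0, Real.log_zpow, mul_add, Real.exp_add]
    have h1 : β * (k * Real.log ‖m‖) = - (k * Real.log ‖l‖) := by
      rw [hβ]; field_simp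
    have h2 : ‖l‖ ^ k = Real.exp (k * Real.log ‖l‖) := by
      rw [← Real.log_zpow, Real.exp_log (by positivity)]
    rw [h1, h2, Real.exp_neg]
    field_simp
  have hσ0 : ∀ ζ ∈ Ω, σ ζ ≠ 0 := by
    intro ζ hζ h0
    have h1 := hζ.2.self_of_nhds.1
    change S (σ ζ) = U ζ at h1
    rw [h0, hS0, ← hU0] at h1
    exact hζ.1 (hU h1).symm
  have hvpos : ∀ ζ ∈ Ω, 0 < v ζ := fun ζ hζ =>
    mul_pos (norm_pos_iff.2 (hσ0 ζ hζ)) (Real.exp_pos _)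
  have hvcont : ∀ (z : ℕ → ℂ) (ζ t : ℂ), ζ ≠ 0 → Tendsto z atTop (𝓝 ζ) →
      Tendsto (fun n => σ (z n)) atTop (𝓝 t) →
      Tendsto (fun n => v (z n)) atTop (𝓝 (‖t‖ * Real.exp (β * Real.log ‖ζ‖))) := by
    intro z ζ t hζ h1 h2
    refine h2.norm.mul ?_
    refine (Real.continuous_exp.tendsto _).comp ?_
    exact (h1.norm.log (norm_ne_zero_iff.2 hζ)).const_mul β
  -- compactness
  have hcpt : ∀ (z : ℕ → ℂ) (C : ℝ), (∀ n, z n ∈ Ω) → (∀ n, 1 ≤ ‖z n‖ ∧ ‖z n‖ ≤ C) →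
      (∀ n, v (z n) ≤ C) → ∀ I, Tendsto (fun n => v (z n)) atTop (𝓝 I) →
      ∃ ζ ∈ Ω, v ζ = I := by
    intro z C hzΩ hzb hvb I hI
    have hb : ∀ n, (z n, σ (z n)) ∈ Metric.closedBall (0 : ℂ × ℂ) C := by
      intro n
      rw [mem_closedBall_zero_iff, Prod.norm_def]
      refine max_le (hzb n).2 (le_trans ?_ (hvb n))
      have h1 : 1 ≤ Real.exp (β * Real.log ‖z n‖) :=
        Real.one_le_exp (mul_nonneg hβ0.le (Real.log_nonneg (hzb n).1))
      exact le_mul_of_one_le_right (norm_nonneg _) h1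
    obtain ⟨w, _, φ, hφ, hw⟩ := (isCompact_closedBall (0 : ℂ × ℂ) C).tendsto_subseq hb
    have hw1 : Tendsto (fun n => z (φ n)) atTop (𝓝 w.1) := (continuous_fst.tendsto _).comp hw
    have hw2 : Tendsto (fun n => σ (z (φ n))) atTop (𝓝 w.2) := (continuous_snd.tendsto _).comp hw
    have hw0 : w.1 ≠ 0 := by
      have : 1 ≤ ‖w.1‖ := ge_of_tendsto' hw1.norm fun n => (hzb (φ n)).1
      intro h; rw [h, norm_zero] at this; linarith
    obtain ⟨h1, h2⟩ := hcl _ _ _ (fun n => hzΩ (φ n)) hw1 hw0 hw2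
    refine ⟨w.1, h1, ?_⟩
    have h3 := hvcont _ _ _ hw0 hw1 hw2
    rw [← h2] at h3
    exact tendsto_nhds_unique h3 (hI.comp hφ.tendsto_atTop)
  have hmin : ∃ ζ ∈ Ω, ∀ ζ' ∈ Ω, v ζ ≤ v ζ' := by
    have hbb : BddBelow (v '' Ω) := ⟨0, by rintro _ ⟨ζ, hζ, rfl⟩; exact (hvpos ζ hζ).le⟩
    obtain ⟨u, hu1, hu2, hu3⟩ := exists_seq_tendsto_sInf (hne.image v) hbb
    choose z hzΩ hzu using hu3
    have hk : ∀ n, ∃ k : ℤ, 1 ≤ ‖m ^ k * z n‖ ∧ ‖m ^ k * z n‖ ≤ ‖m‖ := by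
      intro n
      have hz0 : 0 < ‖z n‖ := norm_pos_iff.2 (hzΩ n).1
      obtain ⟨k, hk1, hk2⟩ := exists_mem_Ico_zpow hz0 m1
      refine ⟨-k, ?_, ?_⟩
      · rw [norm_mul, norm_zpow, zpow_neg, ← div_eq_inv_mul, one_le_div (by positivity)]
        exact hk1
      · rw [norm_mul, norm_zpow, zpow_neg, ← div_eq_inv_mul, div_le_iff₀ (by positivity)]
        rw [zpow_add_one₀ (norm_ne_zero_iff.2 m0), mul_comm] at hk2
        exact hk2.le
    choose k hk1 hk2 using hk
    have hvz : ∀ n, v (m ^ k n * z n) = u n := fun n => by rw [hvinv _ _ (hzΩ n), hzu]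
    obtain ⟨C, hC⟩ := hu2.bddAbove_range
    obtain ⟨ζ, hζ, hζv⟩ := hcpt (fun n => m ^ k n * z n) (max C ‖m‖)
      (fun n => (hinv _ _ (hzΩ n)).1)
      (fun n => ⟨hk1 n, (hk2 n).trans (le_max_right _ _)⟩)
      (fun n => by simp only [hvz]; exact (hC ⟨n, rfl⟩).trans (le_max_left _ _)) _
      (by simpa only [hvz] using hu2)
    exact ⟨ζ, hζ, fun ζ' hζ' => hζv ▸ csInf_le hbb ⟨ζ', hζ', rfl⟩⟩
  obtain ⟨ζ0, hζ0, hI⟩ := hmin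
  set I := v ζ0 with hIdef
  have hIpos : 0 < I := hvpos _ hζ0
  set W : Set ℂ := {ζ | ζ ∈ Ω ∧ v ζ = I} with hW
  have hWo : IsOpen W := by
    rw [isOpen_iff_mem_nhds]
    rintro ζ1 ⟨h1, h2⟩
    have e1 : ∀ᶠ z in 𝓝 ζ1, z ∈ Ω := by
      filter_upwards [h1.2.eventually_nhds, isOpen_ne.mem_nhds h1.1] with z hz hz0
      exact ⟨hz0, hz⟩
    set k : ℂ → ℂ := fun z => Complex.exp (-β * Complex.log (z / ζ1)) / σ z with hk
    have e2 : ∀ᶠ z in 𝓝 ζ1, z / ζ1 ∈ Complex.slitPlane := by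
      have hc : Continuous fun z : ℂ => z / ζ1 := by fun_prop
      refine hc.continuousAt.eventually (Complex.isOpen_slitPlane.mem_nhds ?_)
      simp only [div_self h1.1]; exact Complex.one_mem_slitPlane
    have e3 : ∀ᶠ z in 𝓝 ζ1, DifferentiableAt ℂ k z := by
      filter_upwards [e1, e2] with z hz1 hz2
      refine DifferentiableAt.div ?_ hz1.2.self_of_nhds.2 (hσ0 z hz1)
      refine DifferentiableAt.cexp (DifferentiableAt.const_mul ?_ _)
      refine DifferentiableAt.clog ?_ hz2
      exact differentiableAt_id.div_const ζ1
    have e4 : ∀ z ∈ Ω, ‖k z‖ = Real.exp (β * Real.log ‖ζ1‖) / v z := by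
      intro z hz
      have a0 : (σ z : ℂ) ≠ 0 := hσ0 z hz
      simp only [hk, hv]
      rw [norm_div, Complex.norm_exp]
      have a1 : (-(β : ℂ) * Complex.log (z / ζ1)).re = β * Real.log ‖ζ1‖ - β * Real.log ‖z‖ := by
        rw [← Complex.ofReal_neg, Complex.re_ofReal_mul, Complex.log_re, norm_div,
          Real.log_div (norm_ne_zero_iff.2 hz.1) (norm_ne_zero_iff.2 h1.1)]
        ring
      rw [a1, Real.exp_sub]
      field_simp
    have e5 : IsLocalMax (norm ∘ k) ζ1 := by
      filter_upwards [e1] with z hz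
      simp only [comp]
      rw [e4 z hz, e4 ζ1 h1, h2]
      exact div_le_div_of_nonneg_left (Real.exp_pos _).le hIpos (hI z hz)
    filter_upwards [e1, Complex.norm_eventually_eq_of_isLocalMax e3 e5] with z hz1 hz2
    refine ⟨hz1, ?_⟩
    rw [e4 z hz1, e4 ζ1 h1, h2] at hz2
    have := hvpos z hz1
    have := Real.exp_pos (β * Real.log ‖ζ1‖)
    field_simp at hz2
    exact hz2.symm
  have hWc : closure W ∩ {0}ᶜ ⊆ W := by
    rintro ζ ⟨h1, h2⟩
    have h2 : ζ ≠ 0 := h2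
    obtain ⟨z, hz1, hz2⟩ := mem_closure_iff_seq_limit.1 h1
    have hb : Tendsto (fun n => ‖σ (z n)‖) atTop (𝓝 (I * Real.exp (-(β * Real.log ‖ζ‖)))) := by
      have h3 : Tendsto (fun n => I * Real.exp (-(β * Real.log ‖z n‖))) atTop
          (𝓝 (I * Real.exp (-(β * Real.log ‖ζ‖)))) := by
        refine Tendsto.const_mul _ ((Real.continuous_exp.tendsto _).comp ?_)
        exact ((hz2.norm.log (norm_ne_zero_iff.2 h2)).const_mul β).neg
      refine h3.congr fun n => ?_
      rw [← (hz1 n).2, hv, Real.exp_neg]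
      field_simp
    obtain ⟨C, hC⟩ := hb.bddAbove_range
    have hb2 : ∀ n, σ (z n) ∈ Metric.closedBall (0 : ℂ) C := fun n => by
      rw [mem_closedBall_zero_iff]; exact hC ⟨n, rfl⟩
    obtain ⟨t, _, φ, hφ, ht⟩ := (isCompact_closedBall (0 : ℂ) C).tendsto_subseq hb2
    have hz3 := hz2.comp hφ.tendsto_atTop
    obtain ⟨a1, a2⟩ := hcl _ ζ t (fun n => (hz1 (φ n)).1) hz3 h2 ht
    refine ⟨a1, ?_⟩
    have h3 := hvcont _ _ _ h2 hz3 ht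
    rw [← a2] at h3
    have h4 : Tendsto (fun n => v ((z ∘ φ) n)) atTop (𝓝 I) := by
      refine tendsto_const_nhds.congr fun n => ?_
      exact (hz1 (φ n)).2.symm
    exact tendsto_nhds_unique h3 h4
  have hall : ({0}ᶜ : Set ℂ) ⊆ W := by
    refine IsPreconnected.subset_of_closure_inter_subset ?_ hWo ⟨ζ0, hζ0.1, hζ0, rfl⟩ hWc
    exact (isConnected_compl_singleton_of_one_lt_rank (by simp) (0 : ℂ)).isPreconnected
  have hbd : Bornology.IsBounded (range U) := by
    have h1 : Bornology.IsBounded (S '' Metric.closedBall 0 I ∪ U '' Metric.closedBall 0 1) :=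
      (((isCompact_closedBall 0 I).image hSd.continuous).union
        ((isCompact_closedBall 0 1).image hUd.continuous)).isBounded
    refine h1.subset ?_
    rintro _ ⟨ζ, rfl⟩
    rcases le_total ‖ζ‖ 1 with hζ | hζ
    · exact Or.inr ⟨ζ, by simpa using hζ, rfl⟩
    · left
      have h0 : ζ ≠ 0 := by intro h; rw [h, norm_zero] at hζ; linarith
      obtain ⟨a, b⟩ := hall h0
      refine ⟨σ ζ, ?_, a.2.self_of_nhds.1⟩
      rw [mem_closedBall_zero_iff, ← b]
      have h1 : 1 ≤ Real.exp (β * Real.log ‖ζ‖) :=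
        Real.one_le_exp (mul_nonneg hβ0.le (Real.log_nonneg hζ))
      exact le_mul_of_one_le_right (norm_nonneg _) h1
  have := hU (hUd.apply_eq_apply_of_bounded hbd 0 1)
  exact zero_ne_one this
end

open Function Set Filter Topology
noncomputable section
variable {f g : ℂ × ℂ → ℂ × ℂ} {l m : ℂ} {θ ε R : ℝ}

lemma Sys.noover (h : Sys f g l m θ ε R) : ∃ r : ℝ, 0 < r ∧ r < R ∧ ∀ (k : ℕ) (η0 : ℂ), η0 ≠ 0 →
    ‖η0‖ < r → ‖(f^[k] (wu g R η0, η0)).1‖ < r →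
    (∀ᶠ η in 𝓝 η0, (f^[k] (wu g R η, η)).2 = ws f R (f^[k] (wu g R η, η)).1) → False := by
  obtain ⟨S, s, δ, r0, hδ, hr0, hr0R, hSd, hSi, hS0, hSf, hS1, hS2, hsd, hs0⟩ := h.lin
  obtain ⟨S', s', δ', r0', hδ', hr0', hr0R', hSd', hSi', hS0', hSf', hS1', hS2', hsd', hs0'⟩ :=
    h.swap.lin
  have L := h.lo
  have m0 := L.m0
  have l0 := L.l0
  set U : ℂ → ℂ × ℂ := fun ζ => (S' ζ).swap with hU
  have hUi : Injective U := fun a b hab => hSi' (Prod.swap_injective hab)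
  have hUd : Differentiable ℂ U := by
    intro ζ
    have := hSd' ζ
    exact this.snd.prodMk this.fst
  have hU0 : U 0 = 0 := by simp [hU, hS0']
  have hUf : ∀ ζ, f (U ζ) = U (m * ζ) := by
    intro ζ
    have h1 := hSf' (m * ζ)
    rw [inv_mul_cancel_left₀ m0] at h1
    have h2 : g (U (m * ζ)) = U ζ := by
      simp only [hU]; rw [← h1]; simp [sw]
    rw [← h2, h.right]
  have hfi : ∀ j, Injective (f^[j]) := fun j => LeftInverse.injective (g := g^[j]) (h.gf j)
  have hSj : ∀ j t, f^[j] (S t) = S (l ^ j * t) := by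
    intro j
    induction j with
    | zero => intro t; simp
    | succ j ih => intro t; rw [iterate_succ_apply', ih, hSf]; ring_nf
  have hX : ∀ j : ℕ, Differentiable ℂ fun ζ => f^[j] (U ζ) := fun j => by
    intro ζ
    exact DifferentiableAt.comp (g := f^[j]) (f := U) ζ ((L.dif.iterate j) _) (hUd ζ)
  have OV : ∀ (ζ t : ℂ) (j : ℕ), ζ ≠ 0 → S t = U ζ → ‖l ^ j * t‖ < δ →
      (∀ᶠ z in 𝓝 ζ, (f^[j] (U z)).2 = ws f R (f^[j] (U z)).1) →
      ζ ∈ ovO S U ∧ ovs S U ζ = t := by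
    intro ζ t j hζ hSU ht hev
    refine ⟨⟨hζ, ?_⟩, ovs_eq hSi hSU⟩
    have a0 : f^[j] (U ζ) = S (l ^ j * t) := by rw [← hSU, hSj]
    obtain ⟨a1, a2, a3⟩ := hS1 _ ht
    rw [← a0] at a1 a2 a3
    have lj : l ^ j ≠ 0 := pow_ne_zero _ l0
    have hX1 : ∀ z, DifferentiableAt ℂ (fun z => (f^[j] (U z)).1) z := fun z => ((hX j) z).fst
    have b1 : ∀ᶠ z in 𝓝 ζ, ‖(f^[j] (U z)).1‖ < r0 :=
      (hX1 ζ).continuousAt.norm.eventually (gt_mem_nhds a2)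
    have b2 : ∀ᶠ z in 𝓝 ζ, ‖s (f^[j] (U z)).1‖ < δ := by
      have c1 : ContinuousAt (fun z => s (f^[j] (U z)).1) ζ :=
        ContinuousAt.comp (g := s) (hsd _ a2).continuousAt (hX1 ζ).continuousAt
      refine c1.norm.eventually (gt_mem_nhds ?_)
      simp only [a3]; exact ht
    have b3 : ∀ᶠ z in 𝓝 ζ, S ((l ^ j)⁻¹ * s (f^[j] (U z)).1) = U z := by
      filter_upwards [b1, b2, hev] with z h1 h2 h3
      apply hfi j
      rw [hSj, mul_inv_cancel_left₀ lj, hS2 _ h1 h2, ← h3]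
    filter_upwards [b1, b3.eventually_nhds] with z h1 h3
    have h4 := h3.self_of_nhds
    refine ⟨by rw [ovs_eq hSi h4, h4], ?_⟩
    have h5 : ovs S U =ᶠ[𝓝 z] fun z => (l ^ j)⁻¹ * s (f^[j] (U z)).1 := by
      filter_upwards [h3] with w hw using ovs_eq hSi hw
    refine DifferentiableAt.congr_of_eventuallyEq ?_ h5
    refine DifferentiableAt.const_mul ?_ _
    exact DifferentiableAt.comp (g := s) (f := fun z => (f^[j] (U z)).1) z (hsd _ h1) (hX1 z)
  have hcl : ∀ (z : ℕ → ℂ) (ζ t : ℂ), (∀ n, z n ∈ ovO S U) → Tendsto z atTop (𝓝 ζ) → ζ ≠ 0 →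
      Tendsto (fun n => ovs S U (z n)) atTop (𝓝 t) → ζ ∈ ovO S U ∧ ovs S U ζ = t := by
    intro z ζ t hz hzζ hζ hzt
    have hSt : S t = U ζ := by
      have h1 := (hSd.continuous.tendsto t).comp hzt
      have h2 := (hUd.continuous.tendsto ζ).comp hzζ
      refine tendsto_nhds_unique h1 (h2.congr fun n => ?_)
      exact ((hz n).2.self_of_nhds.1).symm
    obtain ⟨j, hj⟩ : ∃ j : ℕ, ‖l ^ j * t‖ < δ := by
      have : Tendsto (fun n : ℕ => ‖l ^ n * t‖) atTop (𝓝 0) := by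
        have := ((tendsto_pow_atTop_nhds_zero_of_norm_lt_one L.l1).mul_const t).norm
        simpa using this
      exact (this.eventually (gt_mem_nhds hδ)).exists
    refine OV ζ t j hζ hSt hj ?_
    have a0 : f^[j] (U ζ) = S (l ^ j * t) := by rw [← hSt, hSj]
    have a2 := (hS1 _ hj).2.1
    rw [← a0] at a2
    have hX1 : ∀ z, DifferentiableAt ℂ (fun z => (f^[j] (U z)).1) z := fun z => ((hX j) z).fst
    have b1 : ∀ᶠ z in 𝓝 ζ, ‖(f^[j] (U z)).1‖ < r0 :=
      (hX1 ζ).continuousAt.norm.eventually (gt_mem_nhds a2)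
    obtain ⟨ρ, hρ, hb⟩ := Metric.eventually_nhds_iff_ball.1 b1
    set F : ℂ → ℂ := fun z => (f^[j] (U z)).2 - ws f R (f^[j] (U z)).1 with hF
    have hFd : DifferentiableOn ℂ F (Metric.ball ζ ρ) := by
      intro z hz
      refine DifferentiableAt.differentiableWithinAt ?_
      refine DifferentiableAt.sub ((hX j) z).snd ?_
      refine DifferentiableAt.comp (g := ws f R) (f := fun z => (f^[j] (U z)).1) z ?_ (hX1 z)
      exact L.ws_diff.differentiableAt (Metric.isOpen_ball.mem_nhds (by
        simpa using (hb z hz).trans hr0R))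
    have hFA := hFd.analyticOnNhd Metric.isOpen_ball
    have h1 : ∀ᶠ n in atTop, z n ∈ Metric.ball ζ ρ := hzζ.eventually (Metric.ball_mem_nhds ζ hρ)
    have h2 : ∀ᶠ n in atTop, ‖l ^ j * ovs S U (z n)‖ < δ :=
      ((hzt.const_mul (l ^ j)).norm).eventually (gt_mem_nhds hj)
    obtain ⟨n, hn1, hn2⟩ := (h1.and h2).exists
    have h3 : F =ᶠ[𝓝 (z n)] 0 := by
      have c1 := (hz n).2
      have c2 : ∀ᶠ w in 𝓝 (z n), ‖l ^ j * ovs S U w‖ < δ :=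
        ((c1.self_of_nhds.2.continuousAt.const_mul (l ^ j)).norm).eventually (gt_mem_nhds hn2)
      filter_upwards [c1, c2] with w hw1 hw2
      have := (hS1 _ hw2).1
      rw [← hSj, hw1.1] at this
      simp [hF, this]
    have h4 := hFA.eqOn_zero_of_preconnected_of_eventuallyEq_zero
      (convex_ball ζ ρ).isPreconnected hn1 h3
    filter_upwards [Metric.ball_mem_nhds ζ hρ] with w hw
    exact sub_eq_zero.1 (h4 hw)
  have hs1 : ∀ᶠ ξ in 𝓝 (0 : ℂ), ‖s ξ‖ < δ := by
    refine (hsd 0 (by simpa using hr0)).continuousAt.norm.eventually (gt_mem_nhds ?_)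
    simp only [hs0, norm_zero]; exact hδ
  have hs1' : ∀ᶠ ξ in 𝓝 (0 : ℂ), ‖s' ξ‖ < δ' := by
    refine (hsd' 0 (by simpa using hr0')).continuousAt.norm.eventually (gt_mem_nhds ?_)
    simp only [hs0', norm_zero]; exact hδ'
  obtain ⟨r1, hr1, hr1b⟩ := Metric.eventually_nhds_iff.1 (hs1.and hs1')
  refine ⟨min r1 (min r0 r0'), lt_min hr1 (lt_min hr0 hr0'),
    lt_of_le_of_lt ((min_le_right _ _).trans (min_le_left _ _)) hr0R, ?_⟩
  intro k η0 hη0 hη1 hξ1 hev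
  rw [lt_min_iff, lt_min_iff] at hη1 hξ1
  have c1 : ‖s' η0‖ < δ' := (hr1b (by simpa using hη1.1 : dist η0 0 < r1)).2
  have c2 : ‖s (f^[k] (wu g R η0, η0)).1‖ < δ :=
    (hr1b (by simpa using hξ1.1 : dist (f^[k] (wu g R η0, η0)).1 0 < r1)).1
  have c3 := hS2' η0 hη1.2.2 c1
  have c4 : U (s' η0) = (wu g R η0, η0) := by simp only [hU]; rw [c3]; rfl
  have lk : l ^ k ≠ 0 := pow_ne_zero _ l0
  set ξ0 := (f^[k] (wu g R η0, η0)).1 with hξ0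
  have c5 : f^[k] (U (s' η0)) = S (s ξ0) := by
    rw [hS2 ξ0 hξ1.2.1 c2, c4, ← hev.self_of_nhds]
  have c6 : S ((l ^ k)⁻¹ * s ξ0) = U (s' η0) := by
    apply hfi k
    rw [hSj, mul_inv_cancel_left₀ lk, c5]
  have c7 : s' η0 ≠ 0 := by
    intro h0
    rw [h0, hU0] at c4
    exact hη0 (congrArg Prod.snd c4).symm
  have c8 : ∀ᶠ z in 𝓝 (s' η0), (f^[k] (U z)).2 = ws f R (f^[k] (U z)).1 := by
    have d1 : Tendsto (fun z => (S' z).1) (𝓝 (s' η0)) (𝓝 η0) := by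
      have := (continuous_fst.comp hSd'.continuous).tendsto (s' η0)
      simp only [comp] at this
      rwa [c3] at this
    have d2 : ∀ᶠ z in 𝓝 (s' η0), ‖z‖ < δ' := continuous_norm.continuousAt.eventually (gt_mem_nhds c1)
    filter_upwards [d1.eventually hev, d2] with z hz1 hz2
    have : U z = (wu g R (S' z).1, (S' z).1) := by
      have := (hS1' z hz2).1
      apply Prod.ext
      · simp only [hU, Prod.fst_swap]; rw [this]; rfl
      · rfl
    rw [this]; exact hz1
  refine hd_over l0 L.l1 L.m1 hSi hUi hSd hUd hS0 hU0 ?_ hcl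
    ⟨s' η0, (OV (s' η0) _ k c7 c6 (by rwa [mul_inv_cancel_left₀ lk]) c8).1⟩
  intro t ζ
  rw [← hSf, ← hUf]
  exact ⟨fun h => by rw [h], fun hh => by rw [← h.left (S t), hh, h.left]⟩
end

open Function Set Filter Topology
noncomputable section
variable {f g : ℂ × ℂ → ℂ × ℂ} {l m : ℂ} {θ ε R : ℝ}

lemma he_solve {G : ℕ → ℂ × ℂ → ℂ × ℂ} {g : ℂ × ℂ → ℂ × ℂ} {z : ℂ × ℂ}
    (hcc : ∀ᶠ w in 𝓝 z, Tendsto (fun p : ℕ × (ℂ × ℂ) => G p.1 p.2) (atTop ×ˢ 𝓝 w) (𝓝 (g w)))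
    (hdiff : ∀ᶠ p : ℕ × (ℂ × ℂ) in atTop ×ˢ 𝓝 z, DifferentiableAt ℂ (G p.1) p.2)
    (hz : g z = 0) (A : (ℂ × ℂ) ≃L[ℂ] (ℂ × ℂ))
    (hA : HasFDerivAt g (A : (ℂ × ℂ) →L[ℂ] (ℂ × ℂ)) z) :
    ∃ x : ℕ → ℂ × ℂ, Tendsto x atTop (𝓝 z) ∧
      ∀ᶠ n in atTop, G n (x n) = 0 ∧ Injective (fderiv ℂ (G n) (x n)) := by
  obtain ⟨ρ1, hρ1, hu⟩ := ha_unif_of_cc hcc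
  obtain ⟨pa, hpa, pb, hpb, hp⟩ := eventually_prod_iff.1 hdiff
  obtain ⟨ρ2, hρ2, hb⟩ := Metric.eventually_nhds_iff_ball.1 hpb
  have hρ : 0 < min ρ1 ρ2 := lt_min hρ1 hρ2
  have hu' : TendstoUniformlyOn G g atTop (Metric.ball z (min ρ1 ρ2)) :=
    hu.mono (Metric.ball_subset_ball (min_le_left _ _))
  have hd : ∀ᶠ n in atTop, DifferentiableOn ℂ (G n) (Metric.ball z (min ρ1 ρ2)) := by
    filter_upwards [hpa] with n hn w hw
    exact (hp hn (hb w (Metric.ball_subset_ball (min_le_right _ _) hw))).differentiableWithinAt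
  obtain ⟨x, hx1, hx2⟩ := ha_hurwitz hρ hd hu' hz A hA
  have h1 := ha_weier_seq hρ hd hu'
  rw [hA.fderiv] at h1
  have h2 : Tendsto (fun n => fderiv ℂ (G n) (x n)) atTop (𝓝 (A : (ℂ × ℂ) →L[ℂ] (ℂ × ℂ))) :=
    h1.comp (tendsto_id.prodMk hx1)
  refine ⟨x, hx1, ?_⟩
  filter_upwards [hx2, h2.eventually A.nhds] with n hn1 hn2
  refine ⟨hn1, ?_⟩
  obtain ⟨e, he⟩ := hn2
  rw [← he]
  exact e.injective

lemma he_tu {α : Type} [TopologicalSpace α] {X : Type} {F : ℕ → α → ℂ} {k : α → ℂ} {s : Set α} {x : α}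
    (h : TendstoUniformlyOn F k atTop s) (hs : s ∈ 𝓝 x) (hk : ContinuousAt k x)
    {𝓕 : Filter X} {n : X → ℕ} {q : X → α} (hn : Tendsto n 𝓕 atTop) (hq : Tendsto q 𝓕 (𝓝 x)) :
    Tendsto (fun i => F (n i) (q i)) 𝓕 (𝓝 (k x)) := by
  have h1 : TendstoUniformlyOn (fun i => F (n i)) k 𝓕 s := fun u hu => hn.eventually (h u hu)
  exact h1.tendsto_comp hk.continuousWithinAt
    (tendsto_nhdsWithin_iff.2 ⟨hq, hq.eventually hs⟩)

lemma Loc.bP_lim (h : Loc f l m θ ε R) {X : Type} {𝓕 : Filter X} {n : X → ℕ} {q : X → ℂ × ℂ}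
    {q0 : ℂ × ℂ} (hn : Tendsto n 𝓕 atTop) (hq : Tendsto q 𝓕 (𝓝 q0)) (h0 : ‖q0‖ < R) :
    Tendsto (fun i => bP f R (n i) (q i)) 𝓕 (𝓝 (q0.1, ws f R q0.1)) := by
  have h1 : Tendsto (fun i => bP f R (n i) (q i) - ((q i).1, ws f R (q i).1)) 𝓕 (𝓝 0) := by
    rw [tendsto_zero_iff_norm_tendsto_zero]
    have h2 : ∀ᶠ i in 𝓕, ‖q i‖ < R := hq.norm.eventually (gt_mem_nhds h0)
    refine squeeze_zero' (Eventually.of_forall fun _ => norm_nonneg _) ?_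
      ((h.pow_lim (2 * R)).comp hn)
    filter_upwards [h2] with i hi using h.ws_unif hi.le (n i)
  have hq1 : Tendsto (fun i => (q i).1) 𝓕 (𝓝 q0.1) := (continuous_fst.tendsto _).comp hq
  have h3 : ContinuousAt (ws f R) q0.1 :=
    (h.ws_diff.differentiableAt (Metric.isOpen_ball.mem_nhds (by
      simpa using (norm_fst_le q0).trans_lt h0))).continuousAt
  have h4 := h1.add (hq1.prodMk_nhds (h3.tendsto.comp hq1))
  simpa using h4

lemma Sys.fbP_lim (h : Sys f g l m θ ε R) {X : Type} {𝓕 : Filter X} {n : X → ℕ} {q : X → ℂ × ℂ}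
    {q0 : ℂ × ℂ} (hn : Tendsto n 𝓕 atTop) (hq : Tendsto q 𝓕 (𝓝 q0)) (h0 : ‖q0‖ < R) :
    Tendsto (fun i => f^[n i] (bP f R (n i) (q i))) 𝓕 (𝓝 (wu g R q0.2, q0.2)) := by
  have h2 : ∀ᶠ i in 𝓕, ‖q i‖ < R := hq.norm.eventually (gt_mem_nhds h0)
  have h1 := h.lo'.bP_lim hn (q := fun i => (q i).swap) (q0 := q0.swap)
    ((continuous_swap.tendsto _).comp hq) (by rwa [norm_swap'])
  have h3 := (continuous_swap.tendsto _).comp h1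
  refine h3.congr' ?_
  filter_upwards [h2] with i hi
  simp only [comp]
  rw [h.bP_swap _ hi.le, Prod.swap_swap]

lemma he_quot {X : Type} {𝓕 : Filter X} {Y : ℂ × ℂ → ℂ} {Y' : ℂ × ℂ →L[ℂ] ℂ} {z0 : ℂ × ℂ}
    (hY : HasStrictFDerivAt Y Y' z0) {b : X → ℂ × ℂ} {e κ : X → ℂ} {κ0 : ℂ}
    (hb : Tendsto b 𝓕 (𝓝 z0)) (he : Tendsto e 𝓕 (𝓝 0)) (he0 : ∀ i, e i ≠ 0)
    (hκ : Tendsto κ 𝓕 (𝓝 κ0)) :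
    Tendsto (fun i => (e i)⁻¹ * (Y (b i + (e i * κ i, 0)) - Y (b i))) 𝓕 (𝓝 (Y' (κ0, 0))) := by
  have h1 : Tendsto (fun i => ((e i * κ i, 0) : ℂ × ℂ)) 𝓕 (𝓝 0) := by
    have := (he.mul hκ).prodMk_nhds (tendsto_const_nhds (x := (0 : ℂ)))
    rw [zero_mul] at this; exact this
  have h2 : Tendsto (fun i => (b i + (e i * κ i, 0), b i)) 𝓕 (𝓝 (z0, z0)) := by
    have := (hb.add h1).prodMk_nhds hb
    simpa using this
  have h3 := hY.isLittleO.comp_tendsto h2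
  have h4 : (fun i => (e i)⁻¹ * (Y (b i + (e i * κ i, 0)) - Y (b i) - Y' (e i * κ i, 0))) =o[𝓕]
      fun i => (e i)⁻¹ • ((e i * κ i, 0) : ℂ × ℂ) := by
    have h5 := (Asymptotics.isBigO_refl (fun i => (e i)⁻¹) 𝓕).smul_isLittleO h3
    simpa [comp_def] using h5
  have h6 : (fun i => (e i)⁻¹ • ((e i * κ i, 0) : ℂ × ℂ)) = fun i => ((κ i, 0) : ℂ × ℂ) := by
    funext i
    have := he0 i
    ext <;> simp [this]
  rw [h6] at h4
  have h7 : Tendsto (fun i => ((κ i, 0) : ℂ × ℂ)) 𝓕 (𝓝 (κ0, 0)) :=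
    hκ.prodMk_nhds tendsto_const_nhds
  have h8 := (h4.trans_isBigO (h7.isBigO_one ℂ))
  rw [Asymptotics.isLittleO_one_iff] at h8
  have h9 := h8.add ((Y'.continuous.tendsto _).comp h7)
  rw [zero_add] at h9
  refine h9.congr fun i => ?_
  have h10 : ((e i * κ i, 0) : ℂ × ℂ) = e i • ((κ i, 0) : ℂ × ℂ) := by simp
  simp only [comp]
  have := he0 i
  rw [h10, map_smul, smul_eq_mul]
  field_simp
  ring

/-- other straightened coordinate -/
def yh (f : ℂ × ℂ → ℂ × ℂ) (R : ℝ) (z : ℂ × ℂ) : ℂ := z.2 - ws f R z.1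

/-- local unstable curve -/
def gam (g : ℂ × ℂ → ℂ × ℂ) (R : ℝ) (y : ℂ) : ℂ × ℂ := (wu g R y, y)

lemma Sys.yh_diffAt (h : Sys f g l m θ ε R) {z : ℂ × ℂ} (hz : ‖z.1‖ < R) :
    DifferentiableAt ℂ (yh f R) z :=
  differentiableAt_snd.sub ((h.ws_diffAt hz).comp z differentiableAt_fst)

lemma Sys.gam_diffAt (h : Sys f g l m θ ε R) {y : ℂ} (hy : ‖y‖ < R) :
    DifferentiableAt ℂ (gam g R) y :=
  (h.wu_diffAt hy).prodMk differentiableAt_id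

/-- homoclinic data -/
structure Hom (f g : ℂ × ℂ → ℂ × ℂ) (R r : ℝ) (k : ℕ) (η : ℂ) : Prop where
  η0 : η ≠ 0
  ηr : ‖η‖ < r
  ξ0 : (f^[k] (gam g R η)).1 ≠ 0
  ξr : ‖(f^[k] (gam g R η)).1‖ < r
  hy : yh f R (f^[k] (gam g R η)) = 0

lemma Sys.Y_surj (h : Sys f g l m θ ε R) (k : ℕ) {z : ℂ × ℂ} (hz : ‖(f^[k] z).1‖ < R) :
    fderiv ℂ (fun z => yh f R (f^[k] z)) z ≠ 0 := by
  intro h0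
  have h1 : HasFDerivAt (fun z => yh f R (f^[k] z))
      ((fderiv ℂ (yh f R) (f^[k] z)).comp (fderiv ℂ (f^[k]) z)) z :=
    HasFDerivAt.comp (g := yh f R) (f := f^[k]) z (h.yh_diffAt hz).hasFDerivAt
      ((h.lo.dif.iterate k) z).hasFDerivAt
  rw [h1.fderiv] at h0
  have h2 : HasFDerivAt (fun z => f^[k] (g^[k] z))
      ((fderiv ℂ (f^[k]) z).comp (fderiv ℂ (g^[k]) (f^[k] z))) (f^[k] z) := by
    have a := ((h.lo.dif.iterate k) (g^[k] (f^[k] z))).hasFDerivAt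
    rw [h.gf] at a
    exact HasFDerivAt.comp (g := f^[k]) (f := g^[k]) (f^[k] z) (by rw [h.gf]; exact a)
      ((h.g_diff.iterate k) _).hasFDerivAt
  have h3 : (fun z => f^[k] (g^[k] z)) = id := by funext z; exact h.fg k z
  rw [h3] at h2
  have h4 := h2.unique (hasFDerivAt_id _)
  have h5 : fderiv ℂ (yh f R) (f^[k] z) = 0 := by
    have := congrArg (fun A => A.comp (fderiv ℂ (g^[k]) (f^[k] z))) h0
    simp only [ContinuousLinearMap.comp_assoc, h4] at this
    simpa using this
  have h6 : HasFDerivAt (yh f R) (ContinuousLinearMap.snd ℂ ℂ ℂ -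
      (fderiv ℂ (ws f R) (f^[k] z).1).comp (ContinuousLinearMap.fst ℂ ℂ ℂ)) (f^[k] z) :=
    hasFDerivAt_snd.fun_sub (HasFDerivAt.comp (g := ws f R) (f := Prod.fst) _
      (h.ws_diffAt hz).hasFDerivAt hasFDerivAt_fst)
  rw [h6.fderiv] at h5
  have := congrArg (fun A => A ((0, 1) : ℂ × ℂ)) h5
  simp at this
end

open Function Set Filter Topology
noncomputable section
variable {f g : ℂ × ℂ → ℂ × ℂ} {l m : ℂ} {θ ε R : ℝ}

lemma he_diag {u v : ℂ → ℂ} {a b x1 x2 : ℂ} (hu : HasDerivAt u a x1) (hv : HasDerivAt v b x2)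
    (ha : a ≠ 0) (hb : b ≠ 0) : ∃ A : (ℂ × ℂ) ≃L[ℂ] (ℂ × ℂ),
    HasFDerivAt (fun w : ℂ × ℂ => (u w.1, v w.2)) (A : (ℂ × ℂ) →L[ℂ] (ℂ × ℂ)) (x1, x2) := by
  refine ⟨(ContinuousLinearEquiv.unitsEquivAut ℂ (Units.mk0 a ha)).prodCongr
    (ContinuousLinearEquiv.unitsEquivAut ℂ (Units.mk0 b hb)), ?_⟩
  have h1 : HasFDerivAt (fun w : ℂ × ℂ => u w.1) (a • ContinuousLinearMap.fst ℂ ℂ ℂ) (x1, x2) :=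
    HasDerivAt.comp_hasFDerivAt (h₂ := u) (f := Prod.fst) (x1, x2) hu hasFDerivAt_fst
  have h2 : HasFDerivAt (fun w : ℂ × ℂ => v w.2) (b • ContinuousLinearMap.snd ℂ ℂ ℂ) (x1, x2) :=
    HasDerivAt.comp_hasFDerivAt (h₂ := v) (f := Prod.snd) (x1, x2) hv hasFDerivAt_snd
  refine (h1.prodMk h2).congr_fderiv ?_
  ext <;> simp

lemma Sys.transv (h : Sys f g l m θ ε R) {r : ℝ} (hrR : r < R) {K H : ℂ × ℂ → ℂ}
    (hKu : TendstoUniformlyOn (fun n q => (l ^ n)⁻¹ * ((f^[n] (bP f R n q)).1 - wu g R q.2)) K atTop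
      (Metric.ball 0 r))
    (hKd : ∀ q ∈ Metric.ball (0 : ℂ × ℂ) r, DifferentiableAt ℂ K q)
    (hK0 : ∀ q ∈ Metric.ball (0 : ℂ × ℂ) r, q.1 ≠ 0 → K q ≠ 0)
    (hHu : TendstoUniformlyOn (fun n q => m ^ n * ((bP f R n q).2 - ws f R q.1)) H atTop
      (Metric.ball 0 r))
    (hHd : ∀ q ∈ Metric.ball (0 : ℂ × ℂ) r, DifferentiableAt ℂ H q)
    (hH0 : ∀ q ∈ Metric.ball (0 : ℂ × ℂ) r, q.2 ≠ 0 → H q ≠ 0)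
    (hno : ∀ (k : ℕ) (η0 : ℂ), η0 ≠ 0 →
      ‖η0‖ < r → ‖(f^[k] (gam g R η0)).1‖ < r →
      (∀ᶠ η in 𝓝 η0, yh f R (f^[k] (gam g R η)) = 0) → False)
    {k : ℕ} {η0 : ℂ} (hH : Hom f g R r k η0) :
    ∃ k' η', Hom f g R r k' η' ∧ deriv (fun η => yh f R (f^[k'] (gam g R η))) η' ≠ 0 := by
  by_cases hder : deriv (fun η => yh f R (f^[k] (gam g R η))) η0 = 0
  swap
  · exact ⟨k, η0, hH, hder⟩
  have L := h.lo
  have l0 := L.l0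
  have m0 := L.m0
  set T : ℂ → ℂ × ℂ := fun η => f^[k] (gam g R η) with hT
  set Y : ℂ × ℂ → ℂ := fun z => yh f R (f^[k] z) with hY
  set φ : ℂ → ℂ := fun η => yh f R (T η) with hφ
  set ξ0 := (T η0).1 with hξ0
  have hηR : ‖η0‖ < R := hH.ηr.trans hrR
  have hξR : ‖ξ0‖ < R := hH.ξr.trans hrR
  have hTd : ∀ η, ‖η‖ < R → DifferentiableAt ℂ T η := fun η hη =>
    DifferentiableAt.comp (g := f^[k]) (f := gam g R) η ((L.dif.iterate k) _) (h.gam_diffAt hη)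
  have hYd : ∀ z, ‖(f^[k] z).1‖ < R → DifferentiableAt ℂ Y z := fun z hz =>
    DifferentiableAt.comp (g := yh f R) (f := f^[k]) z (h.yh_diffAt hz) ((L.dif.iterate k) z)
  have hfk1 : Continuous fun z => (f^[k] z).1 :=
    continuous_fst.comp (L.dif.iterate k).continuous
  have hYev : ∀ᶠ z in 𝓝 (gam g R η0), DifferentiableAt ℂ Y z := by
    have : ∀ᶠ z in 𝓝 (gam g R η0), ‖(f^[k] z).1‖ < R :=
      (hfk1.norm.continuousAt (x := gam g R η0)).eventually (gt_mem_nhds hξR)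
    filter_upwards [this] with z hz using hYd z hz
  have hYs := ha_strict hYev
  set Y' := fderiv ℂ Y (gam g R η0) with hY'
  have hd0 : Y' (1, 0) ≠ 0 := by
    intro h0
    have h1 : HasDerivAt (gam g R) (deriv (wu g R) η0, 1) η0 :=
      (h.wu_diffAt hηR).hasDerivAt.prodMk (hasDerivAt_id η0)
    have h2 : HasDerivAt φ (Y' (deriv (wu g R) η0, 1)) η0 :=
      HasFDerivAt.comp_hasDerivAt (f := gam g R) (l := Y) η0 hYs.hasFDerivAt h1
    have h3 : Y' (deriv (wu g R) η0, 1) = 0 := by rw [← h2.deriv]; exact hder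
    apply h.Y_surj k (z := gam g R η0) hξR
    change Y' = 0
    have h4 : ((0, 1) : ℂ × ℂ) = (deriv (wu g R) η0, 1) - deriv (wu g R) η0 • ((1, 0) : ℂ × ℂ) := by
      simp
    have h5 : Y' (0, 1) = 0 := by rw [h4, map_sub, map_smul, h0, h3]; simp
    ext
    · simpa using h0
    · simpa using h5
  have hφev : ∀ᶠ η in 𝓝 η0, DifferentiableAt ℂ φ η := by
    have h1 := (hTd η0 hηR).continuousAt.fst.norm.eventually (gt_mem_nhds hξR)
    have h2 := continuous_norm.continuousAt.eventually (gt_mem_nhds hηR)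
    filter_upwards [h1, h2] with η h1 h2
    exact DifferentiableAt.comp (g := yh f R) (f := T) η (h.yh_diffAt h1) (hTd η h2)
  have hφA : AnalyticAt ℂ φ η0 := Complex.analyticAt_iff_eventually_differentiableAt.2 hφev
  have hφn : ¬ ∀ᶠ η in 𝓝 η0, φ η = 0 := fun hc => hno k η0 hH.η0 hH.ηr hH.ξr hc
  obtain ⟨M, E, hEA, hE0, hE⟩ := hφA.exists_eventuallyEq_pow_smul_nonzero_iff.2 hφn
  have hM : M ≠ 0 := by
    rintro rfl
    have := hE.self_of_nhds
    rw [show φ η0 = 0 from hH.hy] at this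
    simp at this
    exact hE0 this.symm
  obtain ⟨κ, hκ⟩ := IsAlgClosed.exists_pow_nat_eq m⁻¹ (Nat.pos_of_ne_zero hM)
  obtain ⟨ν, hν⟩ := IsAlgClosed.exists_pow_nat_eq l (Nat.pos_of_ne_zero hM)
  have κ0 : κ ≠ 0 := by rintro rfl; rw [zero_pow hM] at hκ; exact inv_ne_zero m0 hκ.symm
  have ν0 : ν ≠ 0 := by rintro rfl; rw [zero_pow hM] at hν; exact l0 hν.symm
  have κ1 : ‖κ‖ < 1 := by
    have : ‖κ‖ ^ M < 1 := by
      rw [← norm_pow, hκ, norm_inv]; exact inv_lt_one_of_one_lt₀ L.m1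
    by_contra hc
    exact absurd this (not_lt.2 (one_le_pow₀ (not_lt.1 hc)))
  have ν1 : ‖ν‖ < 1 := by
    have : ‖ν‖ ^ M < 1 := by
      rw [← norm_pow, hν]; exact L.l1
    by_contra hc
    exact absurd this (not_lt.2 (one_le_pow₀ (not_lt.1 hc)))
  set q0 : ℂ × ℂ := (ξ0, η0) with hq0
  have hq0r : ‖q0‖ < r := by rw [Prod.norm_def]; exact max_lt hH.ξr hH.ηr
  have hq0b : q0 ∈ Metric.ball (0 : ℂ × ℂ) r := by simpa using hq0r
  have hbn : Metric.ball (0 : ℂ × ℂ) r ∈ 𝓝 q0 := Metric.isOpen_ball.mem_nhds hq0b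
  have hHq : H q0 ≠ 0 := hH0 q0 hq0b hH.η0
  have hKq : K q0 ≠ 0 := hK0 q0 hq0b hH.ξ0
  set a1 : ℕ → ℂ × ℂ → ℂ := fun n w => η0 + κ ^ n * w.1 with ha1
  set a2 : ℕ → ℂ × ℂ → ℂ := fun n w => η0 + ν ^ n * w.2 with ha2
  set Q : ℕ → ℂ × ℂ → ℂ × ℂ := fun n w => ((T (a1 n w)).1, a2 n w) with hQ
  set F : ℕ → ℂ × ℂ → ℂ × ℂ := fun n w =>
    (m ^ n * ((T (a1 n w)).2 - (bP f R n (Q n w)).2),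
      (l ^ n)⁻¹ * Y (f^[n] (bP f R n (Q n w)))) with hF
  -- limits
  have t1 : ∀ w : ℂ × ℂ, Tendsto (fun p : ℕ × (ℂ × ℂ) => a1 p.1 p.2) (atTop ×ˢ 𝓝 w) (𝓝 η0) := by
    intro w
    have e1 : Tendsto (fun p : ℕ × (ℂ × ℂ) => κ ^ p.1) (atTop ×ˢ 𝓝 w) (𝓝 0) :=
      (tendsto_pow_atTop_nhds_zero_of_norm_lt_one κ1).comp tendsto_fst
    have e2 : Tendsto (fun p : ℕ × (ℂ × ℂ) => p.2.1) (atTop ×ˢ 𝓝 w) (𝓝 w.1) :=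
      (continuous_fst.tendsto _).comp tendsto_snd
    simpa using (e1.mul e2).const_add η0
  have t2 : ∀ w : ℂ × ℂ, Tendsto (fun p : ℕ × (ℂ × ℂ) => a2 p.1 p.2) (atTop ×ˢ 𝓝 w) (𝓝 η0) := by
    intro w
    have e1 : Tendsto (fun p : ℕ × (ℂ × ℂ) => ν ^ p.1) (atTop ×ˢ 𝓝 w) (𝓝 0) :=
      (tendsto_pow_atTop_nhds_zero_of_norm_lt_one ν1).comp tendsto_fst
    have e2 : Tendsto (fun p : ℕ × (ℂ × ℂ) => p.2.2) (atTop ×ˢ 𝓝 w) (𝓝 w.2) :=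
      (continuous_snd.tendsto _).comp tendsto_snd
    simpa using (e1.mul e2).const_add η0
  have tT : ∀ w : ℂ × ℂ, Tendsto (fun p : ℕ × (ℂ × ℂ) => T (a1 p.1 p.2)) (atTop ×ˢ 𝓝 w)
      (𝓝 (T η0)) := fun w => (hTd η0 hηR).continuousAt.tendsto.comp (t1 w)
  have tQ : ∀ w : ℂ × ℂ, Tendsto (fun p : ℕ × (ℂ × ℂ) => Q p.1 p.2) (atTop ×ˢ 𝓝 w) (𝓝 q0) :=
    fun w => ((continuous_fst.tendsto _).comp (tT w)).prodMk_nhds (t2 w)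
  have tf : ∀ w : ℂ × ℂ, Tendsto (fun p : ℕ × (ℂ × ℂ) => f^[p.1] (bP f R p.1 (Q p.1 p.2)))
      (atTop ×ˢ 𝓝 w) (𝓝 (gam g R η0)) := fun w =>
    h.fbP_lim tendsto_fst (tQ w) (hq0r.trans hrR)
  have tK : ∀ w : ℂ × ℂ, Tendsto (fun p : ℕ × (ℂ × ℂ) =>
      (l ^ p.1)⁻¹ * ((f^[p.1] (bP f R p.1 (Q p.1 p.2))).1 - wu g R (Q p.1 p.2).2))
      (atTop ×ˢ 𝓝 w) (𝓝 (K q0)) := fun w =>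
    he_tu hKu hbn (hKd q0 hq0b).continuousAt tendsto_fst (tQ w)
  have tH : ∀ w : ℂ × ℂ, Tendsto (fun p : ℕ × (ℂ × ℂ) =>
      m ^ p.1 * ((bP f R p.1 (Q p.1 p.2)).2 - ws f R (Q p.1 p.2).1))
      (atTop ×ˢ 𝓝 w) (𝓝 (H q0)) := fun w =>
    he_tu hHu hbn (hHd q0 hq0b).continuousAt tendsto_fst (tQ w)
  have eQ : ∀ w : ℂ × ℂ, ∀ᶠ p : ℕ × (ℂ × ℂ) in atTop ×ˢ 𝓝 w, ‖Q p.1 p.2‖ < r :=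
    fun w => (tQ w).norm.eventually (gt_mem_nhds hq0r)
  have powe : ∀ n : ℕ, (κ ^ n) ^ M = (m ^ n)⁻¹ := by
    intro n; rw [← pow_mul, mul_comm, pow_mul, hκ, inv_pow]
  have powe' : ∀ n : ℕ, (ν ^ n) ^ M = l ^ n := by
    intro n; rw [← pow_mul, mul_comm, pow_mul, hν]
  have tF : ∀ w : ℂ × ℂ, Tendsto (fun p : ℕ × (ℂ × ℂ) => F p.1 p.2) (atTop ×ˢ 𝓝 w)
      (𝓝 (w.1 ^ M * E η0 - H q0, w.2 ^ M * E η0 + Y' (K q0, 0))) := by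
    intro w
    have w1 : Tendsto (fun p : ℕ × (ℂ × ℂ) => p.2.1) (atTop ×ˢ 𝓝 w) (𝓝 w.1) :=
      (continuous_fst.tendsto _).comp tendsto_snd
    have w2 : Tendsto (fun p : ℕ × (ℂ × ℂ) => p.2.2) (atTop ×ˢ 𝓝 w) (𝓝 w.2) :=
      (continuous_snd.tendsto _).comp tendsto_snd
    refine Tendsto.prodMk_nhds ?_ ?_
    · have e1 := ((w1.pow M).mul (hEA.continuousAt.tendsto.comp (t1 w))).sub (tH w)
      refine e1.congr' ?_
      filter_upwards [(t1 w).eventually hE] with p hp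
      have e2 : (T (a1 p.1 p.2)).2 = φ (a1 p.1 p.2) + ws f R (Q p.1 p.2).1 := by
        simp only [hφ, yh, hQ]; ring
      simp only [comp]
      rw [e2, hp, smul_eq_mul]
      have e3 : a1 p.1 p.2 - η0 = κ ^ p.1 * p.2.1 := by simp [ha1]
      rw [e3, mul_pow, powe]
      have := pow_ne_zero p.1 m0
      field_simp
      ring
    · have e0 : Tendsto (fun p : ℕ × (ℂ × ℂ) => gam g R (a2 p.1 p.2)) (atTop ×ˢ 𝓝 w)
          (𝓝 (gam g R η0)) := (h.gam_diffAt hηR).continuousAt.tendsto.comp (t2 w)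
      have e1 := he_quot hYs e0 (e := fun p : ℕ × (ℂ × ℂ) => l ^ p.1)
        ((tendsto_pow_atTop_nhds_zero_of_norm_lt_one L.l1).comp tendsto_fst)
        (fun p => pow_ne_zero _ l0) (tK w)
      have e2 := ((w2.pow M).mul (hEA.continuousAt.tendsto.comp (t2 w))).add e1
      refine e2.congr' ?_
      filter_upwards [(t2 w).eventually hE, eQ w] with p hp hpq
      have lp := pow_ne_zero p.1 l0
      have e3 : gam g R (a2 p.1 p.2) + (l ^ p.1 * ((l ^ p.1)⁻¹ *
          ((f^[p.1] (bP f R p.1 (Q p.1 p.2))).1 - wu g R (Q p.1 p.2).2)), 0) =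
          f^[p.1] (bP f R p.1 (Q p.1 p.2)) := by
        rw [mul_inv_cancel_left₀ lp]
        apply Prod.ext
        · simp [gam, hQ]
        · simp only [gam, Prod.snd_add, add_zero]
          exact (L.bP_spec p.1 (hpq.trans hrR).le).2.2.symm
      have e4 : Y (gam g R (a2 p.1 p.2)) = φ (a2 p.1 p.2) := rfl
      rw [e3, e4, hp, smul_eq_mul]
      have e3 : a2 p.1 p.2 - η0 = ν ^ p.1 * p.2.2 := by simp [ha2]
      rw [e3, mul_pow, powe']
      simp only [comp]
      field_simp
      ring
  have dF : ∀ w : ℂ × ℂ, ∀ᶠ p : ℕ × (ℂ × ℂ) in atTop ×ˢ 𝓝 w, DifferentiableAt ℂ (F p.1) p.2 := by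
    intro w
    have e1 := (t1 w).norm.eventually (gt_mem_nhds hηR)
    have e2 := ((hfk1.tendsto _).comp (tf w)).norm.eventually (gt_mem_nhds hξR)
    filter_upwards [e1, e2, eQ w] with p h1 h2 h3
    have d1 : DifferentiableAt ℂ (a1 p.1) p.2 := by simp only [ha1]; fun_prop
    have d2 : DifferentiableAt ℂ (a2 p.1) p.2 := by simp only [ha2]; fun_prop
    have d3 : DifferentiableAt ℂ (fun w => T (a1 p.1 w)) p.2 :=
      DifferentiableAt.comp (g := T) (f := a1 p.1) p.2 (hTd _ h1) d1
    have d4 : DifferentiableAt ℂ (Q p.1) p.2 := d3.fst.prodMk d2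
    have d5 : DifferentiableAt ℂ (fun w => bP f R p.1 (Q p.1 w)) p.2 :=
      DifferentiableAt.comp (g := bP f R p.1) (f := Q p.1) p.2 (L.bP_diff p.1 (h3.trans hrR)) d4
    have d6 : DifferentiableAt ℂ (fun w => f^[p.1] (bP f R p.1 (Q p.1 w))) p.2 :=
      DifferentiableAt.comp (g := f^[p.1]) (f := fun w => bP f R p.1 (Q p.1 w)) p.2
        ((L.dif.iterate _) _) d5
    have d7 : DifferentiableAt ℂ (fun w => Y (f^[p.1] (bP f R p.1 (Q p.1 w)))) p.2 :=
      DifferentiableAt.comp (g := Y) (f := fun w => f^[p.1] (bP f R p.1 (Q p.1 w))) p.2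
        (hYd _ h2) d6
    exact ((d3.snd.sub d5.snd).const_mul _).prodMk (d7.const_mul _)
  have hKd0 : Y' (K q0, 0) ≠ 0 := by
    have : ((K q0, 0) : ℂ × ℂ) = K q0 • ((1, 0) : ℂ × ℂ) := by simp
    rw [this, map_smul, smul_eq_mul]
    exact mul_ne_zero hKq hd0
  obtain ⟨σ, hσ⟩ := IsAlgClosed.exists_pow_nat_eq (H q0 / E η0) (Nat.pos_of_ne_zero hM)
  obtain ⟨σ', hσ'⟩ := IsAlgClosed.exists_pow_nat_eq (-Y' (K q0, 0) / E η0) (Nat.pos_of_ne_zero hM)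
  have σ0 : σ ≠ 0 := by
    rintro rfl; rw [zero_pow hM] at hσ; exact div_ne_zero hHq hE0 hσ.symm
  have σ0' : σ' ≠ 0 := by
    rintro rfl; rw [zero_pow hM] at hσ'; exact div_ne_zero (neg_ne_zero.2 hKd0) hE0 hσ'.symm
  have hM' : (M : ℂ) ≠ 0 := Nat.cast_ne_zero.2 hM
  obtain ⟨A, hA⟩ := he_diag (u := fun s => s ^ M * E η0 - H q0)
    (v := fun s => s ^ M * E η0 + Y' (K q0, 0))
    (((hasDerivAt_pow M σ).mul_const (E η0)).sub_const (H q0))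
    (((hasDerivAt_pow M σ').mul_const (E η0)).add_const (Y' (K q0, 0)))
    (mul_ne_zero (mul_ne_zero hM' (pow_ne_zero _ σ0)) hE0)
    (mul_ne_zero (mul_ne_zero hM' (pow_ne_zero _ σ0')) hE0)
  obtain ⟨x, hx, hxF⟩ := he_solve (Eventually.of_forall tF) (dF (σ, σ')) (by
      simp only [hσ, hσ']; field_simp; simp) A hA
  have hx' : Tendsto (fun n => (n, x n)) atTop (atTop ×ˢ 𝓝 (σ, σ')) := tendsto_id.prodMk hx
  have hfk : Continuous fun z => f^[k] z := (L.dif.iterate k).continuous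
  have v1 := hx'.eventually (dF (σ, σ'))
  have v2 := hx'.eventually (eQ (σ, σ'))
  have v3 := hx'.eventually ((t1 (σ, σ')).eventually (isOpen_ne.mem_nhds hH.η0))
  have v4 := hx'.eventually ((t1 (σ, σ')).norm.eventually (gt_mem_nhds hH.ηr))
  have tfk := (hfk1.tendsto _).comp (tf (σ, σ'))
  have v5 := hx'.eventually (tfk.eventually (isOpen_ne.mem_nhds hH.ξ0))
  have v6 := hx'.eventually (tfk.norm.eventually (gt_mem_nhds hH.ξr))
  obtain ⟨n, ⟨hz, hinj⟩, v1, v2, v3, v4, v5, v6⟩ :=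
    (hxF.and (v1.and (v2.and (v3.and (v4.and (v5.and v6)))))).exists
  simp only [comp] at v1 v2 v3 v4 v5 v6
  have mn := pow_ne_zero n m0
  have ln := pow_ne_zero n l0
  have κn := pow_ne_zero n κ0
  have νn := pow_ne_zero n ν0
  set η1 := a1 n (x n) with hη1
  obtain ⟨s1, s2, s3⟩ := L.bP_spec n (v2.trans hrR).le
  have hz1 : (T η1).2 = (bP f R n (Q n (x n))).2 := by
    have := congrArg Prod.fst hz
    simp only [hF, Prod.fst_zero, mul_eq_zero, mn, false_or] at this
    exact sub_eq_zero.1 this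
  have hz2 : Y (f^[n] (bP f R n (Q n (x n)))) = 0 := by
    have := congrArg Prod.snd hz
    simpa only [hF, Prod.snd_zero, mul_eq_zero, inv_eq_zero, ln, false_or] using this
  have hbT : bP f R n (Q n (x n)) = T η1 := Prod.ext s1 hz1.symm
  have hbn : ∀ i ≤ n, ‖f^[i] (T η1)‖ < R := by
    intro i hi
    rw [← hbT]
    exact ((L.bP_norm (v2.trans hrR).le hi).trans_lt v2).trans hrR
  rw [hbT] at hz2 v5 v6 s3
  have hit : ∀ η, f^[k + n + k] (gam g R η) = f^[k] (f^[n] (T η)) := by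
    intro η; rw [iterate_add_apply, iterate_add_apply]
  refine ⟨k + n + k, η1, ⟨v3, v4, by rw [hit]; exact v5, by rw [hit]; exact v6,
    by rw [hit]; exact hz2⟩, ?_⟩
  intro hd
  simp only [hit] at hd
  have hTn : DifferentiableAt ℂ (fun η => f^[n] (T η)) η1 :=
    DifferentiableAt.comp (g := f^[n]) (f := T) η1 ((L.dif.iterate n) _) (hTd _ (v4.trans hrR))
  have hNd : DifferentiableAt ℂ (fun η => Y (f^[n] (T η))) η1 :=
    DifferentiableAt.comp (g := Y) (f := fun η => f^[n] (T η)) η1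
      (hYd _ (v6.trans hrR)) hTn
  set c : ℂ → ℂ × ℂ := fun η => ((κ ^ n)⁻¹ * (η - η0), (ν ^ n)⁻¹ * ((f^[n] (T η)).2 - η0)) with hc
  have hc1 : c η1 = x n := by
    simp only [hc]
    rw [s3]
    apply Prod.ext
    · simp only [hη1, ha1]; field_simp; ring
    · simp only [hQ, ha2]; field_simp; ring
  have hcd : HasDerivAt c ((κ ^ n)⁻¹ * 1, (ν ^ n)⁻¹ * deriv (fun η => (f^[n] (T η)).2) η1) η1 :=
    (((hasDerivAt_id η1).sub_const η0).const_mul _).prodMk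
      ((hTn.snd.hasDerivAt.sub_const η0).const_mul _)
  have hFc : HasDerivAt (fun η => F n (c η)) (fderiv ℂ (F n) (x n)
      ((κ ^ n)⁻¹ * 1, (ν ^ n)⁻¹ * deriv (fun η => (f^[n] (T η)).2) η1)) η1 := by
    refine HasFDerivAt.comp_hasDerivAt (f := c) (l := F n) η1 ?_ hcd
    rw [hc1]; exact v1.hasFDerivAt
  have hOrb : ∀ᶠ η in 𝓝 η1, Orb f R n (T η) := by
    have : ∀ i ∈ Finset.range (n + 1), ∀ᶠ η in 𝓝 η1, ‖f^[i] (T η)‖ ≤ R := by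
      intro i hi
      have hc : ContinuousAt (fun η => f^[i] (T η)) η1 :=
        ContinuousAt.comp (g := f^[i]) (L.dif.iterate i).continuous.continuousAt
          (hTd _ (v4.trans hrR)).continuousAt
      refine (hc.norm.eventually (gt_mem_nhds (hbn i (by simpa [Nat.lt_succ_iff] using hi)))).mono
        fun _ h => le_of_lt h
    have := (Filter.eventually_all_finset (Finset.range (n + 1))).2 this
    filter_upwards [this] with η hη i hi
    exact hη i (by simpa [Nat.lt_succ_iff] using hi)
  have hFe : (fun η => F n (c η)) =ᶠ[𝓝 η1] fun η => (0, (l ^ n)⁻¹ * Y (f^[n] (T η))) := by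
    filter_upwards [hOrb] with η hη
    have e1 : a1 n (c η) = η := by
      simp only [ha1, hc]; rw [mul_inv_cancel_left₀ κn]; ring
    have e2 : a2 n (c η) = (f^[n] (T η)).2 := by
      simp only [ha2, hc]; rw [mul_inv_cancel_left₀ νn]; ring
    have e3 := L.bP_uniq hη
    simp only [hF, hQ]
    rw [e1, e2, e3]
    simp
  have hFc2 : HasDerivAt (fun η => F n (c η)) (0, (l ^ n)⁻¹ * 0) η1 := by
    refine HasDerivAt.congr_of_eventuallyEq ?_ hFe
    refine (hasDerivAt_const η1 0).prodMk ?_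
    have := hNd.hasDerivAt
    rw [show deriv (fun η => Y (f^[n] (T η))) η1 = 0 from hd] at this
    exact this.const_mul _
  have hfin := hFc.unique hFc2
  rw [mul_zero] at hfin
  have := hinj (hfin.trans (map_zero (fderiv ℂ (F n) (x n))).symm)
  have := congrArg Prod.fst this
  simp at this
  exact κ0 this.1
end

open Function Set Filter Topology
noncomputable section
variable {f g : ℂ × ℂ → ℂ × ℂ} {l m : ℂ} {θ ε R : ℝ}

/-- trace -/
def tr2 (A : (ℂ × ℂ) →L[ℂ] ℂ × ℂ) : ℂ := (A (1, 0)).1 + (A (0, 1)).2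
/-- determinant -/
def dt2 (A : (ℂ × ℂ) →L[ℂ] ℂ × ℂ) : ℂ := (A (1, 0)).1 * (A (0, 1)).2 - (A (0, 1)).1 * (A (1, 0)).2

lemma hf_ap (A : (ℂ × ℂ) →L[ℂ] ℂ × ℂ) (x y : ℂ) : A (x, y) = x • A (1, 0) + y • A (0, 1) := by
  rw [← map_smul, ← map_smul, ← map_add]; simp

lemma dt2_comp (A B : (ℂ × ℂ) →L[ℂ] ℂ × ℂ) : dt2 (A.comp B) = dt2 A * dt2 B := by
  simp only [dt2, ContinuousLinearMap.comp_apply]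
  rw [hf_ap A (B (1, 0)).1 (B (1, 0)).2, hf_ap A (B (0, 1)).1 (B (0, 1)).2]
  simp only [Prod.fst_add, Prod.snd_add, Prod.smul_fst, Prod.smul_snd, smul_eq_mul]
  ring

lemma dt2_cont : Continuous dt2 := by unfold dt2; fun_prop

lemma hf_eig (A : (ℂ × ℂ) →L[ℂ] ℂ × ℂ) (w : ℂ) (hw : w ^ 2 - tr2 A * w + dt2 A = 0) :
    ∃ v : ℂ × ℂ, v ≠ 0 ∧ A v = w • v := by
  obtain ⟨a, c, h1⟩ : ∃ a c, A (1, 0) = (a, c) := ⟨_, _, rfl⟩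
  obtain ⟨b, d, h2⟩ : ∃ b d, A (0, 1) = (b, d) := ⟨_, _, rfl⟩
  simp only [tr2, dt2, h1, h2] at hw
  by_cases hv : ((b, w - a) : ℂ × ℂ) = 0
  · by_cases hv2 : ((w - d, c) : ℂ × ℂ) = 0
    · refine ⟨(1, 0), by simp, ?_⟩
      simp only [Prod.mk_eq_zero] at hv hv2
      rw [h1]
      ext
      · simp; linear_combination -hv.2
      · simp; exact hv2.2
    · refine ⟨_, hv2, ?_⟩
      rw [hf_ap, h1, h2]
      ext
      · simp; linear_combination -hw
      · simp; ring
  · refine ⟨_, hv, ?_⟩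
    rw [hf_ap, h1, h2]
    ext
    · simp; ring
    · simp; linear_combination -hw

lemma hf_roots (t d : ℂ) : ∃ u s : ℂ, u + s = t ∧ u * s = d ∧ ‖s‖ ≤ ‖u‖ := by
  obtain ⟨D, hD⟩ := IsAlgClosed.exists_pow_nat_eq (t ^ 2 - 4 * d) (n := 2) (by norm_num)
  rcases le_total ‖(t - D) / 2‖ ‖(t + D) / 2‖ with h | h
  · exact ⟨_, _, by ring, by linear_combination -(1 / 4) * hD, h⟩
  · exact ⟨_, _, by ring, by linear_combination -(1 / 4) * hD, h⟩

lemma hf_eigs {l m : ℂ} (l0 : l ≠ 0) (l1 : ‖l‖ < 1) (m1 : 1 < ‖m‖) {t d : ℕ → ℂ} {t0 d0 : ℂ}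
    (t00 : t0 ≠ 0) (ht : Tendsto (fun n => t n / m ^ n) atTop (𝓝 t0))
    (hd : Tendsto (fun n => d n / (l ^ n * m ^ n)) atTop (𝓝 d0)) :
    ∃ u s : ℕ → ℂ, (∀ n, u n + s n = t n ∧ u n * s n = d n) ∧
      Tendsto (fun n => u n / m ^ n) atTop (𝓝 t0) ∧
      Tendsto (fun n => s n / l ^ n) atTop (𝓝 (d0 / t0)) := by
  have m0 : m ≠ 0 := by rintro rfl; simp at m1; linarith
  choose u s h1 h2 h3 using fun n => hf_roots (t n) (d n)
  have hlm : ‖l / m‖ < 1 := by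
    rw [norm_div, div_lt_one (by linarith)]; linarith
  have hp : Tendsto (fun n => (u n / m ^ n) * (s n / m ^ n)) atTop (𝓝 0) := by
    have := hd.mul (tendsto_pow_atTop_nhds_zero_of_norm_lt_one hlm)
    rw [mul_zero] at this
    refine this.congr fun n => ?_
    have a := pow_ne_zero n m0
    have b := pow_ne_zero n l0
    rw [← h2 n, div_pow]
    field_simp
  have hS : Tendsto (fun n => s n / m ^ n) atTop (𝓝 0) := by
    have h4 : Tendsto (fun n => ‖s n / m ^ n‖ ^ 2) atTop (𝓝 0) := by
      refine squeeze_zero (fun n => by positivity) (fun n => ?_)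
        (tendsto_zero_iff_norm_tendsto_zero.1 hp)
      rw [norm_mul, sq]
      refine mul_le_mul_of_nonneg_right ?_ (norm_nonneg _)
      rw [norm_div, norm_div]
      gcongr
      exact h3 n
    rw [tendsto_zero_iff_norm_tendsto_zero]
    have := h4.sqrt
    rw [Real.sqrt_zero] at this
    exact this.congr fun n => Real.sqrt_sq (norm_nonneg _)
  have hU : Tendsto (fun n => u n / m ^ n) atTop (𝓝 t0) := by
    have := ht.sub hS
    rw [sub_zero] at this
    refine this.congr fun n => ?_
    rw [← h1 n]; ring
  refine ⟨u, s, fun n => ⟨h1 n, h2 n⟩, hU, ?_⟩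
  refine (hd.div hU t00).congr' ?_
  filter_upwards [hU.eventually (isOpen_ne.mem_nhds t00)] with n hn
  have a := pow_ne_zero n m0
  have b := pow_ne_zero n l0
  have c : u n ≠ 0 := by rintro h; simp [h] at hn
  simp only [Pi.div_apply]
  rw [← h2 n]
  field_simp

lemma hf_hyp {l m : ℂ} (l1 : ‖l‖ < 1) (m1 : 1 < ‖m‖) {u s : ℕ → ℂ} {c d : ℂ} (c0 : c ≠ 0)
    (hu : Tendsto (fun n => u n / m ^ n) atTop (𝓝 c))
    (hs : Tendsto (fun n => s n / l ^ n) atTop (𝓝 d)) (l0 : l ≠ 0) :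
    ∀ᶠ n in atTop, ‖s n‖ < 1 ∧ 1 < ‖u n‖ := by
  have m0 : m ≠ 0 := by rintro rfl; simp at m1; linarith
  have h1 : Tendsto s atTop (𝓝 0) := by
    have := hs.mul (tendsto_pow_atTop_nhds_zero_of_norm_lt_one l1)
    rw [mul_zero] at this
    refine this.congr fun n => ?_
    have b := pow_ne_zero n l0
    field_simp
  have h2 : Tendsto (fun n => ‖u n‖) atTop atTop := by
    have := (hu.norm).pos_mul_atTop (norm_pos_iff.2 c0) (tendsto_pow_atTop_atTop_of_one_lt m1)
    refine this.congr fun n => ?_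
    have b := pow_ne_zero n m0
    rw [← norm_pow, ← norm_mul]
    field_simp
  have h3 := h1.norm.eventually (gt_mem_nhds (show ‖(0 : ℂ)‖ < 1 by simp))
  exact h3.and (h2.eventually_gt_atTop 1)

lemma hf_inj {A : (ℂ × ℂ) →L[ℂ] ℂ × ℂ} (hA : ∀ v, A v = 0 → v = 0) :
    ∃ B : (ℂ × ℂ) ≃L[ℂ] (ℂ × ℂ), (B : (ℂ × ℂ) →L[ℂ] ℂ × ℂ) = A := by
  have hi : Injective (A : (ℂ × ℂ) →ₗ[ℂ] ℂ × ℂ) :=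
    (injective_iff_map_eq_zero _).2 hA
  refine ⟨(LinearEquiv.ofInjectiveEndo (A : (ℂ × ℂ) →ₗ[ℂ] ℂ × ℂ) hi).toContinuousLinearEquiv, ?_⟩
  ext <;> simp

lemma Sys.fk_inv (h : Sys f g l m θ ε R) (k : ℕ) (z : ℂ × ℂ) :
    (fderiv ℂ (g^[k]) (f^[k] z)).comp (fderiv ℂ (f^[k]) z) = ContinuousLinearMap.id ℂ (ℂ × ℂ) := by
  have h2 : HasFDerivAt (fun z => g^[k] (f^[k] z))
      ((fderiv ℂ (g^[k]) (f^[k] z)).comp (fderiv ℂ (f^[k]) z)) z :=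
    HasFDerivAt.comp (g := g^[k]) (f := f^[k]) z ((h.g_diff.iterate k) _).hasFDerivAt
      ((h.lo.dif.iterate k) _).hasFDerivAt
  have h3 : (fun z => g^[k] (f^[k] z)) = id := by funext z; exact h.gf k z
  rw [h3] at h2
  exact h2.unique (hasFDerivAt_id _)

lemma Sys.fk_dt (h : Sys f g l m θ ε R) (k : ℕ) (z : ℂ × ℂ) : dt2 (fderiv ℂ (f^[k]) z) ≠ 0 := by
  intro h0
  have := congrArg dt2 (h.fk_inv k z)
  rw [dt2_comp, h0] at this
  simp [dt2] at this
end

open Function Set Filter Topology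
noncomputable section
variable {f g : ℂ × ℂ → ℂ × ℂ} {l m : ℂ} {θ ε R : ℝ}

lemma hf_dlim {F : Type} [NormedAddCommGroup F] [NormedSpace ℂ F] [CompleteSpace F]
    {G : ℕ → ℂ × ℂ → F} {g : ℂ × ℂ → F} {z : ℂ × ℂ}
    (hcc : ∀ᶠ w in 𝓝 z, Tendsto (fun p : ℕ × (ℂ × ℂ) => G p.1 p.2) (atTop ×ˢ 𝓝 w) (𝓝 (g w)))
    (hdiff : ∀ᶠ p : ℕ × (ℂ × ℂ) in atTop ×ˢ 𝓝 z, DifferentiableAt ℂ (G p.1) p.2) :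
    Tendsto (fun p : ℕ × (ℂ × ℂ) => fderiv ℂ (G p.1) p.2) (atTop ×ˢ 𝓝 z) (𝓝 (fderiv ℂ g z)) := by
  obtain ⟨ρ1, hρ1, hu⟩ := ha_unif_of_cc hcc
  obtain ⟨pa, hpa, pb, hpb, hp⟩ := eventually_prod_iff.1 hdiff
  obtain ⟨ρ2, hρ2, hb⟩ := Metric.eventually_nhds_iff_ball.1 hpb
  have hρ : 0 < min ρ1 ρ2 := lt_min hρ1 hρ2
  have hu' : TendstoUniformlyOn G g atTop (Metric.ball z (min ρ1 ρ2)) :=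
    hu.mono (Metric.ball_subset_ball (min_le_left _ _))
  have hd : ∀ᶠ n in atTop, DifferentiableOn ℂ (G n) (Metric.ball z (min ρ1 ρ2)) := by
    filter_upwards [hpa] with n hn w hw
    exact (hp hn (hb w (Metric.ball_subset_ball (min_le_right _ _) hw))).differentiableWithinAt
  exact ha_weier_seq hρ hd hu'

lemma hf_clm {B : ℕ → (ℂ × ℂ) →L[ℂ] ℂ × ℂ} {B0 : (ℂ × ℂ) →L[ℂ] ℂ × ℂ} {v : ℕ → ℂ × ℂ}
    {v0 : ℂ × ℂ} (hB : Tendsto B atTop (𝓝 B0)) (hv : Tendsto v atTop (𝓝 v0)) :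
    Tendsto (fun n => B n (v n)) atTop (𝓝 (B0 v0)) :=
  ((isBoundedBilinearMap_apply (𝕜 := ℂ) (E := ℂ × ℂ) (F := ℂ × ℂ)).continuous.tendsto (B0, v0)).comp
    (hB.prodMk_nhds hv)

lemma hf_lin {M P B Q : (ℂ × ℂ) →L[ℂ] ℂ × ℂ} (h : M.comp P = B.comp Q)
    (hP : ∀ v, (P v).1 = v.1) (hQ : ∀ v, (Q v).2 = v.2) (h0 : (P (0, 1)).2 ≠ 0) :
    tr2 M = (B ((Q (1, 0)).1, 0)).1 +
      ((P (0, 1)).2)⁻¹ * ((B (Q (0, 1))).2 - (P (1, 0)).2 * (B (Q (0, 1))).1) ∧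
    dt2 M * (P (0, 1)).2 = dt2 B * (Q (1, 0)).1 := by
  have e1 : P (1, 0) = (1, (P (1, 0)).2) := Prod.ext (hP _) rfl
  have e2 : P (0, 1) = (0, (P (0, 1)).2) := Prod.ext (hP _) rfl
  have e3 : Q (1, 0) = ((Q (1, 0)).1, 0) := Prod.ext rfl (hQ _)
  have a1 : M (P (1, 0)) = B (Q (1, 0)) := congrArg (fun A => A (1, 0)) h
  have a2 : M (P (0, 1)) = B (Q (0, 1)) := congrArg (fun A => A (0, 1)) h
  constructor
  · have b1 : M (1, 0) + (P (1, 0)).2 • M (0, 1) = B (Q (1, 0)) := by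
      have := hf_ap M 1 (P (1, 0)).2
      rw [one_smul, ← e1] at this
      rw [← a1, this]
    have b2 : (P (0, 1)).2 • M (0, 1) = B (Q (0, 1)) := by
      have := hf_ap M 0 (P (0, 1)).2
      rw [zero_smul, zero_add, ← e2] at this
      rw [← a2, this]
    rw [← e3, ← b1, ← b2]
    simp only [tr2, Prod.fst_add, Prod.snd_add, Prod.smul_fst, Prod.smul_snd, smul_eq_mul]
    field_simp
    ring
  · have := congrArg dt2 h
    rw [dt2_comp, dt2_comp] at this
    have e4 : dt2 P = (P (0, 1)).2 := by simp only [dt2, hP]; ring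
    have e5 : dt2 Q = (Q (1, 0)).1 := by simp only [dt2, hQ]; ring
    rw [e4, e5] at this
    exact this

lemma Sys.per (h : Sys f g l m θ ε R) {r : ℝ} (hrR : r < R) {K H : ℂ × ℂ → ℂ}
    (hKu : TendstoUniformlyOn (fun n q => (l ^ n)⁻¹ * ((f^[n] (bP f R n q)).1 - wu g R q.2)) K atTop
      (Metric.ball 0 r))
    (hKd : ∀ q ∈ Metric.ball (0 : ℂ × ℂ) r, DifferentiableAt ℂ K q)
    (hK1 : ∀ q ∈ Metric.ball (0 : ℂ × ℂ) r, fderiv ℂ K q (1, 0) ≠ 0)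
    (hHu : TendstoUniformlyOn (fun n q => m ^ n * ((bP f R n q).2 - ws f R q.1)) H atTop
      (Metric.ball 0 r))
    (hHd : ∀ q ∈ Metric.ball (0 : ℂ × ℂ) r, DifferentiableAt ℂ H q)
    (hH1 : ∀ q ∈ Metric.ball (0 : ℂ × ℂ) r, fderiv ℂ H q (0, 1) ≠ 0)
    {k : ℕ} {η0 : ℂ} (hH : Hom f g R r k η0)
    (hder : deriv (fun η => yh f R (f^[k] (gam g R η))) η0 ≠ 0) :
    ∃ z : ℕ → ℂ × ℂ, Tendsto z atTop (𝓝 (f^[k] (gam g R η0))) ∧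
      (∀ᶠ n in atTop, f^[k + n] (z n) = z n) ∧ ∃ t0 d0 : ℂ, t0 ≠ 0 ∧ d0 ≠ 0 ∧
      Tendsto (fun n => tr2 (fderiv ℂ (f^[k + n]) (z n)) / m ^ n) atTop (𝓝 t0) ∧
      Tendsto (fun n => dt2 (fderiv ℂ (f^[k + n]) (z n)) / (l ^ n * m ^ n)) atTop (𝓝 d0) := by
  have L := h.lo
  have l0 := L.l0
  have m0 := L.m0
  set T : ℂ → ℂ × ℂ := fun η => f^[k] (gam g R η) with hT
  set ξ0 := (T η0).1 with hξ0
  have hηR : ‖η0‖ < R := hH.ηr.trans hrR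
  have hξR : ‖ξ0‖ < R := hH.ξr.trans hrR
  set q0 : ℂ × ℂ := (ξ0, η0) with hq0
  have hq0r : ‖q0‖ < r := by rw [Prod.norm_def]; exact max_lt hH.ξr hH.ηr
  have hq0R : ‖q0‖ < R := hq0r.trans hrR
  have hq0b : q0 ∈ Metric.ball (0 : ℂ × ℂ) r := by simpa using hq0r
  have hbn : Metric.ball (0 : ℂ × ℂ) r ∈ 𝓝 q0 := Metric.isOpen_ball.mem_nhds hq0b
  have evR : ∀ᶠ w : ℂ × ℂ in 𝓝 q0, ‖w‖ < R := continuous_norm.continuousAt.eventually (gt_mem_nhds hq0R)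
  have evp : ∀ᶠ p : ℕ × (ℂ × ℂ) in atTop ×ˢ 𝓝 q0, ‖p.2‖ < R := tendsto_snd.eventually evR
  have hTd : HasDerivAt T (fderiv ℂ (f^[k]) (gam g R η0) (deriv (wu g R) η0, 1)) η0 := by
    have h1 : HasDerivAt (gam g R) (deriv (wu g R) η0, 1) η0 :=
      (h.wu_diffAt hηR).hasDerivAt.prodMk (hasDerivAt_id η0)
    exact HasFDerivAt.comp_hasDerivAt (f := gam g R) (l := f^[k]) η0
      ((L.dif.iterate k) _).hasFDerivAt h1
  set B0 := fderiv ℂ (f^[k]) (gam g R η0) with hB0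
  set T' := B0 (deriv (wu g R) η0, 1) with hT'
  set S' := deriv (ws f R) ξ0 with hS'
  have hφ : deriv (fun η => yh f R (T η)) η0 = T'.2 - S' * T'.1 := by
    have h1 : HasDerivAt (fun η => (T η).1) T'.1 η0 :=
      HasFDerivAt.comp_hasDerivAt (f := T) (l := Prod.fst) η0 hasFDerivAt_fst hTd
    have h2 : HasDerivAt (fun η => (T η).2) T'.2 η0 :=
      HasFDerivAt.comp_hasDerivAt (f := T) (l := Prod.snd) η0 hasFDerivAt_snd hTd
    have h3 : HasDerivAt (fun η => ws f R (T η).1) (S' * T'.1) η0 :=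
      HasDerivAt.comp (h₂ := ws f R) (h := fun η => (T η).1) η0
        (h.ws_diffAt hξR).hasDerivAt h1
    exact (h2.fun_sub h3).deriv
  rw [hφ] at hder
  set P : ℕ → ℂ × ℂ → ℂ × ℂ := fun n q => bP f R n q with hP
  set Q : ℕ → ℂ × ℂ → ℂ × ℂ := fun n q => f^[n] (bP f R n q) with hQ
  have dP : ∀ n q, ‖q‖ < R → DifferentiableAt ℂ (P n) q := fun n q hq => L.bP_diff n hq
  have dQ : ∀ n q, ‖q‖ < R → DifferentiableAt ℂ (Q n) q := fun n q hq =>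
    DifferentiableAt.comp (g := f^[n]) (f := P n) q ((L.dif.iterate n) _) (dP n q hq)
  have cP : ∀ w : ℂ × ℂ, ‖w‖ < R → Tendsto (fun p : ℕ × (ℂ × ℂ) => P p.1 p.2) (atTop ×ˢ 𝓝 w)
      (𝓝 (w.1, ws f R w.1)) := fun w hw => L.bP_lim tendsto_fst tendsto_snd hw
  have cQ : ∀ w : ℂ × ℂ, ‖w‖ < R → Tendsto (fun p : ℕ × (ℂ × ℂ) => Q p.1 p.2) (atTop ×ˢ 𝓝 w)
      (𝓝 (wu g R w.2, w.2)) := fun w hw => h.fbP_lim tendsto_fst tendsto_snd hw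
  have DP := hf_dlim (evR.mono cP) (evp.mono fun p hp => dP p.1 p.2 hp)
  have DQ := hf_dlim (evR.mono cQ) (evp.mono fun p hp => dQ p.1 p.2 hp)
  have hWs : HasFDerivAt (fun w : ℂ × ℂ => ws f R w.1) (S' • ContinuousLinearMap.fst ℂ ℂ ℂ) q0 :=
    HasDerivAt.comp_hasFDerivAt (h₂ := ws f R) (f := Prod.fst) q0 (h.ws_diffAt hξR).hasDerivAt
      hasFDerivAt_fst
  have hP0 : HasFDerivAt (fun w : ℂ × ℂ => (w.1, ws f R w.1))
      ((ContinuousLinearMap.fst ℂ ℂ ℂ).prod (S' • ContinuousLinearMap.fst ℂ ℂ ℂ)) q0 :=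
    hasFDerivAt_fst.prodMk hWs
  have hQ0 : HasFDerivAt (fun w : ℂ × ℂ => (wu g R w.2, w.2))
      ((deriv (wu g R) η0 • ContinuousLinearMap.snd ℂ ℂ ℂ).prod (ContinuousLinearMap.snd ℂ ℂ ℂ)) q0 :=
    (HasDerivAt.comp_hasFDerivAt (h₂ := wu g R) (f := Prod.snd) q0 (h.wu_diffAt hηR).hasDerivAt
      hasFDerivAt_snd).prodMk hasFDerivAt_snd
  rw [hP0.fderiv] at DP
  rw [hQ0.fderiv] at DQ
  -- solve
  have hT2 : HasFDerivAt (fun w : ℂ × ℂ => T w.2)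
      (((ContinuousLinearMap.snd ℂ ℂ ℂ)).smulRight T') q0 := by
    have := HasFDerivAt.comp (g := T) (f := Prod.snd) q0 hTd.hasFDerivAt
      (hasFDerivAt_snd (𝕜 := ℂ) (E := ℂ) (F := ℂ) (p := q0))
    refine this.congr_fderiv ?_
    ext <;> simp
  have hg := hP0.fun_sub hT2
  obtain ⟨A, hA⟩ := hf_inj (A := (ContinuousLinearMap.fst ℂ ℂ ℂ).prod
      (S' • ContinuousLinearMap.fst ℂ ℂ ℂ) - (ContinuousLinearMap.snd ℂ ℂ ℂ).smulRight T') (by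
    rintro ⟨x, y⟩ hv
    have v1 := congrArg Prod.fst hv
    have v2 := congrArg Prod.snd hv
    simp at v1 v2
    have hy : y * (T'.2 - S' * T'.1) = 0 := by linear_combination S' * v1 - v2
    have hy0 : y = 0 := (mul_eq_zero.1 hy).resolve_right hder
    subst hy0
    simp at v1
    simp [v1])
  rw [← hA] at hg
  have hfkc := (L.dif.iterate k).continuous
  obtain ⟨q, hq, hqs⟩ := he_solve (G := fun n w => P n w - f^[k] (Q n w))
    (evR.mono fun w hw => (cP w hw).sub ((hfkc.tendsto _).comp (cQ w hw)))
    (evp.mono fun p hp => (dP _ _ hp).sub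
      (DifferentiableAt.comp (g := f^[k]) (f := Q p.1) p.2 ((L.dif.iterate k) _) (dQ _ _ hp)))
    (by
      have h1 : (T η0).2 - ws f R (T η0).1 = 0 := hH.hy
      apply sub_eq_zero.2
      exact Prod.ext rfl (sub_eq_zero.1 h1).symm) A hg
  have hq' : Tendsto (fun n => (n, q n)) atTop (atTop ×ˢ 𝓝 q0) := tendsto_id.prodMk hq
  have evq : ∀ᶠ n in atTop, ‖q n‖ < R := hq.eventually evR
  set z : ℕ → ℂ × ℂ := fun n => P n (q n) with hz
  have hTq : (q0.1, ws f R q0.1) = T η0 := by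
    have h1 : (T η0).2 - ws f R (T η0).1 = 0 := hH.hy
    exact Prod.ext rfl (sub_eq_zero.1 h1).symm
  have hzl : Tendsto z atTop (𝓝 (T η0)) := by
    rw [← hTq]; exact (cP q0 hq0R).comp hq'
  refine ⟨z, hzl, ?_, ?_⟩
  · filter_upwards [hqs] with n hn
    rw [iterate_add_apply]
    exact (sub_eq_zero.1 hn.1).symm
  -- derivative limits
  set DPn : ℕ → (ℂ × ℂ) →L[ℂ] ℂ × ℂ := fun n => fderiv ℂ (P n) (q n) with hDPn
  set DQn : ℕ → (ℂ × ℂ) →L[ℂ] ℂ × ℂ := fun n => fderiv ℂ (Q n) (q n) with hDQn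
  set Bn : ℕ → (ℂ × ℂ) →L[ℂ] ℂ × ℂ := fun n => fderiv ℂ (f^[k]) (Q n (q n)) with hBn
  have lDP := DP.comp hq'
  have lDQ := DQ.comp hq'
  have lB : Tendsto Bn atTop (𝓝 B0) := by
    have : ContinuousAt (fderiv ℂ (f^[k])) (gam g R η0) :=
      ha_fderiv_cont (Eventually.of_forall (L.dif.iterate k))
    exact this.tendsto.comp ((cQ q0 hq0R).comp hq')
  have fP : ∀ n, ‖q n‖ < R → ∀ v, (DPn n v).1 = v.1 := by
    intro n hn v
    have h1 : HasFDerivAt (fun w => (P n w).1) ((ContinuousLinearMap.fst ℂ ℂ ℂ).comp (DPn n)) (q n) :=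
      HasFDerivAt.comp (g := Prod.fst) (f := P n) (q n) hasFDerivAt_fst (dP n _ hn).hasFDerivAt
    have h2 : HasFDerivAt (fun w => (P n w).1) (ContinuousLinearMap.fst ℂ ℂ ℂ) (q n) := by
      refine hasFDerivAt_fst.congr_of_eventuallyEq ?_
      filter_upwards [continuous_norm.continuousAt.eventually (gt_mem_nhds hn)] with w hw
      exact (L.bP_spec n (le_of_lt hw)).1
    exact congrArg (fun A => A v) (h1.unique h2)
  have fQ : ∀ n, ‖q n‖ < R → ∀ v, (DQn n v).2 = v.2 := by
    intro n hn v
    have h1 : HasFDerivAt (fun w => (Q n w).2) ((ContinuousLinearMap.snd ℂ ℂ ℂ).comp (DQn n)) (q n) :=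
      HasFDerivAt.comp (g := Prod.snd) (f := Q n) (q n) hasFDerivAt_snd (dQ n _ hn).hasFDerivAt
    have h2 : HasFDerivAt (fun w => (Q n w).2) (ContinuousLinearMap.snd ℂ ℂ ℂ) (q n) := by
      refine hasFDerivAt_snd.congr_of_eventuallyEq ?_
      filter_upwards [continuous_norm.continuousAt.eventually (gt_mem_nhds hn)] with w hw
      exact (L.bP_spec n (le_of_lt hw)).2.2
    exact congrArg (fun A => A v) (h1.unique h2)
  have hcomp : ∀ n, ‖q n‖ < R → (fderiv ℂ (f^[k + n]) (z n)).comp (DPn n) = (Bn n).comp (DQn n) := by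
    intro n hn
    have h1 : HasFDerivAt (fun w => f^[k + n] (P n w))
        ((fderiv ℂ (f^[k + n]) (z n)).comp (DPn n)) (q n) :=
      HasFDerivAt.comp (g := f^[k + n]) (f := P n) (q n) ((L.dif.iterate _) _).hasFDerivAt
        (dP n _ hn).hasFDerivAt
    have h2 : HasFDerivAt (fun w => f^[k] (Q n w)) ((Bn n).comp (DQn n)) (q n) :=
      HasFDerivAt.comp (g := f^[k]) (f := Q n) (q n) ((L.dif.iterate _) _).hasFDerivAt
        (dQ n _ hn).hasFDerivAt
    have h3 : (fun w => f^[k + n] (P n w)) = fun w => f^[k] (Q n w) := by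
      funext w; rw [iterate_add_apply]
    rw [h3] at h1
    exact h1.unique h2
  -- scaled limits
  have lH : Tendsto (fun n => m ^ n * (DPn n (0, 1)).2) atTop (𝓝 (fderiv ℂ H q0 (0, 1))) := by
    have dd : ∀ (n : ℕ) (w : ℂ × ℂ), ‖w‖ < R →
        HasFDerivAt (fun q : ℂ × ℂ => m ^ n * ((bP f R n q).2 - ws f R q.1))
        (m ^ n • ((ContinuousLinearMap.snd ℂ ℂ ℂ).comp (fderiv ℂ (P n) w) -
          deriv (ws f R) w.1 • ContinuousLinearMap.fst ℂ ℂ ℂ)) w := by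
      intro n w hw
      have h1 : HasFDerivAt (fun w => (P n w).2)
        ((ContinuousLinearMap.snd ℂ ℂ ℂ).comp (fderiv ℂ (P n) w)) w :=
        HasFDerivAt.comp (g := Prod.snd) (f := P n) w hasFDerivAt_snd (dP n _ hw).hasFDerivAt
      exact (h1.fun_sub (HasDerivAt.comp_hasFDerivAt (h₂ := ws f R) (f := Prod.fst) w
        (h.ws_diffAt ((norm_fst_le w).trans_lt hw)).hasDerivAt hasFDerivAt_fst)).const_mul _
    have h1 := hf_dlim (G := fun n q => m ^ n * ((bP f R n q).2 - ws f R q.1)) (g := H) (z := q0)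
      (by
        filter_upwards [hbn] with w hw
        exact he_tu hHu (Metric.isOpen_ball.mem_nhds hw) (hHd w hw).continuousAt tendsto_fst
          tendsto_snd)
      (evp.mono fun p hp => (dd p.1 p.2 hp).differentiableAt)
    have h2 := h1.comp hq'
    have h3 := ((ContinuousLinearMap.apply ℂ ℂ ((0, 1) : ℂ × ℂ)).continuous.tendsto _).comp h2
    refine h3.congr' ?_
    filter_upwards [evq] with n hn
    simp only [comp, ContinuousLinearMap.apply_apply]
    rw [(dd n _ hn).fderiv]
    simp [hDPn]
  have lK : Tendsto (fun n => (l ^ n)⁻¹ * (DQn n (1, 0)).1) atTop (𝓝 (fderiv ℂ K q0 (1, 0))) := by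
    have dd : ∀ (n : ℕ) (w : ℂ × ℂ), ‖w‖ < R →
        HasFDerivAt (fun q : ℂ × ℂ => (l ^ n)⁻¹ * ((f^[n] (bP f R n q)).1 - wu g R q.2))
        ((l ^ n)⁻¹ • ((ContinuousLinearMap.fst ℂ ℂ ℂ).comp (fderiv ℂ (Q n) w) -
          deriv (wu g R) w.2 • ContinuousLinearMap.snd ℂ ℂ ℂ)) w := by
      intro n w hw
      have h1 : HasFDerivAt (fun w => (Q n w).1)
        ((ContinuousLinearMap.fst ℂ ℂ ℂ).comp (fderiv ℂ (Q n) w)) w :=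
        HasFDerivAt.comp (g := Prod.fst) (f := Q n) w hasFDerivAt_fst (dQ n _ hw).hasFDerivAt
      exact (h1.fun_sub (HasDerivAt.comp_hasFDerivAt (h₂ := wu g R) (f := Prod.snd) w
        (h.wu_diffAt ((norm_snd_le w).trans_lt hw)).hasDerivAt hasFDerivAt_snd)).const_mul _
    have h1 := hf_dlim (G := fun n q => (l ^ n)⁻¹ * ((f^[n] (bP f R n q)).1 - wu g R q.2)) (g := K)
      (z := q0)
      (by
        filter_upwards [hbn] with w hw
        exact he_tu hKu (Metric.isOpen_ball.mem_nhds hw) (hKd w hw).continuousAt tendsto_fst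
          tendsto_snd)
      (evp.mono fun p hp => (dd p.1 p.2 hp).differentiableAt)
    have h2 := h1.comp hq'
    have h3 := ((ContinuousLinearMap.apply ℂ ℂ ((1, 0) : ℂ × ℂ)).continuous.tendsto _).comp h2
    refine h3.congr' ?_
    filter_upwards [evq] with n hn
    simp only [comp, ContinuousLinearMap.apply_apply]
    rw [(dd n _ hn).fderiv]
    simp [hDQn]
  have hHη := hH1 q0 hq0b
  have hKξ := hK1 q0 hq0b
  have ev0 : ∀ᶠ n in atTop, (DPn n (0, 1)).2 ≠ 0 := by
    filter_upwards [lH.eventually (isOpen_ne.mem_nhds hHη)] with n hn h0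
    rw [h0, mul_zero] at hn; exact hn rfl
  have lP1 : Tendsto (fun n => (DPn n (1, 0)).2) atTop (𝓝 S') := by
    have h3 := ((ContinuousLinearMap.apply ℂ (ℂ × ℂ) ((1, 0) : ℂ × ℂ)).continuous.tendsto _).comp lDP
    have h4 := (continuous_snd.tendsto _).comp h3
    simp at h4
    exact h4
  have lQ1 : Tendsto (fun n => DQn n (0, 1)) atTop (𝓝 (deriv (wu g R) η0, 1)) := by
    have h3 := ((ContinuousLinearMap.apply ℂ (ℂ × ℂ) ((0, 1) : ℂ × ℂ)).continuous.tendsto _).comp lDQ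
    simp at h3
    exact h3
  have lQ2 : Tendsto (fun n => ((DQn n (1, 0)).1, (0 : ℂ))) atTop (𝓝 0) := by
    have h3 := ((ContinuousLinearMap.apply ℂ (ℂ × ℂ) ((1, 0) : ℂ × ℂ)).continuous.tendsto _).comp lDQ
    have h4 := (continuous_fst.tendsto _).comp h3
    have h5 := h4.prodMk_nhds (tendsto_const_nhds (x := (0 : ℂ)))
    simp at h5
    rw [Prod.mk_zero_zero] at h5
    exact h5
  have lBQ : Tendsto (fun n => Bn n (DQn n (0, 1))) atTop (𝓝 T') := hf_clm lB lQ1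
  have lBQ2 : Tendsto (fun n => (Bn n ((DQn n (1, 0)).1, 0)).1) atTop (𝓝 0) := by
    have := (continuous_fst.tendsto _).comp (hf_clm lB lQ2)
    simp at this
    exact this
  have lm : Tendsto (fun n : ℕ => (m ^ n)⁻¹) atTop (𝓝 0) := by
    have : ‖m⁻¹‖ < 1 := by rw [norm_inv]; exact inv_lt_one_of_one_lt₀ L.m1
    simpa using tendsto_pow_atTop_nhds_zero_of_norm_lt_one this
  refine ⟨(fderiv ℂ H q0 (0, 1))⁻¹ * (T'.2 - S' * T'.1),
    dt2 B0 * (fderiv ℂ K q0 (1, 0) * (fderiv ℂ H q0 (0, 1))⁻¹),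
    mul_ne_zero (inv_ne_zero hHη) hder,
    mul_ne_zero (h.fk_dt k _) (mul_ne_zero hKξ (inv_ne_zero hHη)), ?_, ?_⟩
  · have h1 := (lm.mul lBQ2).add ((lH.inv₀ hHη).mul
      (((continuous_snd.tendsto _).comp lBQ).sub (lP1.mul ((continuous_fst.tendsto _).comp lBQ))))
    rw [mul_zero, zero_add] at h1
    refine h1.congr' ?_
    filter_upwards [evq, ev0] with n hn h0
    rw [(hf_lin (hcomp n hn) (fP n hn) (fQ n hn) h0).1]
    have mn := pow_ne_zero n m0
    simp only [comp, Pi.inv_apply]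
    field_simp
  · have h1 := ((dt2_cont.tendsto _).comp lB).mul (lK.mul (lH.inv₀ hHη))
    refine h1.congr' ?_
    filter_upwards [evq, ev0] with n hn h0
    have h2 := (hf_lin (hcomp n hn) (fP n hn) (fQ n hn) h0).2
    have mn := pow_ne_zero n m0
    have ln := pow_ne_zero n l0
    simp only [comp, Pi.inv_apply]
    rw [eq_div_of_mul_eq h0 h2]
    field_simp
end

open Function Set Filter Topology
noncomputable section
variable {f g : ℂ × ℂ → ℂ × ℂ} {l m : ℂ} {θ ε R : ℝ}

lemma hg_dsl {φ : ℂ → ℂ} (hφ : Differentiable ℂ φ) {C : ℝ} (hC : ∀ y, ‖y‖ ≤ 1 → ‖φ y - φ 0‖ ≤ C) :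
    Differentiable ℂ (dslope φ 0) ∧ ∀ y, ‖y‖ ≤ 1 → ‖dslope φ 0 y‖ ≤ C := by
  have hd : Differentiable ℂ (dslope φ 0) :=
    differentiableOn_univ.1 ((Complex.differentiableOn_dslope univ_mem).2 hφ.differentiableOn)
  refine ⟨hd, fun y hy => ?_⟩
  refine Complex.norm_le_of_forall_mem_frontier_norm_le (U := Metric.ball (0 : ℂ) 1)
    Metric.isBounded_ball hd.diffContOnCl (fun w hw => ?_) ?_
  · rw [frontier_ball _ one_ne_zero, mem_sphere_zero_iff_norm] at hw
    have h0 : w ≠ 0 := by rintro rfl; simp at hw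
    have := hC w hw.le
    rw [dslope_of_ne _ h0, slope_def_field, sub_zero, norm_div, hw, div_one]
    exact this
  · rw [closure_ball _ one_ne_zero]; simpa using hy

/-- families holomorphic in each variable and bounded -/
structure Fam (ρ C : ℝ) (q : ℂ → ℂ → ℂ) : Prop where
  a : ∀ x ∈ Metric.ball (0 : ℂ) ρ, Differentiable ℂ (q x)
  b : ∀ y, y ≠ 0 → DifferentiableOn ℂ (fun x => q x y) (Metric.ball 0 ρ)
  c : ∀ x ∈ Metric.ball (0 : ℂ) ρ, ∀ y, ‖y‖ ≤ 1 → ‖q x y‖ ≤ C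

lemma Fam.lip {ρ C : ℝ} {q : ℂ → ℂ → ℂ} (h : Fam ρ C q) {x : ℂ} (hx : x ∈ Metric.ball (0 : ℂ) ρ)
    {y : ℂ} (hy : ‖y‖ ≤ 1) : ‖q x y - q x 0‖ ≤ 2 * C * ‖y‖ := by
  have h1 := (hg_dsl (h.a x hx) (C := 2 * C) (fun y hy => by
    have := norm_sub_le (q x y) (q x 0)
    have h2 := h.c x hx y hy
    have h3 := h.c x hx 0 (by simp)
    linarith)).2 y hy
  have h2 := sub_smul_dslope (q x) 0 y
  rw [← h2, sub_zero, smul_eq_mul, norm_mul, mul_comm]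
  exact mul_le_mul_of_nonneg_right h1 (norm_nonneg _)

lemma Fam.diff0 {ρ C : ℝ} {q : ℂ → ℂ → ℂ} (h : Fam ρ C q) :
    DifferentiableOn ℂ (fun x => q x 0) (Metric.ball 0 ρ) := by
  have h1 : TendstoUniformlyOn (fun (n : ℕ) x => q x (1 / ((n : ℂ) + 1))) (fun x => q x 0) atTop
      (Metric.ball 0 ρ) := by
    rw [Metric.tendstoUniformlyOn_iff]
    intro e he
    have h2 : Tendsto (fun n : ℕ => 2 * C * ‖1 / ((n : ℂ) + 1)‖) atTop (𝓝 0) := by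
      have := (tendsto_one_div_add_atTop_nhds_zero_nat (𝕜 := ℂ)).norm.const_mul (2 * C)
      simpa using this
    filter_upwards [h2.eventually_lt_const he] with n hn x hx
    rw [dist_comm, dist_eq_norm]
    refine (h.lip hx ?_).trans_lt hn
    rw [norm_div, norm_one]
    have : ‖(n : ℂ) + 1‖ = n + 1 := by
      rw [show (n : ℂ) + 1 = ((n + 1 : ℕ) : ℂ) by push_cast; ring, Complex.norm_natCast]; push_cast; ring
    rw [this]
    rw [div_le_one (by positivity)]
    have : (0 : ℝ) ≤ n := Nat.cast_nonneg n
    linarith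
  refine h1.tendstoLocallyUniformlyOn.differentiableOn
    (Eventually.of_forall fun n => h.b _ ?_) Metric.isOpen_ball
  have : (n : ℂ) + 1 ≠ 0 := by exact_mod_cast Nat.succ_ne_zero n
  exact one_div_ne_zero this

lemma Fam.zero0 {ρ C : ℝ} {q : ℂ → ℂ → ℂ} (h : Fam ρ C q) {S : Set (ℂ × ℂ)}
    (hS : ∀ w ∈ S, w.1 ∈ Metric.ball (0 : ℂ) ρ ∧ q w.1 w.2 = 0) {x : ℕ → ℂ}
    (hx : ∀ j, x j ∈ Metric.ball (0 : ℂ) ρ) (hx0 : ∀ j, x j ≠ 0) (hxl : Tendsto x atTop (𝓝 0))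
    (hxS : ∀ j, ((x j, 0) : ℂ × ℂ) ∈ closure S) (hρ : 0 < ρ) :
    ∀ x ∈ Metric.ball (0 : ℂ) ρ, q x 0 = 0 := by
  have hd := h.diff0
  have hz : ∀ j, q (x j) 0 = 0 := by
    intro j
    obtain ⟨w, hwS, hw⟩ := mem_closure_iff_seq_limit.1 (hxS j)
    have w1 : Tendsto (fun n => (w n).1) atTop (𝓝 (x j)) := (continuous_fst.tendsto _).comp hw
    have w2 : Tendsto (fun n => (w n).2) atTop (𝓝 0) := (continuous_snd.tendsto _).comp hw
    have h1 : Tendsto (fun n => q (w n).1 0) atTop (𝓝 (q (x j) 0)) :=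
      ((hd.differentiableAt (Metric.isOpen_ball.mem_nhds (hx j))).continuousAt).tendsto.comp w1
    have h2 : Tendsto (fun n => q (w n).1 0) atTop (𝓝 0) := by
      rw [tendsto_zero_iff_norm_tendsto_zero]
      have h3 : Tendsto (fun n => 2 * C * ‖(w n).2‖) atTop (𝓝 0) := by
        have := w2.norm.const_mul (2 * C)
        simpa using this
      refine squeeze_zero' (Eventually.of_forall fun _ => norm_nonneg _) ?_ h3
      have h4 := w2.norm.eventually (gt_mem_nhds (show ‖(0 : ℂ)‖ < 1 by simp))
      filter_upwards [h4] with n hn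
      have := h.lip (hS _ (hwS n)).1 hn.le
      rwa [(hS _ (hwS n)).2, zero_sub, norm_neg] at this
    exact tendsto_nhds_unique h1 h2
  have hA : AnalyticOnNhd ℂ (fun x => q x 0) (Metric.ball 0 ρ) := hd.analyticOnNhd Metric.isOpen_ball
  have hf : ∃ᶠ x in 𝓝[≠] (0 : ℂ), q x 0 = 0 := by
    have : Tendsto x atTop (𝓝[≠] 0) := tendsto_nhdsWithin_iff.2 ⟨hxl, Eventually.of_forall hx0⟩
    exact this.frequently (Frequently.of_forall hz)
  exact hA.eqOn_zero_of_preconnected_of_frequently_eq_zero (convex_ball _ _).isPreconnected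
    (Metric.mem_ball_self hρ) hf

lemma Fam.div {ρ C : ℝ} {q : ℂ → ℂ → ℂ} (h : Fam ρ C q)
    (h0 : ∀ x ∈ Metric.ball (0 : ℂ) ρ, q x 0 = 0) :
    Fam ρ C (fun x => dslope (q x) 0) ∧ ∀ x ∈ Metric.ball (0 : ℂ) ρ, ∀ y,
      q x y = y * dslope (q x) 0 y := by
  have e : ∀ x ∈ Metric.ball (0 : ℂ) ρ, ∀ y, q x y = y * dslope (q x) 0 y := by
    intro x hx y
    have h2 := sub_smul_dslope (q x) 0 y
    rw [sub_zero, h0 x hx, sub_zero] at h2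
    exact h2.symm
  refine ⟨⟨fun x hx => ?_, fun y hy => ?_, fun x hx => ?_⟩, e⟩
  · exact (hg_dsl (h.a x hx) (fun y hy => by rw [h0 x hx, sub_zero]; exact h.c x hx y hy)).1
  · refine ((h.b y hy).const_mul y⁻¹).congr fun x hx => ?_
    rw [e x hx y, inv_mul_cancel_left₀ hy]
  · exact (hg_dsl (h.a x hx) (fun y hy => by rw [h0 x hx, sub_zero]; exact h.c x hx y hy)).2

lemma Fam.all0 {ρ C : ℝ} {q : ℂ → ℂ → ℂ} (h : Fam ρ C q) {S : Set (ℂ × ℂ)}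
    (hS : ∀ w ∈ S, w.1 ∈ Metric.ball (0 : ℂ) ρ ∧ w.2 ≠ 0 ∧ q w.1 w.2 = 0) {x : ℕ → ℂ}
    (hx : ∀ j, x j ∈ Metric.ball (0 : ℂ) ρ) (hx0 : ∀ j, x j ≠ 0) (hxl : Tendsto x atTop (𝓝 0))
    (hxS : ∀ j, ((x j, 0) : ℂ × ℂ) ∈ closure S) (hρ : 0 < ρ) :
    ∀ x ∈ Metric.ball (0 : ℂ) ρ, ∀ y, ‖y‖ < 1 → q x y = 0 := by
  have key : ∀ k : ℕ, ∃ p : ℂ → ℂ → ℂ, Fam ρ C p ∧ (∀ w ∈ S, p w.1 w.2 = 0) ∧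
      ∀ x ∈ Metric.ball (0 : ℂ) ρ, ∀ y, q x y = y ^ k * p x y := by
    intro k
    induction k with
    | zero => exact ⟨q, h, fun w hw => (hS w hw).2.2, fun x _ y => by simp⟩
    | succ k ih =>
      obtain ⟨p, p1, p2, p3⟩ := ih
      have hp0 := p1.zero0 (fun w hw => ⟨(hS w hw).1, p2 w hw⟩) hx hx0 hxl hxS hρ
      obtain ⟨d1, d2⟩ := p1.div hp0
      refine ⟨_, d1, fun w hw => ?_, fun x hx y => ?_⟩
      · have := d2 _ (hS w hw).1 w.2
        rw [p2 w hw] at this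
        exact (mul_eq_zero.1 this.symm).resolve_left (hS w hw).2.1
      · rw [p3 x hx, d2 x hx]; ring
  intro x hx y hy
  have h1 : ∀ k : ℕ, ‖q x y‖ ≤ C * ‖y‖ ^ k := by
    intro k
    obtain ⟨p, p1, _, p3⟩ := key k
    rw [p3 x hx y, norm_mul, norm_pow, mul_comm]
    exact mul_le_mul_of_nonneg_right (p1.c x hx y hy.le) (by positivity)
  have h2 : Tendsto (fun k : ℕ => C * ‖y‖ ^ k) atTop (𝓝 0) := by
    simpa using (tendsto_pow_atTop_nhds_zero_of_lt_one (norm_nonneg y) hy).const_mul C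
  exact norm_le_zero_iff.1 (ge_of_tendsto' h2 h1)

lemma hg_ident {G : ℂ × ℂ → ℂ} (hG : Differentiable ℂ G) (h0 : ∀ᶠ z in 𝓝 (0 : ℂ × ℂ), G z = 0) :
    ∀ z, G z = 0 := by
  intro z
  have hd : Differentiable ℂ (fun t : ℂ => G (t • z)) := hG.comp (by fun_prop)
  have hA : AnalyticOnNhd ℂ (fun t : ℂ => G (t • z)) univ :=
    hd.differentiableOn.analyticOnNhd isOpen_univ
  have ht : Tendsto (fun t : ℂ => t • z) (𝓝 0) (𝓝 0) := by
    have : Continuous fun t : ℂ => t • z := by fun_prop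
    simpa using this.tendsto 0
  have := hA.eqOn_zero_of_preconnected_of_eventuallyEq_zero isPreconnected_univ (mem_univ 0)
    (ht.eventually h0) (mem_univ 1)
  simpa using this

lemma Sys.zar (h : Sys f g l m θ ε R) {G : ℂ × ℂ → ℂ} (hG : Differentiable ℂ G) {S : Set (ℂ × ℂ)}
    (hS : ∀ w ∈ S, ‖w.1‖ < R ∧ yh f R w ≠ 0 ∧ G w = 0) {x : ℕ → ℂ}
    (hx : ∀ j, ‖x j‖ < R) (hx0 : ∀ j, x j ≠ 0) (hxl : Tendsto x atTop (𝓝 0))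
    (hxS : ∀ j, ((x j, ws f R (x j)) : ℂ × ℂ) ∈ closure S) : ∀ z, G z = 0 := by
  have L := h.lo
  set q : ℂ → ℂ → ℂ := fun x y => G (x, ws f R x + y) with hq
  obtain ⟨C, hC⟩ := (isCompact_closedBall (0 : ℂ × ℂ) (R + 1)).exists_bound_of_continuousOn
    hG.continuous.continuousOn
  have hF : Fam R C q := by
    refine ⟨fun x hx => ?_, fun y _ x hx => ?_, fun x hx y hy => ?_⟩
    · exact hG.comp (by fun_prop)
    · have hx' : ‖x‖ < R := by simpa using hx
      have := h.ws_diffAt hx'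
      refine DifferentiableAt.differentiableWithinAt ?_
      exact DifferentiableAt.comp (g := G) (f := fun x => (x, ws f R x + y)) x (hG _)
        (differentiableAt_id.prodMk (this.add_const y))
    · have hx' : ‖x‖ < R := by simpa using hx
      apply hC
      rw [mem_closedBall_zero_iff, Prod.norm_def]
      have h1 := L.ws_norm hx'.le
      have h2 := norm_add_le (ws f R x) y
      have h3 := L.θ1
      have h4 : θ * ‖x‖ ≤ ‖x‖ := mul_le_of_le_one_left (norm_nonneg _) h3.le
      apply max_le
      · simp only; linarith
      · simp only; linarith
  have hall := hF.all0 (S := (fun w => (w.1, yh f R w)) '' S) (x := x) ?_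
    (fun j => by simpa using hx j) hx0 hxl ?_ L.R0
  · apply hg_ident hG
    have c1 : Tendsto (fun z : ℂ × ℂ => yh f R z) (𝓝 0) (𝓝 0) := by
      have := (h.yh_diffAt (z := 0) (by simpa using L.R0)).continuousAt.tendsto
      rwa [show yh f R 0 = 0 by simp [yh, L.ws_zero]] at this
    have c2 := c1.norm.eventually (gt_mem_nhds (show ‖(0 : ℂ)‖ < 1 by simp))
    have c3 := Metric.ball_mem_nhds (0 : ℂ × ℂ) L.R0
    filter_upwards [c2, c3] with z h2 h3
    have := hall z.1 (by
      have := norm_fst_le z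
      simp at h3 ⊢
      linarith) (yh f R z) h2
    simpa [hq, yh] using this
  · rintro _ ⟨w, hw, rfl⟩
    obtain ⟨h1, h2, h3⟩ := hS w hw
    refine ⟨by simpa using h1, h2, ?_⟩
    simpa [hq, yh] using h3
  · intro j
    have hc : ContinuousAt (fun w : ℂ × ℂ => (w.1, yh f R w)) (x j, ws f R (x j)) :=
      continuousAt_fst.prodMk (h.yh_diffAt (hx j)).continuousAt
    have := mem_closure_image hc (hxS j)
    simpa [yh] using this
end

open Function Set Filter Topology
noncomputable section
variable {f g : ℂ × ℂ → ℂ × ℂ} {l m : ℂ} {θ ε R : ℝ}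

lemma Loc.ws_lim (h : Loc f l m θ ε R) {x : ℂ} (hx : ‖x‖ ≤ R) (j : ℕ) :
    ‖f^[j] (x, ws f R x)‖ ≤ θ ^ j * ‖x‖ := by
  have := h.stab_hyp (h.ws_spec hx) (z' := 0) (fun i => h.orb0 i i le_rfl) j
  simpa [iterate_fixed h.fix] using this

lemma Loc.ws_per (h : Loc f l m θ ε R) {w : ℂ × ℂ} (hw : ‖w.1‖ ≤ R) (hy : yh f R w = 0) {N : ℕ}
    (hN : 1 ≤ N) (hp : f^[N] w = w) : w = 0 := by
  have e : w = (w.1, ws f R w.1) := Prod.ext rfl (sub_eq_zero.1 hy)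
  have h1 := h.ws_lim hw N
  rw [← e, hp] at h1
  have h2 := norm_fst_le w
  have h3 : θ ^ N ≤ θ := by
    have := pow_le_pow_of_le_one h.θ0.le h.θ1.le hN
    simpa using this
  have h4 := norm_nonneg w
  have h5 := h.θ1
  have h6 : θ ^ N * ‖w.1‖ ≤ θ * ‖w‖ := mul_le_mul h3 h2 (norm_nonneg _) h.θ0.le
  have : ‖w‖ ≤ 0 := by nlinarith
  exact norm_le_zero_iff.1 this

lemma Sys.eig_tr (h : Sys f g l m θ ε R) {N j : ℕ} {z : ℂ × ℂ} (hz : f^[N] z = z) {w : ℂ}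
    (he : ∃ v : ℂ × ℂ, v ≠ 0 ∧ fderiv ℂ (f^[N]) z v = w • v) :
    ∃ v : ℂ × ℂ, v ≠ 0 ∧ fderiv ℂ (f^[N]) (f^[j] z) v = w • v := by
  obtain ⟨v, v0, hv⟩ := he
  refine ⟨fderiv ℂ (f^[j]) z v, fun h0 => v0 ?_, ?_⟩
  · have := congrArg (fun A => A v) (h.fk_inv j z)
    simpa [h0] using this.symm
  · have h1 : HasFDerivAt (fun w => f^[N] (f^[j] w))
        ((fderiv ℂ (f^[N]) (f^[j] z)).comp (fderiv ℂ (f^[j]) z)) z :=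
      HasFDerivAt.comp (g := f^[N]) (f := f^[j]) z ((h.lo.dif.iterate _) _).hasFDerivAt
        ((h.lo.dif.iterate _) _).hasFDerivAt
    have h2 : HasFDerivAt (fun w => f^[j] (f^[N] w))
        ((fderiv ℂ (f^[j]) z).comp (fderiv ℂ (f^[N]) z)) z := by
      have := ((h.lo.dif.iterate j) (f^[N] z)).hasFDerivAt
      have a := HasFDerivAt.comp (g := f^[j]) (f := f^[N]) z this
        ((h.lo.dif.iterate N) z).hasFDerivAt
      rw [hz] at a
      exact a
    have h3 : (fun w => f^[N] (f^[j] w)) = fun w => f^[j] (f^[N] w) := by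
      funext w; rw [← iterate_add_apply, ← iterate_add_apply, add_comm]
    rw [h3] at h1
    have := congrArg (fun A => A v) (h1.unique h2)
    simp only [ContinuousLinearMap.comp_apply, hv, map_smul] at this
    exact this

lemma Sys.hom (h : Sys f g l m θ ε R) {r : ℝ} (hr : 0 < r) (hrR : r < R) {τ : ℂ × ℂ} (hτ : τ ≠ 0)
    (hs : Tendsto (fun n : ℕ => f^[n] τ) atTop (𝓝 0))
    (hu : Tendsto (fun n : ℕ => g^[n] τ) atTop (𝓝 0)) : ∃ k η, Hom f g R r k η := by
  have L := h.lo
  obtain ⟨a, ha⟩ := eventually_atTop.1 (hs.norm.eventually (gt_mem_nhds (show ‖(0 : ℂ × ℂ)‖ < r by simpa)))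
  obtain ⟨b, hb⟩ := eventually_atTop.1 (hu.norm.eventually (gt_mem_nhds (show ‖(0 : ℂ × ℂ)‖ < r by simpa)))
  have g0 : g 0 = 0 := by have := h.left 0; rwa [L.fix] at this
  have hA : ∀ i, ‖f^[i] (f^[a] τ)‖ ≤ R := fun i => by
    rw [← iterate_add_apply]; exact ((ha _ (by omega)).trans hrR).le
  have hB : ∀ i, ‖g^[i] (g^[b] τ)‖ ≤ R := fun i => by
    rw [← iterate_add_apply]; exact ((hb _ (by omega)).trans hrR).le
  have e1 := L.ws_uniq hA
  have e2 := h.wu_uniq hB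
  have fa0 : f^[a] τ ≠ 0 := fun h0 => hτ (by
    have := h.gf a τ; rw [h0, iterate_fixed g0] at this; exact this.symm)
  have gb0 : g^[b] τ ≠ 0 := fun h0 => hτ (by
    have := h.fg b τ; rw [h0, iterate_fixed L.fix] at this; exact this.symm)
  have hgam : gam g R (g^[b] τ).2 = g^[b] τ := Prod.ext e2.symm rfl
  have hit : f^[a + b] (gam g R (g^[b] τ).2) = f^[a] τ := by
    rw [hgam, iterate_add_apply, h.fg]
  have wu0 : wu g R 0 = 0 := h.lo'.ws_zero
  refine ⟨a + b, (g^[b] τ).2, ?_, ?_, ?_, ?_, ?_⟩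
  · intro h0; apply gb0
    rw [h0, wu0] at e2
    exact Prod.ext e2 h0
  · exact (norm_snd_le _).trans_lt (hb b le_rfl)
  · rw [hit]; intro h0; apply fa0
    rw [h0, L.ws_zero] at e1
    exact Prod.ext h0 e1
  · rw [hit]; exact (norm_fst_le _).trans_lt (ha a le_rfl)
  · rw [hit]; exact sub_eq_zero.2 e1

lemma Sys.main (h : Sys f g l m θ ε R) {τ : ℂ × ℂ} (hτ : τ ≠ 0)
    (hs : Tendsto (fun n : ℕ => f^[n] τ) atTop (𝓝 0))
    (hu : Tendsto (fun n : ℕ => g^[n] τ) atTop (𝓝 0)) :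
    ∃ (c c' : ℂ) (N : ℕ) (pp : ℕ → ℂ × ℂ) (ls lu : ℕ → ℂ), c ≠ 0 ∧ c' ≠ 0 ∧ 1 ≤ N ∧
      (∀ n, N ≤ n → f^[n] (pp n) = pp n ∧
        (∃ v : ℂ × ℂ, v ≠ 0 ∧ fderiv ℂ (f^[n]) (pp n) v = ls n • v) ∧
        (∃ v : ℂ × ℂ, v ≠ 0 ∧ fderiv ℂ (f^[n]) (pp n) v = lu n • v) ∧
        ‖ls n‖ < 1 ∧ 1 < ‖lu n‖) ∧
      Tendsto (fun n : ℕ => ls n / l ^ n) atTop (𝓝 c) ∧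
      Tendsto (fun n : ℕ => lu n / m ^ n) atTop (𝓝 c') ∧
      0 ∈ closure {x : ℂ × ℂ | ∃ n, N ≤ n ∧ pp n = x} ∧
      ∀ G : ℂ × ℂ → ℂ, Differentiable ℂ G → (∀ n, N ≤ n → G (pp n) = 0) → ∀ z, G z = 0 := by
  have L := h.lo
  have l0 := L.l0
  have m0 := L.m0
  obtain ⟨r1, hr1, hr1R, K, H, ⟨k1, k2, k3, k4⟩, ⟨j1, j2, j3, j4⟩⟩ := h.nf
  obtain ⟨r2, hr2, hr2R, hno⟩ := h.noover
  set r := min r1 r2 with hr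
  have hr0 : 0 < r := lt_min hr1 hr2
  have hrr1 : r ≤ r1 := min_le_left _ _
  have hrr2 : r ≤ r2 := min_le_right _ _
  have hrR : r < R := hrr1.trans_lt hr1R
  have sub : Metric.ball (0 : ℂ × ℂ) r ⊆ Metric.ball 0 r1 := Metric.ball_subset_ball hrr1
  obtain ⟨k0, η0, hH0⟩ := h.hom hr0 hrR hτ hs hu
  obtain ⟨k, η, hH, hder⟩ := h.transv hrR (k1.mono sub) (fun q hq => k2 q (sub hq))
    (fun q hq => k3 q (sub hq)) (j1.mono sub) (fun q hq => j2 q (sub hq))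
    (fun q hq => j3 q (sub hq))
    (fun k η h0 h1 h2 h3 => hno k η h0 (h1.trans_le hrr2) (h2.trans_le hrr2)
      (h3.mono fun η hη => sub_eq_zero.1 hη)) hH0
  obtain ⟨z, hzl, hzp, t0, d0, t00, d00, ht, hd⟩ := h.per hrR (k1.mono sub) (fun q hq => k2 q (sub hq))
    (fun q hq => k4 q (sub hq)) (j1.mono sub) (fun q hq => j2 q (sub hq))
    (fun q hq => j4 q (sub hq)) hH hder
  obtain ⟨u, s, hus, hul, hsl⟩ := hf_eigs l0 L.l1 L.m1 t00 ht hd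
  have hyp := hf_hyp L.l1 L.m1 t00 hul hsl l0
  set a : ℂ × ℂ := f^[k] (gam g R η) with ha
  have a1 : a = (a.1, ws f R a.1) := Prod.ext rfl (sub_eq_zero.1 hH.hy)
  have aR : ‖a.1‖ < R := hH.ξr.trans hrR
  have a0 : a ≠ 0 := fun h0 => hH.ξ0 (by rw [← ha, h0]; rfl)
  have hz0 := hzl.eventually (isOpen_ne.mem_nhds a0)
  obtain ⟨N0, hN0⟩ := eventually_atTop.1 (hzp.and (hyp.and hz0))
  set N := k + N0 + 1 with hN
  set pp : ℕ → ℂ × ℂ := fun n => f^[(Nat.unpair n).1] (z (n - k)) with hpp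
  have hper : ∀ n, N ≤ n → f^[n] (z (n - k)) = z (n - k) := by
    intro n hn
    have := (hN0 (n - k) (by omega)).1
    rwa [show k + (n - k) = n by omega] at this
  have hper2 : ∀ n, N ≤ n → f^[n] (pp n) = pp n := by
    intro n hn
    simp only [hpp]
    rw [← iterate_add_apply, add_comm, iterate_add_apply, hper n hn]
  have heig : ∀ n, N ≤ n → ∀ w, w ^ 2 - (u (n - k) + s (n - k)) * w + u (n - k) * s (n - k) = 0 →
      ∃ v : ℂ × ℂ, v ≠ 0 ∧ fderiv ℂ (f^[n]) (pp n) v = w • v := by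
    intro n hn w hw
    apply h.eig_tr (hper n hn)
    apply hf_eig
    rw [(hus _).1, (hus _).2, show k + (n - k) = n by omega] at hw
    exact hw
  have hfj : ∀ j, Continuous (f^[j]) := fun j => (L.dif.iterate j).continuous
  have seq : ∀ j, Tendsto (fun b => pp (Nat.pair j b)) atTop (𝓝 (f^[j] a)) := by
    intro j
    have h1 : Tendsto (fun b => Nat.pair j b - k) atTop atTop :=
      (tendsto_sub_atTop_nat k).comp (tendsto_atTop_mono (fun b => Nat.right_le_pair j b) tendsto_id)
    have h2 := ((hfj j).tendsto _).comp (hzl.comp h1)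
    refine h2.congr fun b => ?_
    simp [hpp, Nat.unpair_pair]
  have seqN : ∀ j, ∀ᶠ b in atTop, N ≤ Nat.pair j b := fun j =>
    (tendsto_atTop_mono (fun b => Nat.right_le_pair j b) tendsto_id).eventually_ge_atTop N
  have fja : Tendsto (fun j => f^[j] a) atTop (𝓝 0) := by
    rw [tendsto_zero_iff_norm_tendsto_zero]
    refine squeeze_zero (fun _ => norm_nonneg _) (fun j => ?_) (L.pow_lim ‖a.1‖)
    have := L.ws_lim aR.le j
    rw [← a1, mul_comm] at this
    exact this
  have fjb : ∀ j, ‖f^[j] a‖ < R := by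
    intro j
    have := L.ws_lim aR.le j
    rw [← a1] at this
    have h2 : θ ^ j * ‖a.1‖ ≤ ‖a.1‖ :=
      mul_le_of_le_one_left (norm_nonneg _) (pow_le_one₀ L.θ0.le L.θ1.le)
    linarith
  have fjs : ∀ j, f^[j] a = ((f^[j] a).1, ws f R (f^[j] a).1) := fun j =>
    Prod.ext rfl (L.ws_uniq fun i => by rw [← iterate_add_apply]; exact (fjb _).le)
  have g0 : g 0 = 0 := by have := h.left 0; rwa [L.fix] at this
  have finj : ∀ j w, f^[j] w = 0 → w = 0 := by
    intro j w hw
    have := h.gf j w; rw [hw, iterate_fixed g0] at this; exact this.symm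
  refine ⟨d0 / t0 / l ^ k, t0 / m ^ k, N, pp, fun n => s (n - k), fun n => u (n - k),
    div_ne_zero (div_ne_zero d00 t00) (pow_ne_zero _ l0), div_ne_zero t00 (pow_ne_zero _ m0),
    by omega, fun n hn => ⟨hper2 n hn, heig n hn _ (by ring), heig n hn _ (by ring),
      (hN0 (n - k) (by omega)).2.1.1, (hN0 (n - k) (by omega)).2.1.2⟩, ?_, ?_, ?_, ?_⟩
  · refine ((hsl.comp (tendsto_sub_atTop_nat k)).div_const (l ^ k)).congr' ?_
    filter_upwards [eventually_ge_atTop k] with n hn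
    simp only [comp]
    rw [div_div, ← pow_add, Nat.sub_add_cancel hn]
  · refine ((hul.comp (tendsto_sub_atTop_nat k)).div_const (m ^ k)).congr' ?_
    filter_upwards [eventually_ge_atTop k] with n hn
    simp only [comp]
    rw [div_div, ← pow_add, Nat.sub_add_cancel hn]
  · refine isClosed_closure.mem_of_tendsto fja (Eventually.of_forall fun j => ?_)
    exact mem_closure_of_tendsto (seq j) ((seqN j).mono fun b hb => ⟨_, hb, rfl⟩)
  · intro G hG hGp
    refine h.zar hG (S := {w | ‖w.1‖ < R ∧ yh f R w ≠ 0 ∧ G w = 0}) (fun w hw => hw)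
      (x := fun j => (f^[j] a).1) (fun j => (norm_fst_le _).trans_lt (fjb j)) ?_ ?_ ?_
    · intro j h0
      have := fjs j
      rw [h0, L.ws_zero] at this
      exact a0 (finj j a this)
    · exact (continuous_fst.tendsto (0 : ℂ × ℂ)).comp fja
    · intro j
      rw [← fjs j]
      have e1 := (((continuous_fst.tendsto _).comp (seq j)).norm.eventually
        (gt_mem_nhds ((norm_fst_le _).trans_lt (fjb j))))
      refine mem_closure_of_tendsto (seq j) ?_
      filter_upwards [seqN j, e1] with b hb hb1
      refine ⟨hb1, fun hy => ?_, hGp _ hb⟩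
      have := L.ws_per (le_of_lt hb1) hy (by omega) (hper2 _ hb)
      have := finj _ _ this
      exact (hN0 _ (by omega)).2.2 this
end

open Function Set Filter Topology
noncomputable section
variable {f g : ℂ × ℂ → ℂ × ℂ} {l m : ℂ} {θ ε R : ℝ}

lemma hi_close {f : ℂ × ℂ → ℂ × ℂ} (hf : Differentiable ℂ f) (h : fderiv ℂ f 0 = dg l m) {ε : ℝ}
    (hε : 0 < ε) : ∃ R > 0, ∀ z : ℂ × ℂ, ‖z‖ ≤ R → ‖fderiv ℂ f z - dg l m‖ ≤ ε := by
  have hc : ContinuousAt (fderiv ℂ f) 0 := ha_fderiv_cont (Eventually.of_forall fun w => hf w)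
  obtain ⟨r, hr, h1⟩ := Metric.continuousAt_iff.1 hc ε hε
  refine ⟨r / 2, by positivity, fun z hz => ?_⟩
  have := h1 (x := z) (by rw [dist_zero_right]; linarith)
  rw [h, dist_eq_norm] at this
  exact this.le

lemma hi_sys (hf : Differentiable ℂ f) (hg : Differentiable ℂ g) (hl : ∀ z, g (f z) = z)
    (hr : ∀ z, f (g z) = z) (h0 : f 0 = 0) (hd : fderiv ℂ f 0 = dg l m) (h1 : ‖l‖ < 1)
    (h2 : 1 < ‖m‖) : ∃ θ ε R, Sys f g l m θ ε R := by
  have g0 : g 0 = 0 := by have := hl 0; rwa [h0] at this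
  have hcomp : (fderiv ℂ g 0).comp (dg l m) = ContinuousLinearMap.id ℂ (ℂ × ℂ) := by
    have e1 : HasFDerivAt (fun z => g (f z)) ((fderiv ℂ g 0).comp (dg l m)) 0 := by
      have a1 : HasFDerivAt f (dg l m) 0 := hd ▸ (hf 0).hasFDerivAt
      have a2 : HasFDerivAt g (fderiv ℂ g 0) (f 0) := by rw [h0]; exact (hg 0).hasFDerivAt
      exact a2.comp 0 a1
    have e2 : (fun z => g (f z)) = id := funext hl
    rw [e2] at e1
    exact e1.unique (hasFDerivAt_id _)
  have hv : ∀ v, fderiv ℂ g 0 (dg l m v) = v := fun v => by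
    have := congrArg (fun T => T v) hcomp
    exact this
  have m0 : m ≠ 0 := by rintro rfl; simp at h2; linarith
  have l0 : l ≠ 0 := by
    rintro rfl
    have := hv (1, 0)
    have e : dg 0 m (1, 0) = 0 := by simp
    rw [e, map_zero] at this
    exact one_ne_zero (congrArg Prod.fst this).symm
  have gder : fderiv ℂ g 0 = dg l⁻¹ m⁻¹ := by
    refine ContinuousLinearMap.ext fun v => ?_
    have := hv (dg l⁻¹ m⁻¹ v)
    rw [← this]
    congr 1
    simp [l0, m0]
  let S : ℂ × ℂ →L[ℂ] ℂ × ℂ := (ContinuousLinearMap.snd ℂ ℂ ℂ).prod (ContinuousLinearMap.fst ℂ ℂ ℂ)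
  have hS : ∀ z, S z = z.swap := fun z => rfl
  have swe : sw g = fun z => S (g (S z)) := rfl
  have swd : Differentiable ℂ (sw g) := by
    rw [swe]
    exact S.differentiable.comp (hg.comp S.differentiable)
  have swder : fderiv ℂ (sw g) 0 = dg m⁻¹ l⁻¹ := by
    have a0 : HasFDerivAt g (dg l⁻¹ m⁻¹) (S 0) := by
      rw [map_zero, ← gder]; exact (hg 0).hasFDerivAt
    have a1 : HasFDerivAt (fun z => S (g (S z))) (S.comp ((dg l⁻¹ m⁻¹).comp S)) 0 :=
      S.hasFDerivAt.comp 0 (a0.comp 0 S.hasFDerivAt)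
    rw [swe, a1.fderiv]
    refine ContinuousLinearMap.ext fun v => ?_
    simp [hS]
  have lp : 0 < ‖l‖ := norm_pos_iff.2 l0
  have mi : ‖m‖⁻¹ < 1 := inv_lt_one_of_one_lt₀ h2
  obtain ⟨θ, t1, t2⟩ := exists_between (max_lt h1 mi)
  obtain ⟨t3, t4⟩ := max_lt_iff.1 t1
  have θ0 : 0 < θ := lp.trans t3
  have t5 : θ⁻¹ < ‖m‖ := by
    rw [inv_lt_comm₀ θ0 (by linarith)]; exact t4
  have t6 : θ⁻¹ < ‖l‖⁻¹ := by
    rw [inv_lt_inv₀ θ0 lp]; exact t3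
  let ε := min (min (θ - ‖l‖) (θ - ‖m‖⁻¹)) (min (‖m‖ - θ⁻¹) (‖l‖⁻¹ - θ⁻¹))
  have ε0 : 0 < ε := lt_min (lt_min (by linarith) (by linarith)) (lt_min (by linarith) (by linarith))
  have e1 : ε ≤ θ - ‖l‖ := (min_le_left _ _).trans (min_le_left _ _)
  have e2 : ε ≤ θ - ‖m‖⁻¹ := (min_le_left _ _).trans (min_le_right _ _)
  have e3 : ε ≤ ‖m‖ - θ⁻¹ := (min_le_right _ _).trans (min_le_left _ _)
  have e4 : ε ≤ ‖l‖⁻¹ - θ⁻¹ := (min_le_right _ _).trans (min_le_right _ _)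
  obtain ⟨R1, p1, c1⟩ := hi_close hf hd ε0
  obtain ⟨R2, p2, c2⟩ := hi_close swd swder ε0
  refine ⟨θ, ε, min R1 R2, ⟨?_, ?_, hl, hr⟩⟩
  · exact ⟨lt_min p1 p2, θ0, t2, ε0, by linarith, by linarith, l0, hf, h0, hd,
      fun z hz => c1 z (hz.trans (min_le_left _ _))⟩
  · exact ⟨lt_min p1 p2, θ0, t2, ε0, by rw [norm_inv]; linarith, by rw [norm_inv]; linarith,
      inv_ne_zero m0, swd, by simp [swe, g0], swder,
      fun z hz => c2 z (hz.trans (min_le_right _ _))⟩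

lemma hi_basis {T : (ℂ × ℂ) →L[ℂ] ℂ × ℂ} {v w : ℂ × ℂ} (hv : v ≠ 0) (hw : w ≠ 0)
    (h1 : T v = l • v) (h2 : T w = m • w) (hlm : l ≠ m) :
    ∃ B : (ℂ × ℂ) ≃L[ℂ] (ℂ × ℂ), ∀ z, B z = z.1 • v + z.2 • w := by
  let A : (ℂ × ℂ) →L[ℂ] ℂ × ℂ := (ContinuousLinearMap.fst ℂ ℂ ℂ).smulRight v +
    (ContinuousLinearMap.snd ℂ ℂ ℂ).smulRight w
  have hA : ∀ z, A z = z.1 • v + z.2 • w := fun z => rfl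
  obtain ⟨B, hB⟩ := hf_inj (A := A) (by
    rintro ⟨x, y⟩ h
    rw [hA] at h
    simp only at h
    have h3 : x • l • v + y • m • w = 0 := by
      rw [← h1, ← h2, ← map_smul, ← map_smul, ← map_add, h, map_zero]
    have h4 : ((l - m) * x) • v = 0 := by
      have : ((l - m) * x) • v = (x • l • v + y • m • w) - m • (x • v + y • w) := by module
      rw [this, h3, h, smul_zero, sub_zero]
    have hx : x = 0 := by
      rcases smul_eq_zero.1 h4 with h5 | h5
      · exact (mul_eq_zero.1 h5).resolve_left (sub_ne_zero.2 hlm)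
      · exact absurd h5 hv
    subst hx
    have hy : y = 0 := by
      rw [zero_smul, zero_add] at h
      exact (smul_eq_zero.1 h).resolve_right hw
    subst hy
    rfl)
  refine ⟨B, fun z => ?_⟩
  rw [← hA, ← hB]
  rfl

theorem hi_main
    (f finv : ℂ × ℂ → ℂ × ℂ)
    (hfd : Differentiable ℂ f) (hfinvd : Differentiable ℂ finv)
    (hleft : ∀ z, finv (f z) = z) (hright : ∀ z, f (finv z) = z)
    (p : ℂ × ℂ) (hfix : f p = p) (lams lamu : ℂ)
    (hs : ∃ v, v ≠ 0 ∧ (fderiv ℂ f p) v = lams • v)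
    (hu : ∃ v, v ≠ 0 ∧ (fderiv ℂ f p) v = lamu • v)
    (hsn : ‖lams‖ < 1) (hun : 1 < ‖lamu‖)
    (τ : ℂ × ℂ) (hτp : τ ≠ p)
    (hhomos : Tendsto (fun n : ℕ => f^[n] τ) atTop (nhds p))
    (hhomou : Tendsto (fun n : ℕ => finv^[n] τ) atTop (nhds p)) :
    ∃ (c c' : ℂ) (N : ℕ) (pp : ℕ → ℂ × ℂ) (ls lu : ℕ → ℂ),
      c ≠ 0 ∧ c' ≠ 0 ∧ 1 ≤ N ∧
      (∀ n, N ≤ n → f^[n] (pp n) = pp n ∧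
        (∃ v, v ≠ 0 ∧ (fderiv ℂ (f^[n]) (pp n)) v = (ls n) • v) ∧
        (∃ v, v ≠ 0 ∧ (fderiv ℂ (f^[n]) (pp n)) v = (lu n) • v) ∧
        ‖ls n‖ < 1 ∧ 1 < ‖lu n‖) ∧
      Tendsto (fun n : ℕ => ls n / lams ^ n) atTop (nhds c) ∧
      Tendsto (fun n : ℕ => lu n / lamu ^ n) atTop (nhds c') ∧
      p ∈ closure {x : ℂ × ℂ | ∃ n, N ≤ n ∧ pp n = x} ∧
      ∀ g : ℂ × ℂ → ℂ, Differentiable ℂ g →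
        (∀ n, N ≤ n → g (pp n) = 0) → ∀ z, g z = 0 := by
  obtain ⟨v, v0, hv⟩ := hs
  obtain ⟨w, w0, hw⟩ := hu
  obtain ⟨B, hB⟩ := hi_basis v0 w0 hv hw (by rintro rfl; linarith)
  let A : ℂ × ℂ → ℂ × ℂ := fun z => p + B z
  let Ai : ℂ × ℂ → ℂ × ℂ := fun z => B.symm (z - p)
  have AAi : ∀ z, A (Ai z) = z := fun z => by simp [A, Ai]
  have AiA : ∀ z, Ai (A z) = z := fun z => by simp [A, Ai]
  have A0 : A 0 = p := by simp [A]
  have Aip : Ai p = 0 := by simp [Ai]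
  have dA : ∀ z, HasFDerivAt A (B : (ℂ × ℂ) →L[ℂ] ℂ × ℂ) z := fun z =>
    B.hasFDerivAt.const_add p
  have dAi : ∀ z, HasFDerivAt Ai (B.symm : (ℂ × ℂ) →L[ℂ] ℂ × ℂ) z := fun z =>
    HasFDerivAt.comp (g := B.symm) (f := fun z => z - p) z B.symm.hasFDerivAt
      ((hasFDerivAt_id z).sub_const p)
  have DA : Differentiable ℂ A := fun z => (dA z).differentiableAt
  have DAi : Differentiable ℂ Ai := fun z => (dAi z).differentiableAt
  have conjd : ∀ (F : ℂ × ℂ → ℂ × ℂ) (z : ℂ × ℂ), Differentiable ℂ F →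
      ∀ u, fderiv ℂ (fun x => Ai (F (A x))) z u = B.symm (fderiv ℂ F (A z) (B u)) := by
    intro F z hF u
    have h1 : HasFDerivAt (fun x => F (A x)) ((fderiv ℂ F (A z)).comp (B : (ℂ × ℂ) →L[ℂ] ℂ × ℂ)) z :=
      (hF (A z)).hasFDerivAt.comp z (dA z)
    have h2 := HasFDerivAt.comp (g := Ai) (f := fun x => F (A x)) z (dAi _) h1
    have h3 : (fun x => Ai (F (A x))) = Ai ∘ (fun x => F (A x)) := rfl
    rw [h3, h2.fderiv]
    rfl
  have iter : ∀ (F : ℂ × ℂ → ℂ × ℂ) (n : ℕ),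
      (fun x => Ai (F (A x)))^[n] = fun x => Ai (F^[n] (A x)) := by
    intro F n
    induction n with
    | zero => funext x; simp [AiA]
    | succ n ih =>
      funext x
      rw [iterate_succ_apply', ih, iterate_succ_apply', AAi]
  obtain ⟨θ, ε, R, h⟩ := hi_sys (f := fun x => Ai (f (A x))) (g := fun x => Ai (finv (A x)))
    (l := lams) (m := lamu) (DAi.comp (hfd.comp DA)) (DAi.comp (hfinvd.comp DA))
    (fun z => by simp only [AAi, hleft, AiA]) (fun z => by simp only [AAi, hright, AiA])
    (by simp only [A0, hfix, Aip]) (by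
      refine ContinuousLinearMap.ext fun u => ?_
      rw [conjd f 0 hfd u, A0, hB, map_add, map_smul, map_smul, hv, hw, B.symm_apply_eq, hB]
      simp only [dg_apply]
      module) hsn hun
  have fd : ∀ n, Differentiable ℂ (f^[n]) := fun n => hfd.iterate n
  obtain ⟨c, c', N, pp, ls, lu, h1, h2, h3, h4, h5, h6, h7, h8⟩ := h.main (τ := Ai τ)
    (fun e => hτp (by rw [← AAi τ, e, A0]))
    (by
      have := (DAi.continuous.tendsto p).comp hhomos
      rw [Aip] at this
      refine this.congr fun n => ?_
      simp only [iter, AAi, Function.comp_apply])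
    (by
      have := (DAi.continuous.tendsto p).comp hhomou
      rw [Aip] at this
      refine this.congr fun n => ?_
      simp only [iter, AAi, Function.comp_apply])
  have eig : ∀ n (q : ℂ × ℂ) (lam : ℂ),
      (∃ v, v ≠ 0 ∧ fderiv ℂ ((fun x => Ai (f (A x)))^[n]) q v = lam • v) →
      ∃ v, v ≠ 0 ∧ fderiv ℂ (f^[n]) (A q) v = lam • v := by
    rintro n q lam ⟨u, u0, hu⟩
    refine ⟨B u, fun e => u0 (by simpa using e), ?_⟩
    rw [iter, conjd _ _ (fd n), B.symm_apply_eq, map_smul] at hu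
    exact hu
  refine ⟨c, c', N, fun n => A (pp n), ls, lu, h1, h2, h3, fun n hn => ?_, h5, h6, ?_, ?_⟩
  · obtain ⟨k1, k2, k3, k4, k5⟩ := h4 n hn
    refine ⟨?_, eig _ _ _ k2, eig _ _ _ k3, k4, k5⟩
    rw [iter] at k1
    have := congrArg A k1
    simpa only [AAi] using this
  · have := image_closure_subset_closure_image DA.continuous (mem_image_of_mem A h7)
    rw [A0] at this
    refine closure_mono ?_ this
    rintro _ ⟨_, ⟨n, hn, rfl⟩, rfl⟩
    exact ⟨n, hn, rfl⟩
  · intro g hg hz z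
    have := h8 (fun x => g (A x)) (hg.comp DA) hz (Ai z)
    simpa only [AAi] using this
end

/-- a saddle fixed point of a biholomorphism of `ℂ²` which admits a
homoclinic intersection is accumulated by saddle periodic points `pₙ` of period `n`
whose stable and unstable multipliers satisfy `λˢₙ ~ c (λˢ)ⁿ` and `λᵘₙ ~ c' (λᵘ)ⁿ`;
moreover the sequence can be chosen dense for the complex-analytic Zariski topology. -/
theorem homoclinic_multipliers
    (f finv : ℂ × ℂ → ℂ × ℂ)
    (hfd : Differentiable ℂ f) (hfinvd : Differentiable ℂ finv)
    (hleft : ∀ z, finv (f z) = z) (hright : ∀ z, f (finv z) = z)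
    (p : ℂ × ℂ) (hfix : f p = p) (lams lamu : ℂ)
    (hs : IsEigenvalue (fderiv ℂ f p) lams) (hu : IsEigenvalue (fderiv ℂ f p) lamu)
    (hsn : ‖lams‖ < 1) (hun : 1 < ‖lamu‖)
    (τ : ℂ × ℂ) (hτp : τ ≠ p)
    (hhomos : Tendsto (fun n : ℕ => f^[n] τ) atTop (nhds p))
    (hhomou : Tendsto (fun n : ℕ => finv^[n] τ) atTop (nhds p)) :
    ∃ (c c' : ℂ) (N : ℕ) (pp : ℕ → ℂ × ℂ) (ls lu : ℕ → ℂ),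
      c ≠ 0 ∧ c' ≠ 0 ∧ 1 ≤ N ∧
      (∀ n, N ≤ n → f^[n] (pp n) = pp n ∧
        IsEigenvalue (fderiv ℂ (f^[n]) (pp n)) (ls n) ∧
        IsEigenvalue (fderiv ℂ (f^[n]) (pp n)) (lu n) ∧
        ‖ls n‖ < 1 ∧ 1 < ‖lu n‖) ∧
      Tendsto (fun n : ℕ => ls n / lams ^ n) atTop (nhds c) ∧
      Tendsto (fun n : ℕ => lu n / lamu ^ n) atTop (nhds c') ∧
      p ∈ closure {x : ℂ × ℂ | ∃ n, N ≤ n ∧ pp n = x} ∧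
      ∀ g : ℂ × ℂ → ℂ, Differentiable ℂ g →
        (∀ n, N ≤ n → g (pp n) = 0) → ∀ z, g z = 0 := by
  exact hi_main f finv hfd hfinvd hleft hright p hfix lams lamu hs hu hsn hun τ hτp hhomos hhomou
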